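/- Let φ be an anisotropic nonquasilinear quadratic form over F, and let h be a positive integer. Then the following are equivalent: (1) φ is strongly excellent of nondefective height h; (2) there exist anisotropic Pfister forms π₀, π₁, …, π_{h−1} over F, an anisotropic quasilinear quadratic form τ over F, and a scalar a ∈ F^× such that: (i) φ ~ a(π₀ ⊥ π₁ ⊥ ⋯ ⊥ π_{h−1} ⊥ τ); (ii) for all 1 ≤ i < h, π_i is a proper subform of π_{i−1}; (iii) τ ≺ π_{h−1} and dim τ < (dim π_{h−1})/2; (iv) if τ = 0, then dim π_{h−2} > 2·dim π_{h−1}. -/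

import Mathlib

/-!  Common framework: quadratic forms over a field of characteristic 2, presented by
coefficient matrices, together with the standard invariants used in the paper
"Rationality of cycles modulo 2 on products of generically smooth quadrics in
characteristic 2" by S. Scully and G. Zhu. -/

open scoped TensorProduct

/-- A quadratic form of dimension `n` over `F`, presented by an `n × n` coefficient
matrix `q`: the associated quadratic form is `x ↦ ∑ i j, q i j * x i * x j`. -/
abbrev QF (F : Type) (n : ℕ) := Matrix (Fin n) (Fin n) F

namespace QF

section Basic

variable {F : Type} [Field F]

/-- The value of a quadratic form at a vector. -/
def eval {n : ℕ} (q : QF F n) (x : Fin n → F) : F := ∑ i, ∑ j, q i j * x i * x j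

/-- The polar bilinear form of `q`. -/
def polar {n : ℕ} (q : QF F n) (x y : Fin n → F) : F :=
  eval q (x + y) - eval q x - eval q y

/-- `q` is isotropic: it vanishes at some nonzero vector. -/
def Isotropic {n : ℕ} (q : QF F n) : Prop := ∃ x, x ≠ 0 ∧ eval q x = 0

/-- `q` is anisotropic: it vanishes only at `0`. -/
def Anisotropic {n : ℕ} (q : QF F n) : Prop := ∀ x, eval q x = 0 → x = 0

/-- The zero form `d ⬝ ⟨0⟩` of dimension `d`. -/
def zeroForm (d : ℕ) : QF F d := 0

/-- Isometry of quadratic forms. -/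
def Isom {n m : ℕ} (q : QF F n) (q' : QF F m) : Prop :=
  ∃ e : (Fin n → F) ≃ₗ[F] (Fin m → F), ∀ x, eval q' (e x) = eval q x

/-- Orthogonal sum of quadratic forms. -/
def orthSum {n m : ℕ} (q : QF F n) (q' : QF F m) : QF F (n + m) :=
  Matrix.reindex finSumFinEquiv finSumFinEquiv (Matrix.fromBlocks q 0 0 q')

/-- The binary quadratic form `[a, b] : (x, y) ↦ a x² + x y + b y²`. -/
def binary (a b : F) : QF F 2 := !![a, 1; 0, b]

/-- The orthogonal sum of the binary forms `[a i, b i]`, `i = 0, …, r - 1`. -/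
def binSum {r : ℕ} (a b : Fin r → F) : QF F (r + r) :=
  Matrix.reindex finSumFinEquiv finSumFinEquiv
    (Matrix.fromBlocks (Matrix.diagonal a) 1 0 (Matrix.diagonal b))

/-- The split form `w ⬝ ℍ`, the orthogonal sum of `w` hyperbolic planes. -/
def hyper (w : ℕ) : QF F (w + w) := binSum 0 0

/-- The quasilinear (diagonal) quadratic form `⟨c 0, …, c (s - 1)⟩`. -/
def diag {s : ℕ} (c : Fin s → F) : QF F s := Matrix.diagonal c

/-- `q` has type `(r, s)` with quasilinear part `⟨c⟩`, i.e.
`q ≃ [a 0, b 0] ⊥ ⋯ ⊥ [a (r-1), b (r-1)] ⊥ ⟨c⟩` for some `a b`. -/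
def HasTypeWith {n : ℕ} (q : QF F n) (r s : ℕ) (c : Fin s → F) : Prop :=
  ∃ a b : Fin r → F, Isom q (orthSum (binSum a b) (diag c))

/-- `q` has type `(r, s)`. -/
def HasType {n : ℕ} (q : QF F n) (r s : ℕ) : Prop := ∃ c : Fin s → F, HasTypeWith q r s c

/-- `q` is quasilinear, i.e. isometric to a diagonal form. -/
def IsQuasilinear {n : ℕ} (q : QF F n) : Prop := ∃ c : Fin n → F, Isom q (diag c)

/-- The isotropy index `i₀(q)`: the maximal dimension of a totally isotropic subspace. -/
noncomputable def i0 {n : ℕ} (q : QF F n) : ℕ :=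
  sSup {d | ∃ W : Submodule F (Fin n → F), Module.finrank F W = d ∧ ∀ x ∈ W, eval q x = 0}

/-- The defect index `i_d(q)`: the maximal dimension of a totally isotropic subspace
contained in the radical of the polar form (equivalently, the isotropy index of the
quasilinear part of `q`, in characteristic 2). -/
noncomputable def defect {n : ℕ} (q : QF F n) : ℕ :=
  sSup {d | ∃ W : Submodule F (Fin n → F), Module.finrank F W = d ∧
    (∀ x ∈ W, eval q x = 0) ∧ ∀ x ∈ W, ∀ y, polar q x y = 0}

/-- `q` is nondefective. -/
def Nondefective {n : ℕ} (q : QF F n) : Prop := defect q = 0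

/-- The Witt index `i_W(q)`: the maximal number of hyperbolic planes splitting off `q`. -/
noncomputable def wittIndex {n : ℕ} (q : QF F n) : ℕ :=
  sSup {w | ∃ (m : ℕ) (q' : QF F m), Isom q (orthSum q' (hyper w))}

/-- `qa` is the anisotropic part of `q`: `qa` is anisotropic and
`q ≃ qa ⊥ w ⬝ ℍ ⊥ d ⬝ ⟨0⟩` (Witt decomposition). -/
def IsAnisotropicPart {n m : ℕ} (q : QF F n) (qa : QF F m) : Prop :=
  Anisotropic qa ∧ ∃ w d : ℕ, Isom q (orthSum (orthSum qa (hyper w)) (zeroForm d))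

/-- Witt equivalence: `q` and `q'` have isometric anisotropic parts. -/
def WittEquiv {n m : ℕ} (q : QF F n) (q' : QF F m) : Prop :=
  ∃ (k : ℕ) (qa : QF F k), IsAnisotropicPart q qa ∧ IsAnisotropicPart q' qa

/-- `p` is dominated by `q` (`p ≺ q`): `p` is isometric to the restriction of `q` to a
subspace of the underlying space of `q`. -/
def Dominated {m n : ℕ} (p : QF F m) (q : QF F n) : Prop :=
  ∃ f : (Fin m → F) →ₗ[F] (Fin n → F), Function.Injective f ∧ ∀ x, eval q (f x) = eval p x

/-- `p` is a subform (orthogonal direct summand) of `q`. -/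
def Subform {m n : ℕ} (p : QF F m) (q : QF F n) : Prop :=
  ∃ (k : ℕ) (p' : QF F k), Isom q (orthSum p p')

/-- Base change of a quadratic form along a field extension `K/F`. -/
def baseChange {n : ℕ} (q : QF F n) (K : Type) [Field K] [Algebra F K] : QF K n :=
  q.map (algebraMap F K)

/-- Transport a quadratic form along an equality of dimensions. -/
def castQF {n m : ℕ} (h : n = m) (q : QF F n) : QF F m :=
  Matrix.reindex (finCongr h) (finCongr h) q

/-- The orthogonal sum of the first `h` members of a family of quadratic forms. -/
noncomputable def sumFam {D : ℕ → ℕ} (f : ∀ i, QF F (D i)) :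
    (h : ℕ) → QF F (∑ i ∈ Finset.range h, D i)
  | 0 => castQF (by simp) (zeroForm 0)
  | h + 1 => castQF (Finset.sum_range_succ D h).symm (orthSum (sumFam f h) (f h))

/-- The Gram matrix of the `k`-fold bilinear Pfister form `⟪a 0, …, a (k-1)⟫_b`. -/
noncomputable def bPfister {k : ℕ} (a : Fin k → F) :
    Matrix (Fin (2 ^ k)) (Fin (2 ^ k)) F :=
  Matrix.reindex finFunctionFinEquiv finFunctionFinEquiv
    (Matrix.diagonal fun f : Fin k → Fin 2 => ∏ i, if f i = 1 then a i else 1)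

/-- The `(k+1)`-fold quadratic Pfister form `⟪a 0, …, a (k-1)⟫_b ⊗ [1, c]`. -/
noncomputable def qPfister {k : ℕ} (a : Fin k → F) (c : F) : QF F (2 ^ k * 2) :=
  Matrix.reindex finProdFinEquiv finProdFinEquiv
    (Matrix.kroneckerMap (· * ·) (bPfister a) (binary 1 c))

/-- `π` is a `(k+1)`-fold quadratic Pfister form. -/
def IsPfister {m : ℕ} (k : ℕ) (π : QF F m) : Prop :=
  ∃ (a : Fin k → F) (c : F), Isom π (qPfister a c)

/-- `π` is a general `(k+1)`-fold Pfister form: a nonzero scalar multiple of a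
`(k+1)`-fold quadratic Pfister form. -/
def IsGenPfister {m : ℕ} (k : ℕ) (π : QF F m) : Prop :=
  ∃ d : F, d ≠ 0 ∧ ∃ (a : Fin k → F) (c : F), Isom π (d • qPfister a c)

/-- `q` is a Pfister neighbour: `2 ^ k < dim q ≤ 2 ^ (k + 1)` and `q` is dominated by a
general `(k+1)`-fold Pfister form (domination forces `dim q ≤ 2 ^ (k + 1)`). -/
def IsPfisterNeighbour {n : ℕ} (q : QF F n) : Prop :=
  ∃ (k : ℕ) (π : QF F (2 ^ k * 2)), 2 ^ k < n ∧ IsGenPfister k π ∧ Dominated q π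

/-- `qc` is the complementary form of the Pfister neighbour `q` in its ambient general
Pfister form `π`: it is the nondefective form of dimension `2 ^ (k + 1) - dim q` which is
Witt equivalent to `q ⊥ π` (this pins down `qc` up to isometry). -/
def IsComplement {n k m : ℕ} (q : QF F n) (π : QF F (2 ^ k * 2)) (qc : QF F m) : Prop :=
  m = 2 ^ k * 2 - n ∧ Nondefective qc ∧ WittEquiv (orthSum q π) qc

/-- `qc` is the complementary form of the Pfister neighbour `q`. -/
def IsComplementOf {n m : ℕ} (q : QF F n) (qc : QF F m) : Prop :=
  ∃ (k : ℕ) (π : QF F (2 ^ k * 2)), 2 ^ k < n ∧ IsGenPfister k π ∧ Dominated q π ∧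
    IsComplement q π qc

/-- The polynomial of the quadric `{q = 0}` in the affine chart where the last
projective coordinate equals `1`. -/
noncomputable def affinePoly {n : ℕ} (q : QF F n) : MvPolynomial (Fin (n - 1)) F :=
  ∑ i : Fin n, ∑ j : Fin n,
    MvPolynomial.C (q i j) *
      (if h : (i : ℕ) < n - 1 then MvPolynomial.X (⟨(i : ℕ), h⟩ : Fin (n - 1)) else 1) *
      (if h : (j : ℕ) < n - 1 then MvPolynomial.X (⟨(j : ℕ), h⟩ : Fin (n - 1)) else 1)

/-- `K` is a model of the function field `F(q)` of the projective quadric `{q = 0}`: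
`K` is the fraction field of the affine coordinate ring of the (dense) standard affine
chart of the quadric. -/
def IsFunctionField {n : ℕ} (q : QF F n) (K : Type) [Field K] [Algebra F K] : Prop :=
  ∃ f : MvPolynomial (Fin (n - 1)) F →ₐ[F] K,
    RingHom.ker f = Ideal.span {affinePoly q} ∧
    IntermediateField.adjoin F (Set.range fun i => f (MvPolynomial.X i)) = ⊤

end Basic

/-- A bundled field extension of `F`. -/
structure FieldExt (F : Type) [Field F] : Type 1 where
  carrier : Type
  [fieldInst : Field carrier]
  [algInst : Algebra F carrier]

attribute [instance] FieldExt.fieldInst FieldExt.algInst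

/-- `K/F` is a separable field extension (MacLane's criterion: `K ⊗_F L` is reduced for
every purely inseparable extension `L/F`). -/
def IsSepExt (F : Type) [Field F] (K : Type) [Field K] [Algebra F K] : Prop :=
  ∀ (L : Type) [Field L] [Algebra F L], IsPurelyInseparable F L → IsReduced (K ⊗[F] L)

/-- `K/F` is purely transcendental: `K` is generated over `F` by an algebraically
independent subset. -/
def IsPurelyTranscendentalExt (F : Type) [Field F] (K : Type) [Field K] [Algebra F K] :
    Prop :=
  ∃ s : Set K, AlgebraicIndependent F (fun x : s => (x : K)) ∧
    IntermediateField.adjoin F s = ⊤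

section Invariants

variable {F : Type} [Field F]

/-- `p` and `q` are stably birationally equivalent: over every field extension of `F`,
`p` is isotropic if and only if `q` is (for anisotropic forms of dimension at least 2
this is equivalent to stable birationality of the associated projective quadrics). -/
def SBEquiv {m n : ℕ} (p : QF F m) (q : QF F n) : Prop :=
  ∀ (K : Type) [Field K] [Algebra F K],
    (Isotropic (baseChange p K) ↔ Isotropic (baseChange q K))

/-- The first higher isotropy index `i₁(q)` of an anisotropic form: the minimal positive
isotropy index attained over field extensions of `F`. -/
noncomputable def i1 {n : ℕ} (q : QF F n) : ℕ :=
  sInf {i | 0 < i ∧ ∃ K : FieldExt F, i0 (baseChange q K.carrier) = i}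

/-- The Izhboldin dimension `dim q - i₁(q)`. -/
noncomputable def izh {n : ℕ} (q : QF F n) : ℕ := n - i1 q

/-- The nondefective splitting pattern of a nondefective form `q`: the set of Witt
indices attained by `q` over separable field extensions of `F`. -/
def splittingPattern {n : ℕ} (q : QF F n) : Set ℕ :=
  {w | ∃ K : FieldExt F, IsSepExt F K.carrier ∧ wittIndex (baseChange q K.carrier) = w}

/-- The nondefective height `h_nd(q)`. -/
noncomputable def hnd {n : ℕ} (q : QF F n) : ℕ := (splittingPattern q).ncard - 1

/-- `jrel q t = j_t(q)`: the `t`-th value (in increasing order) of the nondefective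
splitting pattern of `q`. -/
noncomputable def jrel {n : ℕ} (q : QF F n) (t : ℕ) : ℕ :=
  sInf {w | w ∈ splittingPattern q ∧ {w' | w' ∈ splittingPattern q ∧ w' < w}.ncard = t}

/-- `irel q t = i_t(q) = j_t(q) - j_(t-1)(q)`: the `t`-th higher Witt index of `q`. -/
noncomputable def irel {n : ℕ} (q : QF F n) (t : ℕ) : ℕ := jrel q t - jrel q (t - 1)

/-- `q` is a virtual Pfister neighbour: it becomes an anisotropic Pfister neighbour
over some field extension of `F`. -/
def IsVirtualPfisterNeighbour {n : ℕ} (q : QF F n) : Prop :=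
  ∃ K : FieldExt F, Anisotropic (baseChange q K.carrier) ∧
    IsPfisterNeighbour (baseChange q K.carrier)

end Invariants

/-! ### The combinatorics of `Λ(X)` and the motivic decomposition type -/

/-- Formal symbols `i_lo` and `iᵘᵖ` indexing the Tate motives of a split quadric. -/
inductive Sym : Type
  | lo : ℤ → Sym
  | up : ℤ → Sym
  deriving DecidableEq

/-- Shift of a symbol by `j`. -/
def Sym.shift (j : ℤ) : Sym → Sym
  | .lo i => .lo (i + j)
  | .up i => .up (i + j)

/-- The shift `Λ[j]` of a set of symbols. -/
def shiftSet (Λ : Set Sym) (j : ℤ) : Set Sym := Sym.shift j '' Λ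

/-- The set `Λ(X)` for a quadric `X` of dimension `d` attached to a form of type
`(r, s)`: the symbols `i_lo` for `0 ≤ i < r` and `iᵘᵖ` for `d - r < i ≤ d`. -/
def LamSet (r d : ℤ) : Set Sym :=
  {x | (∃ i : ℤ, x = Sym.lo i ∧ 0 ≤ i ∧ i < r) ∨ ∃ i : ℤ, x = Sym.up i ∧ d - r < i ∧ i ≤ d}

/-- `a(Λ) = m`: `m` is the least index `i` with `i_lo ∈ Λ`. -/
def IsALower (Λ : Set Sym) (m : ℤ) : Prop :=
  Sym.lo m ∈ Λ ∧ ∀ i : ℤ, Sym.lo i ∈ Λ → m ≤ i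

/-- `b(Λ) = m`: `m` is the largest index `i` with `iᵘᵖ ∈ Λ`. -/
def IsBUpper (Λ : Set Sym) (m : ℤ) : Prop :=
  Sym.up m ∈ Λ ∧ ∀ i : ℤ, Sym.up i ∈ Λ → i ≤ m

/-- The member of a partition `M` of `Λ(X)` containing `0_lo`: the upper connected
component `Λᵁ(X)`. -/
def upperComp (M : Set (Set Sym)) : Set Sym := ⋃₀ {Λ | Λ ∈ M ∧ Sym.lo 0 ∈ Λ}

/-- An abstract theory of `F`-rational algebraic cycles modulo 2 of middle dimension on
the squares of generically smooth nondefective quadrics, as constructed in §§4–7 of the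
paper: `RatCyc K q` is the family of subsets `Λ ⊆ Λ(X_q)` whose associated cycle
`α_Λ = ∑_{λ ∈ Λ} α_λ` is an `F`-rational element of `Ch̄_{d_X}(X_q²)` (the image of
`CH_{d_X}(X_q²)/2 → CH_{d_X}((X_q²)_F̄)/2`).  The formal properties recorded here are
those established in the paper: the family is an `𝔽₂`-subspace (closed under symmetric
difference), is closed under intersections, consists of subsets of `Λ(X_q)`, and
contains `Λ(X_q)` itself. -/
structure MDTTheory : Type 1 where
  RatCyc : ∀ (K : Type) [Field K] {n : ℕ} (q : QF K n), Set (Set Sym)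
  inter_mem : ∀ (K : Type) [Field K] {n : ℕ} (q : QF K n),
    ∀ Λ₁ ∈ RatCyc K q, ∀ Λ₂ ∈ RatCyc K q, Λ₁ ∩ Λ₂ ∈ RatCyc K q
  symmDiff_mem : ∀ (K : Type) [Field K] {n : ℕ} (q : QF K n),
    ∀ Λ₁ ∈ RatCyc K q, ∀ Λ₂ ∈ RatCyc K q, symmDiff Λ₁ Λ₂ ∈ RatCyc K q
  subset_lam : ∀ (K : Type) [Field K] {n : ℕ} (q : QF K n) (r s : ℕ),
    HasType q r s → ∀ Λ ∈ RatCyc K q, Λ ⊆ LamSet (r : ℤ) ((n : ℤ) - 2)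
  lam_mem : ∀ (K : Type) [Field K] {n : ℕ} (q : QF K n) (r s : ℕ),
    HasType q r s → LamSet (r : ℤ) ((n : ℤ) - 2) ∈ RatCyc K q

/-- The motivic decomposition type `MDT(q)`: the partition of `Λ(X_q)` into the supports
of the indecomposable rational cycles, i.e. the minimal nonempty members of the family
of rational subsets. -/
def MDTTheory.MDT (T : MDTTheory) (K : Type) [Field K] {n : ℕ} (q : QF K n) :
    Set (Set Sym) :=
  {Λ | Λ ∈ T.RatCyc K q ∧ Λ.Nonempty ∧
    ∀ Λ' ∈ T.RatCyc K q, Λ' ⊆ Λ → Λ' = ∅ ∨ Λ' = Λ}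

end QF

namespace QF

/-- `q` (anisotropic, with quasilinear part `⟨c⟩`) is strongly excellent of nondefective
height `h`: there are Pfister neighbours `ψ 0, …, ψ (h - 1)` over `F` with `ψ 0 ≅ q`,
`ψ (i + 1)` the complementary form of `ψ i` for `i + 1 < h`, and the complementary form
of `ψ (h - 1)` equal to `⟨c⟩` (the anisotropic part of the quasilinear part of `q`). -/
def StronglyExcellentOfHeight {F : Type} [Field F] {n s : ℕ}
    (q : QF F n) (c : Fin s → F) (h : ℕ) : Prop :=
  0 < h ∧ ∃ (D : ℕ → ℕ) (ψ : ∀ i, QF F (D i)),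
    Isom (ψ 0) q ∧
    (∀ i, i < h → IsPfisterNeighbour (ψ i)) ∧
    (∀ i, i + 1 < h → IsComplementOf (ψ i) (ψ (i + 1))) ∧
    IsComplementOf (ψ (h - 1)) (diag c)

end QF



namespace QFX

open Finset

/-! ### Forms over commutative rings -/

section Ring

variable {R : Type*} [CommRing R] {n m : ℕ}

/-- The value of a quadratic form over a commutative ring. -/
def ev (q : Matrix (Fin n) (Fin n) R) (x : Fin n → R) : R := ∑ i, ∑ j, q i j * x i * x j

/-- The polar form over a commutative ring. -/
def bl (q : Matrix (Fin n) (Fin n) R) (x y : Fin n → R) : R :=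
  ∑ i, ∑ j, q i j * (x i * y j + y i * x j)

lemma ev_add (q : Matrix (Fin n) (Fin n) R) (x y : Fin n → R) :
    ev q (x + y) = ev q x + ev q y + bl q x y := by
  unfold ev bl
  simp only [← Finset.sum_add_distrib]
  refine Finset.sum_congr rfl fun i _ => Finset.sum_congr rfl fun j _ => ?_
  simp only [Pi.add_apply]; ring

lemma ev_smul (q : Matrix (Fin n) (Fin n) R) (a : R) (x : Fin n → R) :
    ev q (a • x) = a ^ 2 * ev q x := by
  unfold ev
  simp only [Finset.mul_sum]
  refine Finset.sum_congr rfl fun i _ => Finset.sum_congr rfl fun j _ => ?_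
  simp only [Pi.smul_apply, smul_eq_mul]; ring

lemma smul_ev (q : Matrix (Fin n) (Fin n) R) (a : R) (x : Fin n → R) :
    ev (a • q) x = a * ev q x := by
  unfold ev
  simp only [Finset.mul_sum]
  refine Finset.sum_congr rfl fun i _ => Finset.sum_congr rfl fun j _ => ?_
  simp only [Matrix.smul_apply, smul_eq_mul]; ring

lemma smul_bl (q : Matrix (Fin n) (Fin n) R) (a : R) (x y : Fin n → R) :
    bl (a • q) x y = a * bl q x y := by
  unfold bl
  simp only [Finset.mul_sum]
  refine Finset.sum_congr rfl fun i _ => Finset.sum_congr rfl fun j _ => ?_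
  simp only [Matrix.smul_apply, smul_eq_mul]; ring

lemma bl_comm (q : Matrix (Fin n) (Fin n) R) (x y : Fin n → R) : bl q x y = bl q y x := by
  unfold bl
  refine Finset.sum_congr rfl fun i _ => Finset.sum_congr rfl fun j _ => ?_
  ring

lemma bl_add_left (q : Matrix (Fin n) (Fin n) R) (x x' y : Fin n → R) :
    bl q (x + x') y = bl q x y + bl q x' y := by
  unfold bl
  simp only [← Finset.sum_add_distrib]
  refine Finset.sum_congr rfl fun i _ => Finset.sum_congr rfl fun j _ => ?_
  simp only [Pi.add_apply]; ring

lemma bl_smul_left (q : Matrix (Fin n) (Fin n) R) (a : R) (x y : Fin n → R) :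
    bl q (a • x) y = a * bl q x y := by
  unfold bl
  simp only [Finset.mul_sum]
  refine Finset.sum_congr rfl fun i _ => Finset.sum_congr rfl fun j _ => ?_
  simp only [Pi.smul_apply, smul_eq_mul]; ring

lemma bl_add_right (q : Matrix (Fin n) (Fin n) R) (x y y' : Fin n → R) :
    bl q x (y + y') = bl q x y + bl q x y' := by
  rw [bl_comm, bl_add_left, bl_comm q y, bl_comm q y']

lemma bl_smul_right (q : Matrix (Fin n) (Fin n) R) (a : R) (x y : Fin n → R) :
    bl q x (a • y) = a * bl q x y := by
  rw [bl_comm, bl_smul_left, bl_comm]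

lemma bl_self (q : Matrix (Fin n) (Fin n) R) (x : Fin n → R) : bl q x x = 2 * ev q x := by
  unfold bl ev
  simp only [Finset.mul_sum]
  refine Finset.sum_congr rfl fun i _ => Finset.sum_congr rfl fun j _ => ?_
  ring

@[simp] lemma ev_zero (q : Matrix (Fin n) (Fin n) R) : ev q 0 = 0 := by simp [ev]

@[simp] lemma bl_zero_left (q : Matrix (Fin n) (Fin n) R) (y : Fin n → R) : bl q 0 y = 0 := by
  simp [bl]

@[simp] lemma bl_zero_right (q : Matrix (Fin n) (Fin n) R) (y : Fin n → R) : bl q y 0 = 0 := by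
  simp [bl]

lemma ev_sub (q : Matrix (Fin n) (Fin n) R) (x y : Fin n → R) :
    ev q (x - y) = ev q x + ev q y - bl q x y := by
  have : x - y = x + (-1 : R) • y := by simp [sub_eq_add_neg]
  rw [this, ev_add, ev_smul, bl_smul_right]; ring

lemma bl_sub_right (q : Matrix (Fin n) (Fin n) R) (x y y' : Fin n → R) :
    bl q x (y - y') = bl q x y - bl q x y' := by
  have : y - y' = y + (-1 : R) • y' := by simp [sub_eq_add_neg]
  rw [this, bl_add_right, bl_smul_right]; ring

lemma ev_map {S : Type*} [CommRing S] (f : R →+* S) (q : Matrix (Fin n) (Fin n) R)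
    (x : Fin n → R) : ev (q.map f) (fun i => f (x i)) = f (ev q x) := by
  simp [ev, map_sum]

lemma bl_map {S : Type*} [CommRing S] (f : R →+* S) (q : Matrix (Fin n) (Fin n) R)
    (x y : Fin n → R) : bl (q.map f) (fun i => f (x i)) (fun i => f (y i)) = f (bl q x y) := by
  simp [bl, map_sum]

/-- The bundled quadratic form. -/
def tq (q : Matrix (Fin n) (Fin n) R) : QuadraticForm R (Fin n → R) :=
  QuadraticMap.ofPolar (ev q)
    (fun a x => by rw [ev_smul, pow_two, smul_eq_mul])
    (fun x x' y => by
      simp only [QuadraticMap.polar, ev_add, bl_add_left]; ring)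
    (fun a x y => by
      simp only [QuadraticMap.polar, ev_add, bl_smul_left, smul_eq_mul]; ring)

@[simp] lemma tq_apply (q : Matrix (Fin n) (Fin n) R) (x : Fin n → R) : tq q x = ev q x := rfl

@[simp] lemma tq_polar (q : Matrix (Fin n) (Fin n) R) (x y : Fin n → R) :
    QuadraticMap.polar (tq q) x y = bl q x y := by
  simp only [QuadraticMap.polar, tq_apply, ev_add]; ring

/-- Pulling back a form along a linear map. -/
lemma exists_pullback (q : Matrix (Fin n) (Fin n) R) (f : (Fin m → R) →ₗ[R] (Fin n → R)) :
    ∃ p : Matrix (Fin m) (Fin m) R, ∀ x, ev p x = ev q (f x) := by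
  refine ⟨fun k l => ∑ i, ∑ j, q i j * f (Pi.single k 1) i * f (Pi.single l 1) j, fun x => ?_⟩
  have hx : ∀ i, f x i = ∑ k, x k * f (Pi.single k 1) i := by
    intro i
    conv_lhs => rw [LinearMap.pi_apply_eq_sum_univ f x]
    simp [Finset.sum_apply]
    refine Finset.sum_congr rfl fun k _ => ?_
    have : (fun j => if k = j then (1 : R) else 0) = Pi.single k 1 := by
      ext j; simp [Pi.single_apply, eq_comm]
    rw [this]
  unfold ev
  simp only [hx, Finset.sum_mul, Finset.mul_sum]
  calc _ = ∑ k, ∑ i, ∑ l, ∑ j, q i j * f (Pi.single k 1) i * f (Pi.single l 1) j * x k * x l := by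
        refine Finset.sum_congr rfl fun k _ => ?_
        rw [Finset.sum_comm]
      _ = ∑ i, ∑ k, ∑ l, ∑ j, q i j * f (Pi.single k 1) i * f (Pi.single l 1) j * x k * x l :=
        Finset.sum_comm
      _ = ∑ i, ∑ k, ∑ j, ∑ l, q i j * f (Pi.single k 1) i * f (Pi.single l 1) j * x k * x l :=
        Finset.sum_congr rfl fun i _ => Finset.sum_congr rfl fun k _ => Finset.sum_comm
      _ = ∑ i, ∑ j, ∑ k, ∑ l, q i j * f (Pi.single k 1) i * f (Pi.single l 1) j * x k * x l :=
        Finset.sum_congr rfl fun i _ => Finset.sum_comm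
      _ = _ := by
        refine Finset.sum_congr rfl fun i _ => Finset.sum_congr rfl fun j _ => ?_
        rw [Finset.sum_comm]
        refine Finset.sum_congr rfl fun l _ => Finset.sum_congr rfl fun k _ => ?_
        ring

end Ring

lemma eval_eq {F : Type} [Field F] {n : ℕ} (q : QF F n) (x : Fin n → F) :
    QF.eval q x = ev q x := rfl

lemma polar_eq {F : Type} [Field F] {n : ℕ} (q : QF F n) (x y : Fin n → F) :
    QF.polar q x y = bl q x y := by
  simp only [QF.polar, eval_eq, ev_add]; ring

end QFX


namespace QFX

open Finset Polynomial

section Poly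

variable {L : Type*} [Field L] {m : ℕ}

/-- Anisotropy over a commutative ring. -/
def An {R : Type*} [CommRing R] {n : ℕ} (q : Matrix (Fin n) (Fin n) R) : Prop :=
  ∀ x, ev q x = 0 → x = 0

lemma natDegree_ev_le (φ : Matrix (Fin m) (Fin m) L) (g : Fin m → L[X]) (d : ℕ)
    (hg : ∀ i, (g i).natDegree ≤ d) : (ev (φ.map C) g).natDegree ≤ d + d := by
  unfold ev
  refine natDegree_sum_le_of_forall_le _ _ fun i _ => natDegree_sum_le_of_forall_le _ _ fun j _ => ?_
  refine natDegree_mul_le_of_le ?_ (hg j)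
  simp only [Matrix.map_apply]
  exact (natDegree_C_mul_le _ _).trans (hg i)

lemma coeff_ev (φ : Matrix (Fin m) (Fin m) L) (g : Fin m → L[X]) (d : ℕ)
    (hg : ∀ i, (g i).natDegree ≤ d) :
    (ev (φ.map C) g).coeff (d + d) = ev φ (fun i => (g i).coeff d) := by
  unfold ev
  simp only [finsetSum_coeff, Matrix.map_apply]
  refine Finset.sum_congr rfl fun i _ => Finset.sum_congr rfl fun j _ => ?_
  rw [coeff_mul_add_eq_of_natDegree_le ((natDegree_C_mul_le _ _).trans (hg i)) (hg j), coeff_C_mul]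

lemma natDegree_bl_le (φ : Matrix (Fin m) (Fin m) L) (u : Fin m → L) (g : Fin m → L[X]) (d : ℕ)
    (hg : ∀ i, (g i).natDegree ≤ d) :
    (bl (φ.map C) (fun i => C (u i)) g).natDegree ≤ d := by
  unfold bl
  refine natDegree_sum_le_of_forall_le _ _ fun i _ => natDegree_sum_le_of_forall_le _ _ fun j _ => ?_
  simp only [Matrix.map_apply]
  refine (natDegree_C_mul_le _ _).trans ?_
  refine natDegree_add_le_of_degree_le ((natDegree_C_mul_le _ _).trans (hg j)) ?_
  exact (natDegree_mul_C_le _ _).trans (hg i)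

lemma An.natDegree_le {φ : Matrix (Fin m) (Fin m) L} (hφ : An φ) (g : Fin m → L[X]) (d : ℕ)
    (h : (ev (φ.map C) g).natDegree ≤ d + d + 1) : ∀ i, (g i).natDegree ≤ d := by
  by_contra hc
  push Not at hc
  obtain ⟨i, hi⟩ := hc
  set D := Finset.univ.sup fun i => (g i).natDegree with hD
  have hle : ∀ i, (g i).natDegree ≤ D := fun i =>
    Finset.le_sup (f := fun i => (g i).natDegree) (Finset.mem_univ i)
  obtain ⟨k, -, hk⟩ := Finset.exists_mem_eq_sup Finset.univ ⟨i, Finset.mem_univ i⟩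
    (fun i => (g i).natDegree)
  have hDk : (g k).natDegree = D := hk.symm
  have h1 : D > d := lt_of_lt_of_le hi (hle i)
  have h2 := coeff_ev φ g D hle
  rw [coeff_eq_zero_of_natDegree_lt (by omega)] at h2
  have h3 := congrFun (hφ _ h2.symm) k
  simp only [Pi.zero_apply] at h3
  rw [← hDk, coeff_natDegree, leadingCoeff_eq_zero] at h3
  rw [h3, natDegree_zero] at hDk
  omega

lemma An.poly {φ : Matrix (Fin m) (Fin m) L} (hφ : An φ) : An (φ.map (C : L →+* L[X])) := by
  intro g hg
  have h0 := hφ.natDegree_le g 0 (by rw [hg]; simp)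
  have h2 := coeff_ev φ g 0 h0
  rw [hg] at h2
  have h3 := hφ _ h2.symm
  ext1 i
  rw [eq_C_of_natDegree_le_zero (h0 i)]
  have := congrFun h3 i
  simp only [Pi.zero_apply] at this
  simp [this]

/-- Cassels' reduction of denominators, with linear side conditions. -/
lemma cassels {φ : Matrix (Fin m) (Fin m) L} (hφ : An φ) (p : L[X]) {ι : Type*}
    (u : ι → Fin m → L) (ℓ : ι → L[X]) (d : ℕ) : ∀ (f : L[X]), f ≠ 0 → f.natDegree ≤ d →
    ∀ (g : Fin m → L[X]), ev (φ.map C) g = f ^ 2 * p →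
    (∀ i, bl (φ.map C) (fun k => C (u i k)) g = f * ℓ i) →
    ∃ g : Fin m → L[X], ev (φ.map C) g = p ∧ ∀ i, bl (φ.map C) (fun k => C (u i k)) g = ℓ i := by
  induction d with
  | zero =>
    intro f hf hd g hg hu
    obtain ⟨c, rfl⟩ := natDegree_eq_zero.1 (Nat.le_zero.1 hd)
    have hc : c ≠ 0 := by rintro rfl; simp at hf
    have hcc : (C c⁻¹ : L[X]) * C c = 1 := by rw [← C_mul, inv_mul_cancel₀ hc, C_1]
    refine ⟨(C c⁻¹ : L[X]) • g, ?_, fun i => ?_⟩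
    · rw [ev_smul, hg]; linear_combination (C c⁻¹ * C c + 1) * p * hcc
    · rw [bl_smul_right, hu]; linear_combination ℓ i * hcc
  | succ d ih =>
    intro f hf hd g hg hu
    by_cases hd' : f.natDegree ≤ d
    · exact ih f hf hd' g hg hu
    have hfd : f.natDegree = d + 1 := by omega
    set q : Fin m → L[X] := fun i => g i / f with hq
    set r : Fin m → L[X] := fun i => g i % f with hr
    have hgqr : g = f • q + r := by
      ext1 i
      simp only [hq, hr, Pi.add_apply, Pi.smul_apply, smul_eq_mul]
      exact (EuclideanDomain.div_add_mod (g i) f).symm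
    have hrd : ∀ i, (r i).natDegree ≤ d := by
      intro i
      have := natDegree_mod_lt (g i) (q := f) (by omega)
      have h' : (r i).natDegree < f.natDegree := this
      omega
    set Q := ev (φ.map C) q with hQ
    set f' := f * p - bl (φ.map C) g q + f * Q with hf'
    have hrr : ev (φ.map C) r = f * f' := by
      have : r = g - f • q := by rw [hgqr]; simp
      rw [this, ev_sub, ev_smul, bl_smul_right, hg, hf', hQ]; ring
    have hBqr : bl (φ.map C) q r = f * (p - Q) - f' := by
      have : r = g - f • q := by rw [hgqr]; simp
      rw [this, bl_sub_right, bl_smul_right, bl_self, hf', bl_comm _ g q, hQ]; ring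
    have hur : ∀ i, bl (φ.map C) (fun k => C (u i k)) q = ℓ i ∧
        bl (φ.map C) (fun k => C (u i k)) r = 0 := by
      intro i
      have h1 := hu i
      rw [hgqr, bl_add_right, bl_smul_right] at h1
      have h2 : bl (φ.map C) (fun k => C (u i k)) r =
          f * (ℓ i - bl (φ.map C) (fun k => C (u i k)) q) := by linear_combination h1
      have h3 := natDegree_bl_le φ (u i) r d hrd
      have h4 : ℓ i - bl (φ.map C) (fun k => C (u i k)) q = 0 := by
        by_contra hne
        rw [h2, natDegree_mul hf hne] at h3
        omega
      exact ⟨by linear_combination -h4, by rw [h2, h4, mul_zero]⟩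
    by_cases hr0 : r = 0
    · refine ⟨q, ?_, fun i => (hur i).1⟩
      have : f ^ 2 * (Q - p) = 0 := by
        rw [hgqr, hr0, add_zero, ev_smul] at hg
        linear_combination hg
      rcases mul_eq_zero.1 this with h | h
      · exact absurd (pow_eq_zero_iff (by norm_num) |>.1 h) hf
      · linear_combination h
    · have hf'0 : f' ≠ 0 := by
        intro h0
        rw [h0, mul_zero] at hrr
        exact hr0 (hφ.poly _ hrr)
      refine ih f' hf'0 ?_ (f' • q - (p - Q) • r) ?_ fun i => ?_
      · have := natDegree_ev_le φ r d hrd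
        rw [hrr, natDegree_mul hf hf'0] at this
        omega
      · rw [ev_sub, ev_smul, ev_smul, bl_smul_right, bl_smul_left, hrr, hBqr, ← hQ]; ring
      · rw [bl_sub_right, bl_smul_right, bl_smul_right, (hur i).1, (hur i).2]; ring

end Poly

end QFX


namespace QFX

open Finset Polynomial

section Frac

variable {L : Type*} [Field L] {m : ℕ} {M : Type*} [Field M] [Algebra L[X] M]
  [IsFractionRing L[X] M]

lemma exists_clear (w : Fin m → M) : ∃ (f : L[X]) (g : Fin m → L[X]), f ≠ 0 ∧
    ∀ i, algebraMap L[X] M (g i) = algebraMap L[X] M f * w i := by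
  obtain ⟨b, hb⟩ := IsLocalization.exist_integer_multiples_of_finite (nonZeroDivisors L[X]) w
  choose g hg using hb
  refine ⟨b, g, nonZeroDivisors.ne_zero b.2, fun i => ?_⟩
  rw [hg i, Algebra.smul_def]

lemma An.frac {φ : Matrix (Fin m) (Fin m) L} (hφ : An φ) :
    An (φ.map ((algebraMap L[X] M).comp C)) := by
  intro w hw
  obtain ⟨f, g, hf, hg⟩ := exists_clear (L := L) w
  have hfM : algebraMap L[X] M f ≠ 0 := by
    simpa using hf
  have h1 : algebraMap L[X] M (ev (φ.map C) g) = 0 := by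
    rw [← ev_map]
    have : (fun i => algebraMap L[X] M (g i)) = algebraMap L[X] M f • w := by
      ext i; simp [hg]
    rw [this, ev_smul, Matrix.map_map]
    change _ * ev (φ.map ((algebraMap L[X] M).comp C)) w = 0
    rw [hw, mul_zero]
  have h2 : g = 0 := hφ.poly _ (by simpa using h1)
  ext i
  have h3 := hg i
  rw [h2] at h3
  simp only [Pi.zero_apply, map_zero] at h3
  rcases mul_eq_zero.1 h3.symm with h | h
  · exact absurd h hfM
  · simpa using h

lemma cassels_frac {φ : Matrix (Fin m) (Fin m) L} (hφ : An φ) (p : L[X]) (hp : p.natDegree ≤ 2)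
    {ι : Type*} (u : ι → Fin m → L) (ℓ : ι → L[X]) (w : Fin m → M)
    (hw : ev (φ.map ((algebraMap L[X] M).comp C)) w = algebraMap L[X] M p)
    (hu : ∀ i, bl (φ.map ((algebraMap L[X] M).comp C))
      (fun k => (algebraMap L[X] M).comp C (u i k)) w = algebraMap L[X] M (ℓ i)) :
    ∃ a b : Fin m → L, p = X ^ 2 * C (ev φ a) + X * C (bl φ a b) + C (ev φ b) ∧
      ∀ i, ℓ i = X * C (bl φ (u i) a) + C (bl φ (u i) b) := by
  obtain ⟨f, g, hf, hg⟩ := exists_clear (L := L) w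
  have hinj : Function.Injective (algebraMap L[X] M) := IsFractionRing.injective _ _
  have hgw : (fun i => algebraMap L[X] M (g i)) = algebraMap L[X] M f • w := by
    ext i; simp [hg]
  obtain ⟨g', hg', hu'⟩ := cassels hφ p u ℓ _ f hf le_rfl g
    (by
      apply hinj
      rw [← ev_map, hgw, ev_smul, Matrix.map_map, map_mul, map_pow, ← hw]; rfl)
    (fun i => by
      apply hinj
      rw [← bl_map, hgw, bl_smul_right, Matrix.map_map, map_mul, ← hu]; rfl)
  have hd := hφ.natDegree_le g' 1 (by rw [hg']; omega)
  have hlin : g' = (X : L[X]) • (fun i => C ((g' i).coeff 1)) + (fun i => C ((g' i).coeff 0)) := by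
    ext1 i
    conv_lhs => rw [eq_X_add_C_of_natDegree_le_one (hd i)]
    simp only [Pi.add_apply, Pi.smul_apply, smul_eq_mul]; ring
  refine ⟨fun i => (g' i).coeff 1, fun i => (g' i).coeff 0, ?_, fun i => ?_⟩
  · rw [← hg', ← ev_map C, ← ev_map C, ← bl_map C]
    conv_lhs => rw [hlin, ev_add, ev_smul, bl_smul_left]
    ring
  · rw [← hu', ← bl_map C, ← bl_map C]
    conv_lhs => rw [hlin, bl_add_right, bl_smul_right]

lemma specialize_frac {φ : Matrix (Fin m) (Fin m) L} (hφ : An φ) (a : L)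
    {ι : Type*} (u : ι → Fin m → L) (ℓ : ι → L) (w : Fin m → M)
    (hw : ev (φ.map ((algebraMap L[X] M).comp C)) w = (algebraMap L[X] M).comp C a)
    (hu : ∀ i, bl (φ.map ((algebraMap L[X] M).comp C))
      (fun k => (algebraMap L[X] M).comp C (u i k)) w = (algebraMap L[X] M).comp C (ℓ i)) :
    ∃ b : Fin m → L, ev φ b = a ∧ ∀ i, bl φ (u i) b = ℓ i := by
  obtain ⟨c, b, h1, h2⟩ := cassels_frac hφ (C a) (by simp) u (fun i => C (ℓ i)) w hw hu
  refine ⟨b, ?_, fun i => ?_⟩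
  · have := congrArg (fun p => p.coeff 0) h1
    simpa using this.symm
  · have := congrArg (fun p => p.coeff 0) (h2 i)
    simpa using this.symm

lemma reflect {φ : Matrix (Fin m) (Fin m) L} (hφ : An φ) (u u0 v : Fin m → L)
    (h : ev φ u = ev φ u0) : ∃ v' : Fin m → L, ev φ v' = ev φ v ∧ bl φ u0 v' = bl φ u v ∧
      ∀ y, bl φ y u = bl φ y u0 → bl φ y v' = bl φ y v := by
  by_cases hz : u - u0 = 0
  · have : u = u0 := sub_eq_zero.1 hz
    subst this
    exact ⟨v, rfl, rfl, fun _ _ => rfl⟩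
  have hz' : ev φ (u - u0) ≠ 0 := fun h0 => hz (hφ _ h0)
  have hev : ev φ (u - u0) = 2 * ev φ u0 - bl φ u0 u := by
    rw [ev_sub, h, bl_comm φ u u0]; ring
  refine ⟨v - (bl φ v (u - u0) / ev φ (u - u0)) • (u - u0), ?_, ?_, fun y hy => ?_⟩
  · rw [ev_sub, ev_smul, bl_smul_right]; field_simp; ring
  · have h1 : bl φ u0 (u - u0) = - ev φ (u - u0) := by
      rw [bl_sub_right, bl_self, hev]; ring
    rw [bl_sub_right, bl_smul_right, h1, mul_neg, div_mul_cancel₀ _ hz', bl_sub_right,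
      bl_comm φ u0 v, bl_comm φ u v]; ring
  · rw [bl_sub_right, bl_smul_right, bl_sub_right φ y u u0, hy]; ring

end Frac

lemma ev_cons {R : Type*} [CommRing R] {n : ℕ} (q : Matrix (Fin (n + 1)) (Fin (n + 1)) R)
    (t : R) (x : Fin n → R) :
    ev q (Fin.cons t x : Fin (n + 1) → R) = q 0 0 * t ^ 2
      + t * ∑ j, (q 0 j.succ + q j.succ 0) * x j + ev (q.submatrix Fin.succ Fin.succ) x := by
  unfold ev
  simp only [Fin.sum_univ_succ, Fin.cons_zero, Fin.cons_succ, Matrix.submatrix_apply,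
    Finset.sum_add_distrib, add_mul, mul_add, Finset.mul_sum]
  have : ∀ i, q i.succ 0 * x i * t = t * (q i.succ 0 * x i) := fun i => by ring
  have h2 : ∀ i, q 0 (Fin.succ i) * t * x i = t * (q 0 i.succ * x i) := fun i => by ring
  simp only [this, h2]
  ring

/-- The iterated rational function field `F(x₁, …, x_n)`. -/
noncomputable def Gen (F : Type) [Field F] : ℕ → QF.FieldExt F
  | 0 => ⟨F⟩
  | n + 1 => ⟨RatFunc (Gen F n).carrier⟩

/-- The generic vector. -/
noncomputable def genx (F : Type) [Field F] : (n : ℕ) → Fin n → (Gen F n).carrier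
  | 0 => Fin.elim0
  | n + 1 => (Fin.cons (RatFunc.X : RatFunc (Gen F n).carrier)
      (fun i => algebraMap (Gen F n).carrier[X] (RatFunc (Gen F n).carrier) (C (genx F n i))) :
        Fin (n + 1) → RatFunc (Gen F n).carrier)

section Tower

variable {F : Type} [Field F]

/-- the algebra map into the tower -/
noncomputable def aG (F : Type) [Field F] (n : ℕ) : F →+* (Gen F n).carrier :=
  algebraMap F (Gen F n).carrier

/-- one step of the tower -/
noncomputable def st (F : Type) [Field F] (n : ℕ) : (Gen F n).carrier →+* (Gen F (n + 1)).carrier :=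
  (algebraMap (Gen F n).carrier[X] (RatFunc (Gen F n).carrier)).comp C

lemma aG_succ (n : ℕ) : aG F (n + 1) = (st F n).comp (aG F n) := by
  ext a
  change algebraMap F (RatFunc (Gen F n).carrier) a = _
  rw [IsScalarTower.algebraMap_apply F (Gen F n).carrier[X] (RatFunc (Gen F n).carrier)]
  rfl

lemma An.gen {m : ℕ} {φ : Matrix (Fin m) (Fin m) F} (hφ : An φ) (n : ℕ) :
    An (φ.map (aG F n)) := by
  induction n with
  | zero => 
    have : φ.map (aG F 0) = φ := by ext i j; rfl
    rw [this]; exact hφ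
  | succ n ih =>
    rw [aG_succ]
    have := ih.frac (M := RatFunc (Gen F n).carrier)
    rw [Matrix.map_map] at this
    exact this

lemma specialize_gen {m : ℕ} {φ : Matrix (Fin m) (Fin m) F} (hφ : An φ) (a : F)
    {ι : Type*} (u : ι → Fin m → F) (ℓ : ι → F) (n : ℕ) : ∀ (w : Fin m → (Gen F n).carrier),
    ev (φ.map (aG F n)) w = aG F n a → 
    (∀ i, bl (φ.map (aG F n)) (fun k => aG F n (u i k)) w = aG F n (ℓ i)) →
    ∃ b : Fin m → F, ev φ b = a ∧ ∀ i, bl φ (u i) b = ℓ i := by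
  induction n with
  | zero =>
    intro w hw hu
    exact ⟨w, hw, hu⟩
  | succ n ih =>
    intro w hw hu
    rw [aG_succ] at hw hu
    obtain ⟨b, h1, h2⟩ := specialize_frac (M := RatFunc (Gen F n).carrier) (hφ.gen n) (aG F n a)
      (fun i k => aG F n (u i k)) (fun i => aG F n (ℓ i)) w
      (by rw [Matrix.map_map]; exact hw) (fun i => by rw [Matrix.map_map]; exact hu i)
    exact ih b h1 h2

/-- The generic value theorem. -/
theorem gvt {m : ℕ} {φ : Matrix (Fin m) (Fin m) F} (hφ : An φ) (k : ℕ) :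
    ∀ (ι : Type) (u : ι → Fin m → F) (ψ : Matrix (Fin k) (Fin k) F) (l : ι → Fin k → F)
      (v : Fin m → (Gen F k).carrier),
      ev (φ.map (aG F k)) v = ev (ψ.map (aG F k)) (genx F k) →
      (∀ i, bl (φ.map (aG F k)) (fun j => aG F k (u i j)) v = ∑ j, aG F k (l i j) * genx F k j) →
      ∃ T : (Fin k → F) →ₗ[F] (Fin m → F), ∀ y, ev φ (T y) = ev ψ y ∧
        ∀ i, bl φ (u i) (T y) = ∑ j, l i j * y j := by
  induction k with
  | zero =>
    intro ι u ψ l v _ _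
    refine ⟨0, fun y => ⟨?_, fun i => ?_⟩⟩
    · simp [ev]
    · simp
  | succ k ih =>
    intro ι u ψ l v hv hu
    set L := (Gen F k).carrier
    set M := RatFunc L
    set β : L := ∑ j : Fin k, (aG F k (ψ 0 j.succ) + aG F k (ψ j.succ 0)) * genx F k j with hβ
    set ψ' := ψ.submatrix Fin.succ Fin.succ with hψ'
    set γ : L := ev (ψ'.map (aG F k)) (genx F k) with hγ
    set δ : ι → L := fun i => ∑ j : Fin k, aG F k (l i j.succ) * genx F k j with hδ
    rw [aG_succ] at hv hu
    have key := cassels_frac (M := M) (hφ.gen k)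
      (X ^ 2 * C (aG F k (ψ 0 0)) + X * C β + C γ) (by compute_degree)
      (fun i j => aG F k (u i j)) (fun i => X * C (aG F k (l i 0)) + C (δ i)) v
      (by
        rw [Matrix.map_map]
        refine hv.trans ?_
        refine (ev_cons _ _ _).trans ?_
        simp only [map_add, map_mul, map_pow]
        congr 1
        · congr 1
          · exact mul_comm _ _
          · congr 1
            rw [hβ, map_sum, map_sum]
            refine Finset.sum_congr rfl fun j _ => ?_
            simp only [map_mul, map_add]
            rfl
        · rw [hγ]
          rw [← RingHom.comp_apply, ← ev_map, Matrix.map_map]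
          rfl)
      (fun i => by
        rw [Matrix.map_map]
        refine (hu i).trans ?_
        rw [Fin.sum_univ_succ]
        simp only [map_add, map_mul]
        congr 1
        · exact mul_comm _ _
        · rw [hδ]
          simp only [map_sum]
          refine Finset.sum_congr rfl fun j _ => ?_
          simp only [map_mul]
          rfl)
    obtain ⟨a, b, hp, hl⟩ := key
    have ha : ev (φ.map (aG F k)) a = aG F k (ψ 0 0) := by
      have := congrArg (fun p => p.coeff 2) hp
      simpa [coeff_X, coeff_C] using this.symm
    have hab : bl (φ.map (aG F k)) a b = β := by
      have := congrArg (fun p => p.coeff 1) hp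
      simpa [coeff_X, coeff_C, coeff_X_pow] using this.symm
    have hb : ev (φ.map (aG F k)) b = γ := by
      have := congrArg (fun p => p.coeff 0) hp
      simpa [coeff_X, coeff_C, coeff_X_pow] using this.symm
    have hla : ∀ i, bl (φ.map (aG F k)) (fun j => aG F k (u i j)) a = aG F k (l i 0) := by
      intro i
      have := congrArg (fun p => p.coeff 1) (hl i)
      simpa [coeff_X, coeff_C, coeff_X_pow] using this.symm
    have hlb : ∀ i, bl (φ.map (aG F k)) (fun j => aG F k (u i j)) b = δ i := by
      intro i
      have := congrArg (fun p => p.coeff 0) (hl i)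
      simpa [coeff_X, coeff_C, coeff_X_pow] using this.symm
    obtain ⟨u0, hu0, hlu0⟩ := specialize_gen hφ (ψ 0 0) u (fun i => l i 0) k a ha hla
    obtain ⟨b', hb1, hb2, hb3⟩ := reflect (hφ.gen k) a (fun j => aG F k (u0 j)) b
      (by rw [ha, ev_map, hu0])
    obtain ⟨T, hT⟩ := ih (Option ι) (fun o => o.elim u0 u) ψ'
      (fun o => o.elim (fun j => ψ 0 j.succ + ψ j.succ 0) (fun i j => l i j.succ)) b'
      (by rw [hb1, hb])
      (by
        rintro (_ | i)
        · simp only [Option.elim]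
          rw [hb2, hab, hβ]
          simp only [map_add]
        · simp only [Option.elim]
          rw [hb3, hlb]
          rw [hla, bl_map, hlu0])
    let T' : (Fin (k + 1) → F) →ₗ[F] (Fin m → F) :=
      (LinearMap.proj (R := F) (φ := fun _ : Fin (k + 1) => F) 0).smulRight u0 +
        T ∘ₗ LinearMap.funLeft F F Fin.succ
    refine ⟨T', fun y => ?_⟩
    have hy : T' y = y 0 • u0 + T (fun j => y j.succ) := rfl
    rw [hy]
    obtain ⟨h1, h2⟩ := hT (fun j => y j.succ)
    refine ⟨?_, fun i => ?_⟩
    · have h3 := h2 none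
      simp only [Option.elim] at h3
      rw [ev_add, ev_smul, bl_smul_left, hu0, h1, h3]
      have : y = Fin.cons (y 0) (fun j => y j.succ) := by
        ext j; refine Fin.cases ?_ (fun j => ?_) j <;> rfl
      conv_rhs => rw [this, ev_cons]
      ring
    · have h3 := h2 (some i)
      simp only [Option.elim] at h3
      rw [bl_add_right, bl_smul_right, hlu0, h3, Fin.sum_univ_succ]
      ring

lemma genx_indep (k : ℕ) (l : Fin k → F) (h : ∑ j, aG F k (l j) * genx F k j = 0) : l = 0 := by
  induction k with
  | zero => ext j; exact j.elim0
  | succ k ih =>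
    set L := (Gen F k).carrier
    have h1 : algebraMap L[X] (RatFunc L) (X * C (aG F k (l 0)) +
        C (∑ j : Fin k, aG F k (l j.succ) * genx F k j)) = 0 := by
      refine Eq.trans ?_ h
      rw [Fin.sum_univ_succ, aG_succ]
      simp only [map_add, map_mul, map_sum, RatFunc.algebraMap_X]
      congr 1
      exact mul_comm _ _
    have h2 : (X * C (aG F k (l 0)) +
        C (∑ j : Fin k, aG F k (l j.succ) * genx F k j) : L[X]) = 0 := by
      simpa only [FaithfulSMul.algebraMap_eq_zero_iff] using h1
    have h3 : aG F k (l 0) = 0 := by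
      have := congrArg (fun p => p.coeff 1) h2
      simpa [coeff_X, coeff_C, coeff_X_pow] using this
    have h4 : ∑ j : Fin k, aG F k (l j.succ) * genx F k j = 0 := by
      have := congrArg (fun p => p.coeff 0) h2
      simpa [coeff_X, coeff_C, coeff_X_pow] using this
    have h5 := ih _ h4
    ext j
    refine Fin.cases ?_ (fun j => ?_) j
    · exact (map_eq_zero (aG F k)).1 h3
    · exact congrFun h5 j

end Tower

end QFX

namespace QFX

open QuadraticMap Module

section Witt

variable {F : Type} [Field F]
variable {U V W X Y : Type} [AddCommGroup U] [Module F U] [AddCommGroup V] [Module F V]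
  [AddCommGroup W] [Module F W] [AddCommGroup X] [Module F X] [AddCommGroup Y] [Module F Y]

/-- domination for bundled forms -/
def Dom (P : QuadraticForm F V) (Q : QuadraticForm F W) : Prop :=
  ∃ f : V →ₗ[F] W, Function.Injective f ∧ ∀ x, Q (f x) = P x

/-- nondegeneracy of the polar form -/
def Nd (Q : QuadraticForm F V) : Prop := ∀ x, (∀ y, polar Q x y = 0) → x = 0

lemma eqv_of {Q : QuadraticForm F V} {Q' : QuadraticForm F W} (e : V ≃ₗ[F] W)
    (h : ∀ x, Q' (e x) = Q x) : Q.Equivalent Q' := ⟨{ e with map_app' := h }⟩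

lemma Equivalent.out {Q : QuadraticForm F V} {Q' : QuadraticForm F W} (h : Q.Equivalent Q') :
    ∃ e : V ≃ₗ[F] W, ∀ x, Q' (e x) = Q x := by
  obtain ⟨e⟩ := h
  exact ⟨e.toLinearEquiv, e.map_app⟩

lemma Equivalent.dom {Q : QuadraticForm F V} {Q' : QuadraticForm F W} (h : Q.Equivalent Q') :
    Dom Q Q' := by
  obtain ⟨e, he⟩ := Equivalent.out h
  exact ⟨e.toLinearMap, e.injective, he⟩

lemma Dom.trans {P : QuadraticForm F U} {Q : QuadraticForm F V} {R : QuadraticForm F W}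
    (h : Dom P Q) (h' : Dom Q R) : Dom P R := by
  obtain ⟨f, hf, hf'⟩ := h
  obtain ⟨g, hg, hg'⟩ := h'
  exact ⟨g.comp f, hg.comp hf, fun x => by simp [hg', hf']⟩

lemma polar_isom {P : QuadraticForm F V} {Q : QuadraticForm F W} {f : V →ₗ[F] W}
    (h : ∀ x, Q (f x) = P x) (x y : V) : polar Q (f x) (f y) = polar P x y := by
  simp [polar, ← map_add, h]

lemma Dom.eqv [FiniteDimensional F V] [FiniteDimensional F W] {P : QuadraticForm F V}
    {Q : QuadraticForm F W} (h : Dom P Q) (hd : finrank F V = finrank F W) :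
    P.Equivalent Q := by
  obtain ⟨f, hf, hf'⟩ := h
  exact eqv_of (LinearEquiv.ofInjectiveOfFinrankEq f hf hd) hf'

lemma Dom.le [FiniteDimensional F W] {P : QuadraticForm F V}
    {Q : QuadraticForm F W} (h : Dom P Q) : finrank F V ≤ finrank F W := by
  obtain ⟨f, hf, hf'⟩ := h
  exact LinearMap.finrank_le_finrank_of_injective hf

lemma Equivalent.finrank_eq {Q : QuadraticForm F V} {Q' : QuadraticForm F W}
    (h : Q.Equivalent Q') : finrank F V = finrank F W := by
  obtain ⟨e, he⟩ := Equivalent.out h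
  exact e.finrank_eq

lemma Equivalent.nd {Q : QuadraticForm F V} {Q' : QuadraticForm F W}
    (h : Q.Equivalent Q') (hn : Nd Q) : Nd Q' := by
  obtain ⟨e, he⟩ := Equivalent.out h
  intro x hx
  have : e.symm x = 0 := hn _ fun y => by
    have := polar_isom (f := e.toLinearMap) he (e.symm x) y
    rw [← this]; simpa using hx _
  simpa using this

lemma Equivalent.aniso {Q : QuadraticForm F V} {Q' : QuadraticForm F W}
    (h : Q.Equivalent Q') (hn : Q.Anisotropic) : Q'.Anisotropic := by
  obtain ⟨e, he⟩ := Equivalent.out h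
  intro x hx
  have : e.symm x = 0 := hn _ (by rw [← he]; simpa using hx)
  simpa using this

lemma Dom.aniso {Q : QuadraticForm F V} {Q' : QuadraticForm F W}
    (h : Dom Q Q') (hn : Q'.Anisotropic) : Q.Anisotropic := by
  obtain ⟨f, hf, he⟩ := h
  intro x hx
  have : f x = 0 := hn _ (by rw [he, hx])
  exact hf (by simpa using this)

/-- The hyperbolic form. -/
abbrev hy (F : Type) [Field F] (n : ℕ) := QuadraticForm.dualProd F (Fin n → F)

lemma dual_equiv_of_nd [FiniteDimensional F V] {Q : QuadraticForm F V} (hQ : Nd Q) (l : Dual F V) :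
    ∃ v, ∀ w, polar Q v w = l w := by
  have hinj : Function.Injective (polarBilin Q) := by
    rw [← LinearMap.ker_eq_bot, LinearMap.ker_eq_bot']
    intro m hm
    exact hQ m fun y => by
      have := LinearMap.congr_fun hm y
      simpa using this
  have e := LinearMap.linearEquivOfInjective (polarBilin Q : V →ₗ[F] Dual F V) hinj
    (Subspace.dual_finrank_eq).symm
  have hs : Function.Surjective (polarBilin Q : V →ₗ[F] Dual F V) :=
    (LinearMap.injective_iff_surjective_of_finrank_eq_finrank (Subspace.dual_finrank_eq).symm).1 hinj
  obtain ⟨v, hv⟩ := hs l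
  exact ⟨v, fun w => by rw [← hv]; simp⟩

theorem delta [CharP F 2] [FiniteDimensional F U] [FiniteDimensional F V] [FiniteDimensional F X]
    {QU : QuadraticForm F U} {QV : QuadraticForm F V} {QX : QuadraticForm F X}
    (f : U →ₗ[F] V) (g : X →ₗ[F] V) (hf : Function.Injective f) (hg : Function.Injective g)
    (hf' : ∀ x, QV (f x) = QU x) (hg' : ∀ x, QV (g x) = QX x)
    (ho : ∀ x y, polar QV (f x) (g y) = 0) (hd : finrank F X + finrank F U = finrank F V)
    (hV : Nd QV) : (QU.prod QV).Equivalent (QX.prod (QuadraticForm.dualProd F U)) := by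
  obtain ⟨r, hr⟩ := f.exists_leftInverse_of_injective (LinearMap.ker_eq_bot.2 hf)
  have hr' : ∀ x, r (f x) = x := fun x => LinearMap.congr_fun hr x
  have hinj : Function.Injective (polarBilin QV) := by
    rw [← LinearMap.ker_eq_bot, LinearMap.ker_eq_bot']
    intro m hm
    exact hV m fun y => by
      have := LinearMap.congr_fun hm y
      simpa using this
  let E := LinearEquiv.ofInjectiveOfFinrankEq (polarBilin QV : V →ₗ[F] Dual F V) hinj
    (Subspace.dual_finrank_eq).symm
  let s : Dual F U →ₗ[F] V := E.symm.toLinearMap.comp r.dualMap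
  have hs : ∀ y w, polar QV (s y) w = y (r w) := by
    intro y w
    have h1 : polarBilin QV (s y) = r.dualMap y := by
      have : E (s y) = r.dualMap y := by simp [s]
      exact this
    have := LinearMap.congr_fun h1 w
    simpa using this
  obtain ⟨b, hb⟩ := LinearMap.BilinMap.toQuadraticMap_surjective (QV.comp s)
  let c : Dual F U →ₗ[F] U := (evalEquiv F U).symm.toLinearMap.comp b
  have hc : ∀ y, y (c y) = QV (s y) := by
    intro y
    have h1 : QV (s y) = b y y := by
      have := congrArg (fun q => q y) hb
      simpa using this.symm
    rw [h1]
    have h2 : evalEquiv F U (c y) = b y := by simp [c]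
    rw [← h2]; simp
  let u : (X × (Dual F U × U)) →ₗ[F] U :=
    (LinearMap.snd F _ _).comp (LinearMap.snd F _ _) + (r.comp g).comp (LinearMap.fst F _ _)
      + (c.comp (LinearMap.fst F _ _)).comp (LinearMap.snd F _ _)
  have hu : ∀ w y x, u (w, (y, x)) = x + r (g w) + c y := by
    intro w y x; simp [u]
  let M : (X × (Dual F U × U)) →ₗ[F] U × V :=
    u.prod (f.comp u + g.comp (LinearMap.fst F _ _)
      + (s.comp (LinearMap.fst F _ _)).comp (LinearMap.snd F _ _))
  have hM : ∀ w y x, M (w, (y, x)) = (u (w, (y, x)), f (u (w, (y, x))) + g w + s y) := by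
    intro w y x; simp [M]
  have two : (2 : F) = 0 := CharTwo.two_eq_zero
  have hMi : Function.Injective M := by
    rw [← LinearMap.ker_eq_bot, LinearMap.ker_eq_bot']
    rintro ⟨w, y, x⟩ h
    rw [hM] at h
    have h1 := congrArg Prod.fst h
    have h2 := congrArg Prod.snd h
    simp only [Prod.fst_zero, Prod.snd_zero] at h1 h2
    rw [h1, map_zero, zero_add] at h2
    have hy : y = 0 := by
      ext z
      have h3 : polar QV (g w + s y) (f z) = 0 := by rw [h2]; simp
      rw [polar_add_left, hs, hr', polar_comm, ho, zero_add] at h3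
      simpa using h3
    subst hy
    have hw : w = 0 := hg (by simpa using h2)
    subst hw
    rw [hu] at h1
    simp only [map_zero, add_zero] at h1
    subst h1; rfl
  refine QuadraticMap.Equivalent.symm (eqv_of (LinearEquiv.ofInjectiveOfFinrankEq M hMi ?_) ?_)
  · simp only [finrank_prod, Subspace.dual_finrank_eq]; omega
  · rintro ⟨w, y, x⟩
    change (QU.prod QV) (M (w, y, x)) = _
    rw [hM]
    simp only [prod_apply, QuadraticForm.dualProd_apply]
    rw [QuadraticMap.map_add QV, QuadraticMap.map_add QV, polar_add_left, ho, polar_comm _ (g w), hs,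
      polar_comm _ _ (s y), hs, hr', hf', hg', hu, ← hc]
    simp only [map_add]
    linear_combination (QU (x + r (g w) + c y) + y (c y) + y (r (g w))) * two

/-- orthogonal complement of two vectors -/
def perp2 (Q : QuadraticForm F V) (E G : V) : Submodule F V :=
  LinearMap.ker (polarBilin Q E) ⊓ LinearMap.ker (polarBilin Q G)

lemma mem_perp2 {Q : QuadraticForm F V} {E G v : V} :
    v ∈ perp2 Q E G ↔ polar Q E v = 0 ∧ polar Q G v = 0 := by
  simp [perp2]

lemma perp2_comm (Q : QuadraticForm F V) (E G : V) : perp2 Q E G = perp2 Q G E := by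
  unfold perp2; rw [inf_comm]

lemma polar_self_zero {Q : QuadraticForm F V} {E : V} (h : Q E = 0) : polar Q E E = 0 := by
  rw [QuadraticMap.polar_self, h]; simp

lemma perp2_iso (Q : QuadraticForm F V) (E G G' : V) (hE : Q E = 0) (hG : polar Q E G ≠ 0)
    (hG' : polar Q E G' ≠ 0) :
    (Q.comp (perp2 Q E G).subtype).Equivalent (Q.comp (perp2 Q E G').subtype) := by
  have key : ∀ G G' : V, polar Q E G ≠ 0 → polar Q E G' ≠ 0 →
      ∃ f : perp2 Q E G →ₗ[F] perp2 Q E G', ∀ x, (f x : V) = x - (polar Q G' x / polar Q G' E) • E := by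
    intro G G' hG hG'
    rw [polar_comm] at hG'
    refine ⟨LinearMap.codRestrict _
      ((perp2 Q E G).subtype - (((polar Q G' E)⁻¹ • (polarBilin Q G')).comp
        (perp2 Q E G).subtype).smulRight E) ?_, ?_⟩
    · intro x
      rw [mem_perp2]
      obtain ⟨h1, h2⟩ := mem_perp2.1 x.2
      simp [polar_sub_right, polar_smul_right, h1, polar_self_zero hE, mul_comm, hG']
    · intro x
      simp [div_eq_inv_mul]
  obtain ⟨f, hf⟩ := key G G' hG hG'
  obtain ⟨g, hg⟩ := key G' G hG' hG
  rw [polar_comm] at hG hG'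
  have hfg : ∀ (G G' : V), polar Q G E ≠ 0 → polar Q G' E ≠ 0 → ∀ (f : perp2 Q E G →ₗ[F] perp2 Q E G') (g : perp2 Q E G' →ₗ[F] perp2 Q E G),
     (∀ x, (f x : V) = x - (polar Q G' x / polar Q G' E) • E) → (∀ x, (g x : V) = x - (polar Q G x / polar Q G E) • E) → ∀ x, g (f x) = x := by
    intro G G' hG hG' f g hf hg x
    obtain ⟨h1, h2⟩ := mem_perp2.1 x.2
    apply Subtype.ext
    rw [hg, hf]
    simp only [polar_sub_right, polar_smul_right, h2, smul_eq_mul, zero_sub, neg_div]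
    rw [mul_div_cancel_right₀ _ hG]
    simp
  refine eqv_of (LinearEquiv.ofLinearMap f g (LinearMap.ext (hfg G' G hG' hG g f hg hf)) (LinearMap.ext (hfg G G' hG hG' f g hf hg))) ?_
  intro x
  obtain ⟨h1, h2⟩ := mem_perp2.1 x.2
  change Q ((f x : _) : V) = Q (x : V)
  rw [hf]
  rw [sub_eq_add_neg, QuadraticMap.map_add Q, QuadraticMap.map_neg, QuadraticMap.map_smul, hE, polar_neg_right, polar_smul_right, polar_comm _ (x : V) E, h1]
  simp

end Witt
end QFX

namespace QFX

open QuadraticMap Module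

section Witt

set_option linter.unusedSimpArgs false

variable {F : Type} [Field F]
variable {U V W X Y : Type} [AddCommGroup U] [Module F U] [AddCommGroup V] [Module F V]
  [AddCommGroup W] [Module F W] [AddCommGroup X] [Module F X] [AddCommGroup Y] [Module F Y]

lemma polar_prod' (P : QuadraticForm F V) (Q : QuadraticForm F W) (x y : V × W) :
    polar (P.prod Q) x y = polar P x.1 y.1 + polar Q x.2 y.2 := by
  simp [polar]; ring

lemma polar_dualProd (x y : Dual F U × U) :
    polar (QuadraticForm.dualProd F U) x y = x.1 y.2 + y.1 x.2 := by
  simp [polar]; ring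

lemma eqv_prod_assoc (P : QuadraticForm F U) (Q : QuadraticForm F V) (R : QuadraticForm F W) :
    ((P.prod Q).prod R).Equivalent (P.prod (Q.prod R)) :=
  eqv_of (LinearEquiv.prodAssoc F U V W) fun x => by simp [add_assoc]

lemma eqv_prod_comm (P : QuadraticForm F U) (Q : QuadraticForm F V) :
    (P.prod Q).Equivalent (Q.prod P) := ⟨IsometryEquiv.prodComm P Q⟩

lemma hy_eqv [FiniteDimensional F U] {n : ℕ} (h : finrank F U = n) :
    (QuadraticForm.dualProd F U).Equivalent (hy F n) :=
  ⟨QuadraticForm.dualProdIsometry (LinearEquiv.ofFinrankEq U (Fin n → F) (by simp [h]))⟩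

lemma hy_add (n m : ℕ) : (hy F (n + m)).Equivalent ((hy F n).prod (hy F m)) := by
  refine (QuadraticMap.Equivalent.trans ?_ ⟨QuadraticForm.dualProdProdIsometry⟩)
  exact ⟨QuadraticForm.dualProdIsometry (LinearEquiv.ofFinrankEq _ _ (by simp))⟩

lemma prod_zero_dim (P : QuadraticForm F U) (Q : QuadraticForm F V) [FiniteDimensional F V]
    (h : finrank F V = 0) : (P.prod Q).Equivalent P := by
  have := finrank_zero_iff.1 h
  refine QuadraticMap.Equivalent.symm (eqv_of (LinearEquiv.ofBijective (LinearMap.inl F U V) ⟨LinearMap.inl_injective, ?_⟩) ?_)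
  · rintro ⟨x, y⟩
    exact ⟨x, by simp [Subsingleton.elim y 0]⟩
  · intro x
    change P x + Q 0 = P x
    simp

lemma nd_hy (n : ℕ) : Nd (hy F n) := by
  rintro ⟨y, x⟩ h
  simp only [polar_dualProd] at h
  have h1 : y = 0 := LinearMap.ext fun z => by simpa using h (0, z)
  have h2 : x = 0 := by
    ext i
    simpa using h (LinearMap.proj i, 0)
  simp [h1, h2]

lemma perp_of_plane (Q : QuadraticForm F V) (P : QuadraticForm F X) (e : (X × (Dual F (Fin 1 → F) × (Fin 1 → F))) ≃ₗ[F] V)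
    (he : ∀ x, Q (e x) = (P.prod (hy F 1)) x) :
    P.Equivalent (Q.comp (perp2 Q (e (0, (0, 1))) (e (0, (LinearMap.proj 0, 0)))).subtype) := by
  have hp : ∀ x y, polar Q (e x) (e y) = polar (P.prod (hy F 1)) x y := fun x y =>
    polar_isom (f := e.toLinearMap) he x y
  let j : X →ₗ[F] perp2 Q (e (0, (0, 1))) (e (0, (LinearMap.proj 0, 0))) :=
    LinearMap.codRestrict _ (e.toLinearMap.comp (LinearMap.inl F _ _)) (by
      intro x
      rw [mem_perp2]
      simp [hp, polar_prod'])
  refine eqv_of (LinearEquiv.ofBijective j ⟨?_, ?_⟩) ?_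
  · intro x y hxy
    have := congrArg Subtype.val hxy
    simpa [j] using this
  · rintro ⟨v, hv⟩
    obtain ⟨⟨x, ⟨y, u⟩⟩, rfl⟩ := e.surjective v
    rw [mem_perp2] at hv
    simp only [hp, polar_prod', polar_dualProd] at hv
    have hy0 : y = 0 := by
      refine LinearMap.pi_ext' fun i => LinearMap.ext_ring ?_
      have : (1 : Fin 1 → F) = Pi.single i 1 := by ext k; simp [Subsingleton.elim k i]
      simpa [this] using hv.1
    have hu0 : u = 0 := by
      ext i
      simpa [Subsingleton.elim i 0] using hv.2
    exact ⟨x, Subtype.ext (by simp [j, hy0, hu0]; rfl)⟩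
  · intro x
    change Q (e (x, 0)) = P x
    rw [he]; simp

lemma perp2_all (Q : QuadraticForm F V) (E G E' G' : V) (a1 : Q E = 0) (a2 : Q G = 0)
    (a3 : polar Q E G ≠ 0) (b1 : Q E' = 0) (b2 : Q G' = 0) (b3 : polar Q E' G' ≠ 0) :
    (Q.comp (perp2 Q E G).subtype).Equivalent (Q.comp (perp2 Q E' G').subtype) := by
  by_cases c : polar Q E E' = 0
  · obtain ⟨g, g1, g2, g3⟩ : ∃ g, Q g = 0 ∧ polar Q E g ≠ 0 ∧ polar Q E' g ≠ 0 := by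
      by_cases c1 : polar Q E' G = 0
      · by_cases c2 : polar Q E G' = 0
        · refine ⟨G + G' - (polar Q G G' / polar Q E G) • E, ?_, ?_, ?_⟩
          · have c3 : polar Q G' E = 0 := by rw [polar_comm]; exact c2
            rw [sub_eq_add_neg, QuadraticMap.map_add Q, QuadraticMap.map_add Q, QuadraticMap.map_neg, QuadraticMap.map_smul, a1, a2,
              b2, polar_neg_right, polar_smul_right, polar_add_left, polar_comm _ G E, c3]
            simp only [smul_eq_mul, add_zero, mul_zero, zero_add]
            rw [div_mul_cancel₀ _ a3]; simp
          · simp [polar_sub_right, polar_add_right, polar_smul_right, polar_self_zero a1, c2, a3]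
          · simp [polar_sub_right, polar_add_right, polar_smul_right, polar_comm _ E' E, c, c1, b3]
        · exact ⟨G', b2, c2, b3⟩
      · exact ⟨G, a2, a3, c1⟩
    refine (perp2_iso Q E G g a1 a3 g2).trans ?_
    rw [perp2_comm Q E g]
    rw [polar_comm] at g2 
    refine (perp2_iso Q g E E' g1 g2 (by rw [polar_comm]; exact g3)).trans ?_
    rw [perp2_comm Q g E']
    exact perp2_iso Q E' g G' b1 g3 b3
  · refine (perp2_iso Q E G E' a1 a3 c).trans ?_
    rw [perp2_comm Q E E']
    exact perp2_iso Q E' E G' b1 (by rw [polar_comm]; exact c) b3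

theorem cancel1 {P : QuadraticForm F X} {R : QuadraticForm F Y}
    (h : (P.prod (hy F 1)).Equivalent (R.prod (hy F 1))) : P.Equivalent R := by
  obtain ⟨φ, hφ⟩ := Equivalent.out h
  set Q := R.prod (hy F 1) with hQ
  have h1 := perp_of_plane Q P φ hφ
  have h2 := perp_of_plane Q R (LinearEquiv.refl F _) (fun x => rfl)
  have hp : ∀ x y, polar Q (φ x) (φ y) = polar (P.prod (hy F 1)) x y := fun x y =>
    polar_isom (f := φ.toLinearMap) hφ x y
  have a1 : Q (φ (0, (0, 1))) = 0 := by rw [hφ]; simp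
  have a2 : Q (φ (0, (LinearMap.proj 0, 0))) = 0 := by rw [hφ]; simp
  have a3 : polar Q (φ (0, (0, 1))) (φ (0, (LinearMap.proj 0, 0))) ≠ 0 := by
    rw [hp]; simp [polar_prod', polar_dualProd]
  have b1 : Q (0, (0, 1)) = 0 := by simp [hQ]
  have b2 : Q (0, (LinearMap.proj 0, 0)) = 0 := by simp [hQ]
  have b3 : polar Q (0, (0, 1)) (0, (LinearMap.proj 0, 0)) ≠ 0 := by
    simp [hQ, polar_prod', polar_dualProd]
  have h3 := perp2_all Q _ _ _ _ a1 a2 a3 b1 b2 b3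
  exact QuadraticMap.Equivalent.trans h1 (QuadraticMap.Equivalent.trans h3 (QuadraticMap.Equivalent.symm h2))

theorem cancel {P : QuadraticForm F X} {R : QuadraticForm F Y} (n : ℕ)
    (h : (P.prod (hy F n)).Equivalent (R.prod (hy F n))) : P.Equivalent R := by
  induction n with
  | zero =>
    exact (prod_zero_dim P (hy F 0) (by simp)).symm.trans (h.trans (prod_zero_dim R (hy F 0) (by simp)))
  | succ n ih =>
    apply ih
    apply cancel1
    refine (eqv_prod_assoc _ _ _).trans (QuadraticMap.Equivalent.trans ?_ (eqv_prod_assoc _ _ _).symm)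
    exact (Equivalent.prod (.refl _) (hy_add n 1).symm).trans (h.trans (Equivalent.prod (.refl _) (hy_add n 1)))

/-- an isotropic nonradical vector in an equivalent form -/
lemma hy_pos_of_aniso_zero {P : QuadraticForm F X} (hP : P.Anisotropic) {n : ℕ}
    {Z : Type} [AddCommGroup Z] [Module F Z]
    {R : QuadraticForm F Y}
    (h : (P.prod (0 : QuadraticForm F Z)).Equivalent (R.prod (hy F n))) : n = 0 := by
  by_contra hn
  obtain ⟨φ, hφ⟩ := Equivalent.out h.symm
  have hn' : 0 < n := Nat.pos_of_ne_zero hn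
  let i : Fin n := ⟨0, hn'⟩
  let E : Y × (Dual F (Fin n → F) × (Fin n → F)) := (0, (0, Pi.single i 1))
  let G : Y × (Dual F (Fin n → F) × (Fin n → F)) := (0, (LinearMap.proj i, 0))
  have hp := polar_isom (f := φ.toLinearMap) hφ E G
  have hE := hφ E
  have h1 : (φ E).1 = 0 := hP _ (by
    have : (R.prod (hy F n)) E = 0 := by simp [E]
    rw [this] at hE
    simpa using hE)
  have h2 : polar (P.prod (0 : QuadraticForm F Z)) (φ E) (φ G) = 0 := by
    rw [polar_prod', h1]; simp [polar]
  have h3 : polar (R.prod (hy F n)) E G = 1 := by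
    simp [polar_prod', polar_dualProd, E, G]
  simp only [LinearEquiv.coe_coe] at hp
  rw [h2, h3] at hp
  exact zero_ne_one hp

lemma dom_of_prod_zero {P : QuadraticForm F X} (hP : P.Anisotropic)
    {Z Z' : Type} [AddCommGroup Z] [Module F Z] [AddCommGroup Z'] [Module F Z']
    {R : QuadraticForm F Y}
    (h : (P.prod (0 : QuadraticForm F Z)).Equivalent (R.prod (0 : QuadraticForm F Z'))) : Dom P R := by
  obtain ⟨φ, hφ⟩ := Equivalent.out h
  have key : ∀ x, R (φ (x, 0)).1 = P x := fun x => by simpa using hφ (x, 0)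
  refine ⟨(LinearMap.fst F _ _).comp (φ.toLinearMap.comp (LinearMap.inl F _ _)), ?_, fun x => key x⟩
  rw [← LinearMap.ker_eq_bot, LinearMap.ker_eq_bot']
  intro x hx
  apply hP
  rw [← key]
  have : (φ (x, 0)).1 = 0 := hx
  rw [this]; simp

/-- Uniqueness in the Witt decomposition. -/
theorem witt_unique [FiniteDimensional F X] [FiniteDimensional F Y]
    {P : QuadraticForm F X} (hP : P.Anisotropic) {R : QuadraticForm F Y} (hR : R.Anisotropic)
    {Z Z' : Type} [AddCommGroup Z] [Module F Z] [AddCommGroup Z'] [Module F Z'] {n m : ℕ}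
    (h : ((P.prod (0 : QuadraticForm F Z)).prod (hy F n)).Equivalent
      ((R.prod (0 : QuadraticForm F Z')).prod (hy F m))) : P.Equivalent R ∧ n = m := by
  have key : ∀ {X Y Z Z' : Type} [AddCommGroup X] [Module F X] [AddCommGroup Y] [Module F Y]
     [AddCommGroup Z] [Module F Z] [AddCommGroup Z'] [Module F Z'] {P : QuadraticForm F X} {R : QuadraticForm F Y},
     P.Anisotropic → R.Anisotropic → ∀ n k, ((P.prod (0 : QuadraticForm F Z)).prod (hy F n)).Equivalent
      ((R.prod (0 : QuadraticForm F Z')).prod (hy F (k + n))) → k = 0 := by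
    intro X Y Z Z' _ _ _ _ _ _ _ _ P R hP hR n k h
    have h' := cancel n (h.trans ((Equivalent.prod (.refl _) (hy_add k n)).trans (eqv_prod_assoc _ _ _).symm))
    exact hy_pos_of_aniso_zero hP h'
  have hnm : n = m := by
    rcases le_total n m with hle | hle
    · obtain ⟨k, rfl⟩ := Nat.exists_eq_add_of_le' hle
      have := key hP hR n k h; omega
    · obtain ⟨k, rfl⟩ := Nat.exists_eq_add_of_le' hle
      have := key hR hP m k h.symm; omega
  subst hnm
  have h' := cancel n h
  have d1 := dom_of_prod_zero hP h'
  have d2 := dom_of_prod_zero hR h'.symm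
  exact ⟨d1.eqv (le_antisymm d1.le d2.le), rfl⟩

end Witt
end QFX

namespace QFX

open QuadraticMap Module

section Bridge

set_option linter.unusedSimpArgs false
set_option linter.unusedVariables false

variable {F : Type} [Field F] {n m : ℕ}

lemma isom_iff {q : QF F n} {q' : QF F m} : QF.Isom q q' ↔ (tq q).Equivalent (tq q') := by
  constructor
  · rintro ⟨e, he⟩
    exact eqv_of e he
  · intro h
    exact Equivalent.out h

lemma dominated_iff {q : QF F n} {q' : QF F m} : QF.Dominated q q' ↔ Dom (tq q) (tq q') := Iff.rfl

lemma aniso_iff {q : QF F n} : QF.Anisotropic q ↔ (tq q).Anisotropic := Iff.rfl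

lemma an_iff {q : QF F n} : An q ↔ (tq q).Anisotropic := Iff.rfl

lemma ev_reindex {R : Type*} [CommRing R] {ι : Type*} [Fintype ι] (e : ι ≃ Fin n) (M : Matrix ι ι R) (x : Fin n → R) :
    ev (Matrix.reindex e e M) x = ∑ i, ∑ j, M i j * x (e i) * x (e j) := by
  unfold ev
  rw [← e.sum_comp]
  refine Finset.sum_congr rfl fun i _ => ?_
  rw [← e.sum_comp]
  simp

lemma tq_orthSum (p : QF F n) (q : QF F m) :
    (tq (QF.orthSum p q)).Equivalent ((tq p).prod (tq q)) := by
  refine eqv_of ((LinearEquiv.funCongrLeft F F finSumFinEquiv).trans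
    (LinearEquiv.sumArrowLequivProdArrow (Fin n) (Fin m) F F)) fun x => ?_
  rw [tq_apply]
  unfold QF.orthSum
  rw [ev_reindex]
  simp only [Fintype.sum_sum_type, Matrix.fromBlocks_apply₁₁, Matrix.fromBlocks_apply₁₂,
    Matrix.fromBlocks_apply₂₁, Matrix.fromBlocks_apply₂₂, Matrix.zero_apply, zero_mul,
    Finset.sum_const_zero, add_zero, zero_add]
  rfl

lemma ev_binSum {r : ℕ} (a b : Fin r → F) (x : Fin (r + r) → F) : ev (QF.binSum a b) x =
    ∑ i, (a i * x (finSumFinEquiv (Sum.inl i)) ^ 2 + x (finSumFinEquiv (Sum.inl i)) * x (finSumFinEquiv (Sum.inr i))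
      + b i * x (finSumFinEquiv (Sum.inr i)) ^ 2) := by
  unfold QF.binSum
  rw [ev_reindex]
  simp only [Fintype.sum_sum_type, Matrix.fromBlocks_apply₁₁, Matrix.fromBlocks_apply₁₂,
    Matrix.fromBlocks_apply₂₁, Matrix.fromBlocks_apply₂₂, Matrix.zero_apply, zero_mul,
    Finset.sum_const_zero, add_zero, zero_add, Matrix.diagonal_apply, Matrix.one_apply, ite_mul, one_mul,
    Finset.sum_ite_eq, Finset.mem_univ, if_true]
  rw [← Finset.sum_add_distrib]
  refine Finset.sum_congr rfl fun i _ => ?_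
  ring

lemma tq_hyper (n : ℕ) : (tq (QF.hyper n : QF F (n + n))).Equivalent (hy F n) := by
  refine eqv_of (((LinearEquiv.funCongrLeft F F finSumFinEquiv).trans
    (LinearEquiv.sumArrowLequivProdArrow (Fin n) (Fin n) F F)).trans
    (LinearEquiv.prodCongr (Pi.basisFun F (Fin n)).toDualEquiv (LinearEquiv.refl F _))) fun x => ?_
  rw [tq_apply]
  unfold QF.hyper
  rw [ev_binSum]
  simp only [Pi.zero_apply, zero_mul, zero_add, add_zero, QuadraticForm.dualProd_apply]
  rw [LinearMap.pi_apply_eq_sum_univ]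
  refine Finset.sum_congr rfl fun i _ => ?_
  have hb : (fun j => if i = j then (1 : F) else 0) = Pi.basisFun F (Fin n) i := by
    ext j; simp [Pi.single_apply, eq_comm]
  rw [hb]
  change x (finSumFinEquiv (Sum.inr i)) • ((Pi.basisFun F (Fin n)).toDual
    (fun k => x (finSumFinEquiv (Sum.inl k)))) (Pi.basisFun F (Fin n) i) = _
  rw [Basis.toDual_apply_left, Pi.basisFun_repr, smul_eq_mul, mul_comm]

lemma tq_zeroForm (d : ℕ) : tq (QF.zeroForm d : QF F d) = 0 := by
  ext x; simp [QF.zeroForm, ev]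

lemma tq_smul (a : F) (q : QF F n) : tq (a • q) = a • tq q := by
  ext x; simp [smul_ev]

lemma tq_cast (h : n = m) (q : QF F n) : (tq (QF.castQF h q)).Equivalent (tq q) := by
  subst h
  have : QF.castQF rfl q = q := by ext; simp [QF.castQF]
  rw [this]
  exact .refl _

lemma ev_diag {s : ℕ} (c : Fin s → F) (x : Fin s → F) : ev (QF.diag c) x = ∑ i, c i * x i ^ 2 := by
  simp [ev, QF.diag, Matrix.diagonal_apply, pow_two, mul_assoc]

lemma polar_diag [CharP F 2] {s : ℕ} (c : Fin s → F) (x y : Fin s → F) :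
    polar (tq (QF.diag c)) x y = 0 := by
  simp only [polar, tq_apply, ev_diag, Pi.add_apply, CharTwo.add_sq, mul_add, Finset.sum_add_distrib]
  ring

lemma nd_binSum {r : ℕ} [CharP F 2] (a b : Fin r → F) : Nd (tq (QF.binSum a b)) := by
  intro x hx
  have key : ∀ y, polar (tq (QF.binSum a b)) x y = ∑ i, (x (finSumFinEquiv (Sum.inl i)) * y (finSumFinEquiv (Sum.inr i))
      + y (finSumFinEquiv (Sum.inl i)) * x (finSumFinEquiv (Sum.inr i))) := by
    intro y
    simp only [polar, tq_apply, ev_binSum, ← Finset.sum_sub_distrib]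
    refine Finset.sum_congr rfl fun i _ => ?_
    simp only [Pi.add_apply, CharTwo.add_sq]
    ring
  ext j
  obtain ⟨j, rfl⟩ := finSumFinEquiv.surjective j
  rcases j with j | j
  · have := hx (Pi.single (finSumFinEquiv (Sum.inr j)) 1)
    rw [key] at this
    simpa only [Pi.single_apply, finSumFinEquiv.injective.eq_iff, reduceCtorEq, Sum.inl.injEq, Sum.inr.injEq, if_false, Pi.zero_apply, zero_mul, mul_zero, add_zero, zero_add, mul_ite, ite_mul, mul_one, one_mul, Finset.sum_ite_eq', Finset.mem_univ, if_true] using this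
  · have := hx (Pi.single (finSumFinEquiv (Sum.inl j)) 1)
    rw [key] at this
    simpa only [Pi.single_apply, finSumFinEquiv.injective.eq_iff, reduceCtorEq, Sum.inl.injEq, Sum.inr.injEq, if_false, Pi.zero_apply, zero_mul, mul_zero, add_zero, zero_add, mul_ite, ite_mul, mul_one, one_mul, Finset.sum_ite_eq', Finset.mem_univ, if_true] using this

lemma tq_sumFam_zero {D : ℕ → ℕ} (f : ∀ i, QF F (D i)) : finrank F (Fin (∑ i ∈ Finset.range 0, D i) → F) = 0 := by
  rw [Finset.range_zero, Finset.sum_empty]; simp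

lemma tq_sumFam_succ {D : ℕ → ℕ} (f : ∀ i, QF F (D i)) (h : ℕ) :
    (tq (QF.sumFam f (h + 1))).Equivalent ((tq (QF.sumFam f h)).prod (tq (f h))) :=
  (tq_cast _ _).trans (tq_orthSum _ _)

lemma exists_tq {V : Type} [AddCommGroup V] [Module F V] [FiniteDimensional F V] (Q : QuadraticForm F V)
    (n : ℕ) (h : finrank F V = n) : ∃ p : QF F n, (tq p).Equivalent Q := by
  let e : (Fin n → F) ≃ₗ[F] V := LinearEquiv.ofFinrankEq _ _ (by simp [h])
  obtain ⟨b, hb⟩ := LinearMap.BilinMap.toQuadraticMap_surjective (Q.comp e.toLinearMap)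
  refine ⟨Matrix.of fun i j => b (Pi.single i 1) (Pi.single j 1), eqv_of e fun x => ?_⟩
  have h1 : Q (e x) = b x x := by
    have := congrArg (fun q => q x) hb
    simpa using this.symm
  rw [h1, tq_apply]
  unfold ev
  rw [LinearMap.pi_apply_eq_sum_univ b x]
  simp only [LinearMap.sum_apply, LinearMap.smul_apply]
  refine Finset.sum_congr rfl fun i _ => ?_
  rw [LinearMap.pi_apply_eq_sum_univ (b _) x]
  simp only [smul_eq_mul, Finset.mul_sum]
  refine Finset.sum_congr rfl fun j _ => ?_
  have (k : Fin n) : (fun j => if k = j then (1 : F) else 0) = Pi.single k 1 := by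
    ext j; simp [Pi.single_apply, eq_comm]
  rw [this, this, Matrix.of_apply]; ring

end Bridge

section WI
variable {F : Type} [Field F] {n m : ℕ}

lemma wittIndex_set_iff (q : QF F n) (w : ℕ) : (∃ (m : ℕ) (q' : QF F m), QF.Isom q (QF.orthSum q' (QF.hyper w))) ↔
    ∃ (m : ℕ) (q' : QF F m), (tq q).Equivalent ((tq q').prod (hy F w)) := by
  refine exists_congr fun m => exists_congr fun q' => ?_
  rw [isom_iff]
  have := (tq_orthSum q' (QF.hyper w : QF F (w+w))).trans (Equivalent.prod (.refl (tq q')) (tq_hyper w))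
  exact ⟨fun h => h.trans this, fun h => h.trans this.symm⟩

lemma wittIndex_mem (q : QF F n) : ∃ (m : ℕ) (q' : QF F m), (tq q).Equivalent ((tq q').prod (hy F (QF.wittIndex q))) := by
  rw [← wittIndex_set_iff]
  refine Nat.sSup_mem (s := {w | ∃ (m : ℕ) (q' : QF F m), QF.Isom q (QF.orthSum q' (QF.hyper w))}) ⟨0, ?_⟩ ⟨n, ?_⟩
  · exact (wittIndex_set_iff q 0).2 ⟨n, q, (prod_zero_dim _ _ (by simp)).symm⟩
  · intro w hw
    obtain ⟨m, q', h⟩ := (wittIndex_set_iff q w).1 hw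
    have := Equivalent.finrank_eq h
    simp [Subspace.dual_finrank_eq] at this
    omega

lemma le_wittIndex (q : QF F n) {w : ℕ} {V : Type} [AddCommGroup V] [Module F V] [FiniteDimensional F V] {Q : QuadraticForm F V}
    (h : (tq q).Equivalent (Q.prod (hy F w))) : w ≤ QF.wittIndex q := by
  obtain ⟨p, hp⟩ := exists_tq Q _ rfl
  refine le_csSup ⟨n, ?_⟩ ((wittIndex_set_iff q w).2 ⟨_, p, h.trans (Equivalent.prod hp.symm (.refl _))⟩)
  intro w hw
  obtain ⟨m, q', h⟩ := (wittIndex_set_iff q w).1 hw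
  have := Equivalent.finrank_eq h
  simp [Subspace.dual_finrank_eq] at this
  omega

theorem wittIndex_prod (q : QF F n) (p : QF F m) (k : ℕ) (h : (tq q).Equivalent ((tq p).prod (hy F k))) :
    QF.wittIndex q = QF.wittIndex p + k := by
  apply le_antisymm
  · obtain ⟨l, q', h'⟩ := wittIndex_mem q
    have hk := le_wittIndex q h
    obtain ⟨j, hj⟩ := Nat.exists_eq_add_of_le' hk
    rw [hj] at h' ⊢
    have := cancel k (h.symm.trans (h'.trans ((Equivalent.prod (.refl _) (hy_add j k)).trans (eqv_prod_assoc _ _ _).symm)))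
    have := le_wittIndex p this
    omega
  · obtain ⟨l, q', h'⟩ := wittIndex_mem p
    refine le_wittIndex (Q := tq q') q ?_
    exact h.trans ((Equivalent.prod h' (.refl _)).trans ((eqv_prod_assoc _ _ _).trans (Equivalent.prod (.refl _) (hy_add _ _).symm)))

theorem wittIndex_aniso (q : QF F n) (h : (tq q).Anisotropic) : QF.wittIndex q = 0 := by
  obtain ⟨l, q', h'⟩ := wittIndex_mem q
  refine hy_pos_of_aniso_zero (Z := Fin 0 → F) h (R := tq q') ?_
  exact (prod_zero_dim _ _ (by simp)).trans h'

theorem wittIndex_polar_zero (q : QF F n) (h : ∀ x y, polar (tq q) x y = 0) : QF.wittIndex q = 0 := by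
  obtain ⟨l, q', h'⟩ := wittIndex_mem q
  by_contra hn
  obtain ⟨φ, hφ⟩ := Equivalent.out h'.symm
  generalize QF.wittIndex q = n at *
  have hn' : 0 < n := Nat.pos_of_ne_zero hn
  let i : Fin n := ⟨0, hn'⟩
  have hp := polar_isom (f := φ.toLinearMap) hφ (0, (0, Pi.single i 1)) (0, (LinearMap.proj i, 0))
  rw [h, polar_prod', polar_dualProd] at hp
  simp at hp

lemma isAnisotropicPart_iff (q : QF F n) (qa : QF F m) : QF.IsAnisotropicPart q qa ↔ (tq qa).Anisotropic ∧
    ∃ w d : ℕ, (tq q).Equivalent (((tq qa).prod (0 : QuadraticForm F (Fin d → F))).prod (hy F w)) := by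
  unfold QF.IsAnisotropicPart
  rw [aniso_iff]
  refine and_congr Iff.rfl (exists_congr fun w => exists_congr fun d => ?_)
  rw [isom_iff]
  have h1 := tq_orthSum (QF.orthSum qa (QF.hyper w)) (QF.zeroForm d : QF F d)
  rw [tq_zeroForm] at h1
  have h2 := h1.trans (Equivalent.prod ((tq_orthSum qa (QF.hyper w)).trans (Equivalent.prod (.refl _) (tq_hyper w))) (.refl 0))
  have h3 := h2.trans ((eqv_prod_assoc _ _ _).trans ((Equivalent.prod (.refl _) (eqv_prod_comm _ _)).trans (eqv_prod_assoc _ _ _).symm))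
  exact ⟨fun h => h.trans h3, fun h => h.trans h3.symm⟩

theorem anisoPart_unique {l : ℕ} {q : QF F n} {p : QF F m} {p' : QF F l} (h : QF.IsAnisotropicPart q p)
   (h' : QF.IsAnisotropicPart q p') : (tq p).Equivalent (tq p') := by
  rw [isAnisotropicPart_iff] at h h'
  obtain ⟨a, w, d, e⟩ := h
  obtain ⟨a', w', d', e'⟩ := h'
  exact (witt_unique a a' (e.symm.trans e')).1

end WI
end QFX

namespace QFX

open QuadraticMap Module

section Comp

variable {F : Type} [Field F]
variable {U V W X Y : Type} [AddCommGroup U] [Module F U] [AddCommGroup V] [Module F V]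
  [AddCommGroup W] [Module F W] [AddCommGroup X] [Module F X] [AddCommGroup Y] [Module F Y]

/-- `P` and `Q` are orthogonal complements of each other in `R`. -/
def Compl (P : QuadraticForm F U) (Q : QuadraticForm F X) (R : QuadraticForm F V) : Prop :=
  ∃ (f : U →ₗ[F] V) (g : X →ₗ[F] V), Function.Injective f ∧ Function.Injective g ∧
    (∀ x, R (f x) = P x) ∧ (∀ x, R (g x) = Q x) ∧ (∀ x y, polar R (f x) (g y) = 0) ∧
    finrank F X + finrank F U = finrank F V

variable {P : QuadraticForm F U} {Q : QuadraticForm F X} {R : QuadraticForm F V}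

lemma Compl.symm (h : Compl P Q R) : Compl Q P R := by
  obtain ⟨f, g, hf, hg, hf', hg', ho, hd⟩ := h
  exact ⟨g, f, hg, hf, hg', hf', fun x y => by rw [polar_comm]; exact ho y x, by omega⟩

lemma Compl.dom (h : Compl P Q R) : Dom P R := by
  obtain ⟨f, g, hf, hg, hf', hg', ho, hd⟩ := h
  exact ⟨f, hf, hf'⟩

lemma Compl.finrank (h : Compl P Q R) : finrank F X + finrank F U = finrank F V := by
  obtain ⟨f, g, hf, hg, hf', hg', ho, hd⟩ := h
  exact hd

lemma Compl.congr (h : Compl P Q R) {P' : QuadraticForm F W} (e : P.Equivalent P') : Compl P' Q R := by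
  obtain ⟨f, g, hf, hg, hf', hg', ho, hd⟩ := h
  obtain ⟨e, he⟩ := Equivalent.out e.symm
  exact ⟨f.comp e.toLinearMap, g, hf.comp e.injective, hg, fun x => by simp [hf', he], hg', fun x y => ho _ y,
    by rw [e.finrank_eq]; exact hd⟩

lemma Compl.congr3 (h : Compl P Q R) {R' : QuadraticForm F W} (e : R.Equivalent R') : Compl P Q R' := by
  obtain ⟨f, g, hf, hg, hf', hg', ho, hd⟩ := h
  obtain ⟨e, he⟩ := Equivalent.out e
  exact ⟨e.toLinearMap.comp f, e.toLinearMap.comp g, e.injective.comp hf, e.injective.comp hg,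
    fun x => by simp [hf', he], fun x => by simp [hg', he],
    fun x y => by rw [← ho x y]; exact polar_isom (f := e.toLinearMap) he _ _,
    by rw [← e.finrank_eq]; exact hd⟩

theorem Compl.eqv [CharP F 2] [FiniteDimensional F U] [FiniteDimensional F V] [FiniteDimensional F X]
    (h : Compl P Q R) (hR : Nd R) : (P.prod R).Equivalent (Q.prod (hy F (Module.finrank F U))) := by
  obtain ⟨f, g, hf, hg, hf', hg', ho, hd⟩ := h
  exact (delta f g hf hg hf' hg' ho hd hR).trans (Equivalent.prod (.refl _) (hy_eqv rfl))

theorem Dom.exists_compl [FiniteDimensional F U] [FiniteDimensional F V]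
    (h : Dom P R) (hR : Nd R) (k : ℕ) (hk : k + finrank F U = finrank F V) :
    ∃ p : QF F k, Compl P (tq p) R := by
  obtain ⟨f, hf, hf'⟩ := h
  let L : V →ₗ[F] Dual F U := f.dualMap.comp (polarBilin R)
  have hL : Function.Surjective L := by
    intro l
    obtain ⟨l', hl'⟩ := LinearMap.dualMap_surjective_of_injective hf l
    obtain ⟨v, hv⟩ := dual_equiv_of_nd hR l'
    refine ⟨v, ?_⟩
    rw [← hl']
    ext x
    simp [L, hv]
  have hd := L.finrank_range_add_finrank_ker
  rw [LinearMap.range_eq_top.2 hL, finrank_top, Subspace.dual_finrank_eq] at hd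
  obtain ⟨p, hp⟩ := exists_tq (R.comp (LinearMap.ker L).subtype) k (by omega)
  obtain ⟨e, he⟩ := Equivalent.out hp
  refine ⟨p, f, (LinearMap.ker L).subtype.comp e.toLinearMap, hf,
    (Submodule.subtype_injective _).comp e.injective, hf', fun x => he x, ?_, by simpa using hk⟩
  intro x y
  have h1 : L (e y) = 0 := (e y).2
  have h2 : polarBilin R (e y : V) (f x) = 0 := LinearMap.congr_fun h1 x
  rw [polar_comm]
  exact h2

/-- a dominated nondegenerate form splits off -/
theorem Dom.split [FiniteDimensional F U] [FiniteDimensional F V]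
    (h : Dom P R) (hP : Nd P) (hR : Nd R) :
    ∃ (k : ℕ) (p : QF F k), R.Equivalent (P.prod (tq p)) := by
  have hle := h.le
  obtain ⟨p, f, g, hf, hg, hf', hg', ho, hd⟩ := h.exists_compl hR (finrank F V - finrank F U) (by omega)
  refine ⟨_, p, QuadraticMap.Equivalent.symm (eqv_of (LinearEquiv.ofInjectiveOfFinrankEq (f.coprod g) ?_ (by simpa [add_comm] using hd)) ?_)⟩
  · rw [← LinearMap.ker_eq_bot, LinearMap.ker_eq_bot']
    rintro ⟨x, y⟩ hxy
    simp only [LinearMap.coprod_apply] at hxy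
    have hx : x = 0 := hP x fun z => by
      rw [← polar_isom hf']
      have : polar R (f x + g y) (f z) = 0 := by rw [hxy]; simp
      rw [polar_add_left, polar_comm _ (g y), ho, add_zero] at this
      exact this
    subst hx
    have : y = 0 := hg (by simpa using hxy)
    simp [this]
  · rintro ⟨x, y⟩
    change R (f x + g y) = _
    rw [QuadraticMap.map_add R, ho, hf', hg']; simp

/-- `T` is the radical of `P`. -/
def HasRad (P : QuadraticForm F U) (T : QuadraticForm F W) : Prop :=
  ∃ f : W →ₗ[F] U, Function.Injective f ∧ (∀ x, P (f x) = T x) ∧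
    ∀ x, (∀ y, polar P x y = 0) ↔ x ∈ LinearMap.range f

lemma HasRad.unique {T : QuadraticForm F W} {T' : QuadraticForm F Y} (h : HasRad P T) (h' : HasRad P T') :
    T.Equivalent T' := by
  obtain ⟨f, hf, hf', hr⟩ := h
  obtain ⟨g, hg, hg', hr'⟩ := h'
  have : LinearMap.range f = LinearMap.range g := by ext x; rw [← hr, ← hr']
  let e : W ≃ₗ[F] Y := (LinearEquiv.ofInjective f hf).trans ((LinearEquiv.ofEq _ _ this).trans (LinearEquiv.ofInjective g hg).symm)
  refine eqv_of e fun x => ?_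
  have h1 : g (e x) = f x := by
    have : LinearEquiv.ofInjective g hg (e x) = LinearEquiv.ofEq _ _ this (LinearEquiv.ofInjective f hf x) := by simp [e]
    exact congrArg Subtype.val this
  rw [← hg', h1, hf']

lemma HasRad.congr {T : QuadraticForm F W} (h : HasRad P T) {P' : QuadraticForm F Y} (e : P.Equivalent P') :
    HasRad P' T := by
  obtain ⟨f, hf, hf', hr⟩ := h
  obtain ⟨e, he⟩ := Equivalent.out e
  refine ⟨e.toLinearMap.comp f, e.injective.comp hf, fun x => by simp [he, hf'], fun x => ?_⟩
  obtain ⟨x, rfl⟩ := e.surjective x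
  have : (∀ y, polar P' (e x) y = 0) ↔ ∀ y, polar P x y = 0 := by
    rw [e.surjective.forall]
    exact forall_congr' fun y => by rw [← polar_isom (f := e.toLinearMap) he]; rfl
  rw [this, hr]
  simp

lemma HasRad.polar_zero (T : QuadraticForm F W) (h : ∀ x y, polar T x y = 0) : HasRad T T :=
  ⟨LinearMap.id, Function.injective_id, fun _ => rfl, fun x => by simp [h]⟩

lemma HasRad.prod (T : QuadraticForm F W) (h : ∀ x y, polar T x y = 0) (hP : Nd P) : HasRad (P.prod T) T := by
  refine ⟨LinearMap.inr F _ _, LinearMap.inr_injective, fun x => by simp, ?_⟩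
  rintro ⟨u, w⟩
  simp only [polar_prod', h, add_zero]
  constructor
  · intro h
    have := hP u fun y => h (y, 0)
    exact ⟨w, by simp [this]⟩
  · rintro ⟨x, hx⟩ y
    have : u = 0 := (congrArg Prod.fst hx).symm
    rw [this]; simp

lemma Compl.mem_range [FiniteDimensional F U] [FiniteDimensional F V] [FiniteDimensional F X]
    {f : U →ₗ[F] V} {g : X →ₗ[F] V} (hf : Function.Injective f) (hg : Function.Injective g)
    (ho : ∀ x y, polar R (f x) (g y) = 0) (hd : Module.finrank F X + Module.finrank F U = Module.finrank F V) (hR : Nd R)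
    (v : V) (hv : ∀ x, polar R (f x) v = 0) : v ∈ LinearMap.range g := by
  let L : V →ₗ[F] Dual F U := f.dualMap.comp (polarBilin R)
  have hL : Function.Surjective L := by
    intro l
    obtain ⟨l', hl'⟩ := LinearMap.dualMap_surjective_of_injective hf l
    obtain ⟨v, hv⟩ := dual_equiv_of_nd hR l'
    refine ⟨v, ?_⟩
    rw [← hl']
    ext x
    simp [L, hv]
  have hd' := L.finrank_range_add_finrank_ker
  rw [LinearMap.range_eq_top.2 hL, finrank_top, Subspace.dual_finrank_eq] at hd'
  have hle : LinearMap.range g ≤ LinearMap.ker L := by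
    rintro _ ⟨y, rfl⟩
    rw [LinearMap.mem_ker]
    ext x
    simp [L, polar_comm _ (g y), ho]
  have : LinearMap.range g = LinearMap.ker L := by
    apply Submodule.eq_of_le_of_finrank_eq hle
    rw [LinearMap.finrank_range_of_inj hg]; omega
  rw [this, LinearMap.mem_ker]
  ext x
  simp [L, polar_comm _ v, hv]

lemma Compl.hasRad [FiniteDimensional F U] [FiniteDimensional F V] [FiniteDimensional F X]
    (h : Compl P Q R) (hR : Nd R) {T : QuadraticForm F W} (hT : HasRad Q T) : HasRad P T := by
  obtain ⟨f, g, hf, hg, hf', hg', ho, hd⟩ := h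
  obtain ⟨t, ht, ht', hr⟩ := hT
  obtain ⟨r, hr1⟩ := f.exists_leftInverse_of_injective (LinearMap.ker_eq_bot.2 hf)
  have hr' : ∀ x, r (f x) = x := fun x => LinearMap.congr_fun hr1 x
  have key : ∀ w, f (r (g (t w))) = g (t w) := by
    intro w
    have : g (t w) ∈ LinearMap.range f := by
      refine Compl.mem_range hg hf (fun x y => by rw [polar_comm]; exact ho y x) (by omega) hR _ ?_
      intro x
      rw [polar_isom hg', polar_comm]
      exact (hr _).2 ⟨w, rfl⟩ x
    obtain ⟨u, hu⟩ := this
    rw [← hu, hr']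
  refine ⟨r.comp (g.comp t), ?_, ?_, ?_⟩
  · intro w w' hw
    have h1 : f (r (g (t w))) = f (r (g (t w'))) := congrArg f hw
    rw [key, key] at h1
    exact ht (hg h1)
  · intro w
    rw [← ht', ← hg', ← key, hf']; rfl
  · intro x
    constructor
    · intro hx
      have : f x ∈ LinearMap.range g := by
        refine Compl.mem_range hf hg ho hd hR _ ?_
        intro y
        rw [polar_isom hf', polar_comm]; exact hx y
      obtain ⟨y, hy⟩ := this
      have hy' : y ∈ LinearMap.range t := by
        rw [← hr]
        intro z
        rw [← polar_isom hg', hy, ho]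
      obtain ⟨w, rfl⟩ := hy'
      refine ⟨w, ?_⟩
      simp [hy, hr']
    · rintro ⟨w, rfl⟩ y
      rw [← polar_isom hf']
      change polar R (f (r (g (t w)))) (f y) = 0
      rw [key, polar_comm, ho]

lemma Compl.nd_dummy : True := trivial

end Comp
end QFX

namespace QFX

open QuadraticMap Module

section Pfister

variable {F : Type} [Field F]
variable {U V W X Y : Type} [AddCommGroup U] [Module F U] [AddCommGroup V] [Module F V]
  [AddCommGroup W] [Module F W] [AddCommGroup X] [Module F X] [AddCommGroup Y] [Module F Y]

lemma ev_qPfister {k : ℕ} (a : Fin k → F) (c : F) (x : Fin (2 ^ k * 2) → F) :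
    ev (QF.qPfister a c) x = ∑ f : Fin k → Fin 2, (∏ i, if f i = 1 then a i else 1) *
      (x (finProdFinEquiv (finFunctionFinEquiv f, 0)) ^ 2
        + x (finProdFinEquiv (finFunctionFinEquiv f, 0)) * x (finProdFinEquiv (finFunctionFinEquiv f, 1))
        + c * x (finProdFinEquiv (finFunctionFinEquiv f, 1)) ^ 2) := by
  unfold QF.qPfister
  rw [ev_reindex]
  rw [Fintype.sum_prod_type, ← finFunctionFinEquiv.sum_comp]
  refine Finset.sum_congr rfl fun f _ => ?_
  have key : ∀ b : Fin 2, (∑ j : Fin (2 ^ k) × Fin 2, Matrix.kroneckerMap (fun x1 x2 => x1 * x2) (QF.bPfister a) (QF.binary 1 c)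
      (finFunctionFinEquiv f, b) j * x (finProdFinEquiv (finFunctionFinEquiv f, b)) * x (finProdFinEquiv j))
      = ∑ b' : Fin 2, (∏ i, if f i = 1 then a i else 1) * QF.binary 1 c b b' *
        x (finProdFinEquiv (finFunctionFinEquiv f, b)) * x (finProdFinEquiv (finFunctionFinEquiv f, b')) := by
    intro b
    rw [Fintype.sum_prod_type, ← finFunctionFinEquiv.sum_comp, Finset.sum_eq_single f]
    · simp [QF.bPfister]
    · intro g _ hg
      apply Finset.sum_eq_zero
      intro b' _
      have : QF.bPfister a (finFunctionFinEquiv f) (finFunctionFinEquiv g) = 0 := by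
        unfold QF.bPfister
        rw [Matrix.reindex_apply, Matrix.submatrix_apply, Equiv.symm_apply_apply, Equiv.symm_apply_apply,
          Matrix.diagonal_apply_ne' _ hg]
      simp [this]
    · simp
  rw [Fin.sum_univ_two, key, key]
  simp only [Fin.sum_univ_two, QF.binary]
  simp
  ring

lemma qPfister_succ {k : ℕ} (a0 : F) (a : Fin k → F) (c : F) :
    (tq (QF.qPfister (Fin.cons a0 a : Fin (k + 1) → F) c)).Equivalent
      ((tq (QF.qPfister a c)).prod (a0 • tq (QF.qPfister a c))) := by
  let J : Fin (2 ^ (k + 1) * 2) → Fin (2 ^ k * 2) := fun idx =>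
    finProdFinEquiv (finFunctionFinEquiv (Fin.tail (finFunctionFinEquiv.symm (finProdFinEquiv.symm idx).1)),
      (finProdFinEquiv.symm idx).2)
  let T : ((Fin (2 ^ k * 2) → F) × (Fin (2 ^ k * 2) → F)) →ₗ[F] (Fin (2 ^ (k + 1) * 2) → F) :=
    { toFun := fun z idx => if (finFunctionFinEquiv.symm (finProdFinEquiv.symm idx).1 : Fin (k + 1) → Fin 2) 0 = 1
        then z.2 (J idx) else z.1 (J idx)
      map_add' := fun z z' => by
        ext idx
        simp only [Prod.fst_add, Prod.snd_add, Pi.add_apply]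
        split_ifs <;> rfl
      map_smul' := fun r z => by
        ext idx
        simp only [Prod.smul_fst, Prod.smul_snd, Pi.smul_apply, RingHom.id_apply]
        split_ifs <;> rfl }
  have hT : ∀ z (f0 : Fin 2) (f : Fin k → Fin 2) (b : Fin 2),
      T z (finProdFinEquiv (finFunctionFinEquiv (Fin.cons f0 f : Fin (k + 1) → Fin 2), b)) =
      if f0 = 1 then z.2 (finProdFinEquiv (finFunctionFinEquiv f, b))
        else z.1 (finProdFinEquiv (finFunctionFinEquiv f, b)) := by
    intro z f0 f b
    change (if (finFunctionFinEquiv.symm (finProdFinEquiv.symm _).1 : Fin (k + 1) → Fin 2) 0 = 1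
        then z.2 (J _) else z.1 (J _)) = _
    simp only [J, Equiv.symm_apply_apply, Fin.cons_zero, Fin.tail_cons]
  symm
  refine Dom.eqv ⟨T, ?_, ?_⟩ (by simp [pow_succ]; ring)
  · rw [← LinearMap.ker_eq_bot, LinearMap.ker_eq_bot']
    intro z hz
    ext j
    · have := hT z 0 (finFunctionFinEquiv.symm (finProdFinEquiv.symm j).1) (finProdFinEquiv.symm j).2
      rw [hz] at this
      simp only [Equiv.apply_symm_apply, Prod.mk.eta, zero_ne_one, if_false, if_true, Pi.zero_apply] at this
      exact this.symm
    · have := hT z 1 (finFunctionFinEquiv.symm (finProdFinEquiv.symm j).1) (finProdFinEquiv.symm j).2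
      rw [hz] at this
      simp only [Equiv.apply_symm_apply, Prod.mk.eta, zero_ne_one, if_false, if_true, Pi.zero_apply] at this
      exact this.symm
  · intro z
    rw [QuadraticMap.prod_apply, _root_.smul_apply]
    simp only [tq_apply]
    rw [ev_qPfister, ev_qPfister, ev_qPfister, ← (Fin.consEquiv (fun _ => Fin 2)).sum_comp, Fintype.sum_prod_type,
      Fin.sum_univ_two]
    have hc : ∀ p, (Fin.consEquiv (fun _ : Fin (k + 1) => Fin 2)) p = (Fin.cons p.1 p.2 : Fin (k + 1) → Fin 2) := fun _ => rfl
    simp only [hc, hT, Fin.prod_univ_succ, Fin.cons_zero, Fin.cons_succ]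
    simp only [zero_ne_one, if_false, if_true, one_mul, smul_eq_mul, Finset.mul_sum, mul_assoc]

lemma ev_qPfister_zero (a : Fin 0 → F) (c : F) (x : Fin (2 ^ 0 * 2) → F) :
    ev (QF.qPfister a c) x = x (0 : Fin 2) ^ 2 + x (0 : Fin 2) * x (1 : Fin 2) + c * x (1 : Fin 2) ^ 2 := by
  rw [ev_qPfister]
  have h0 : ∀ f : Fin 0 → Fin 2, (finProdFinEquiv (finFunctionFinEquiv f, (0 : Fin 2)) : Fin (2 ^ 0 * 2)) = (0 : Fin 2) := by
    intro f
    ext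
    simp [finProdFinEquiv]
  have h1 : ∀ f : Fin 0 → Fin 2, (finProdFinEquiv (finFunctionFinEquiv f, (1 : Fin 2)) : Fin (2 ^ 0 * 2)) = (1 : Fin 2) := by
    intro f
    ext
    simp [finProdFinEquiv]
  simp [h0, h1]

end Pfister
end QFX

namespace QFX

open QuadraticMap Module

section Good

variable {F : Type} [Field F]
variable {U V W X Y : Type} [AddCommGroup U] [Module F U] [AddCommGroup V] [Module F V]
  [AddCommGroup W] [Module F W] [AddCommGroup X] [Module F X] [AddCommGroup Y] [Module F Y]

/-- the value of a similarity -/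
def Round (Q : QuadraticForm F V) : Prop :=
  ∀ u, Q u ≠ 0 → ∃ S : V →ₗ[F] V, ∀ w, Q (S w) = Q u * Q w

lemma polar_sim {P : QuadraticForm F V} {Q : QuadraticForm F W} {f : V →ₗ[F] W} {c : F}
    (h : ∀ x, Q (f x) = c * P x) (x y : V) : polar Q (f x) (f y) = c * polar P x y := by
  simp [polar, ← map_add, h]
  ring

lemma sim_equiv [FiniteDimensional F V] {Q : QuadraticForm F V} (hQ : Nd Q) {c : F} (hc : c ≠ 0) (S : V →ₗ[F] V)
    (hS : ∀ w, Q (S w) = c * Q w) : ∃ e : V ≃ₗ[F] V, ∀ w, Q (e w) = c * Q w := by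
  refine ⟨LinearEquiv.ofInjectiveEndo S ?_, hS⟩
  rw [← LinearMap.ker_eq_bot, LinearMap.ker_eq_bot']
  intro x hx
  apply hQ x
  intro y
  have := polar_sim hS x y
  rw [hx] at this
  simpa [hc] using this

/-- the basic properties of Pfister forms -/
structure GoodP (Q : QuadraticForm F V) : Prop where
  nd : Nd Q
  round : Round Q
  one : ∃ e, Q e = 1
  hyp : ¬ Q.Anisotropic → ∃ m, m + m = finrank F V ∧ Q.Equivalent (hy F m)

lemma GoodP.congr {Q : QuadraticForm F V} {Q' : QuadraticForm F W} (h : GoodP Q) (e : Q.Equivalent Q') :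
    GoodP Q' := by
  refine ⟨Equivalent.nd e h.nd, ?_, ?_, ?_⟩
  · obtain ⟨φ, hφ⟩ := Equivalent.out e
    intro u hu
    obtain ⟨S, hS⟩ := h.round (φ.symm u) (by rw [← hφ]; simpa using hu)
    refine ⟨φ.toLinearMap ∘ₗ S ∘ₗ φ.symm.toLinearMap, fun w => ?_⟩
    simp [hφ, hS]
    rw [← hφ, ← hφ]
    simp
  · obtain ⟨φ, hφ⟩ := Equivalent.out e
    obtain ⟨x, hx⟩ := h.one
    exact ⟨φ x, by rw [hφ, hx]⟩
  · intro hn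
    obtain ⟨m, hm, e'⟩ := h.hyp fun ha => hn (Equivalent.aniso e ha)
    exact ⟨m, by rw [← Equivalent.finrank_eq e, hm], e.symm.trans e'⟩

lemma smul_hy (a : F) (ha : a ≠ 0) (m : ℕ) : (a • hy F m).Equivalent (hy F m) := by
  refine eqv_of (LinearEquiv.prodCongr (LinearEquiv.smulOfNeZero F _ a ha) (LinearEquiv.refl F _)) ?_
  rintro ⟨f, x⟩
  simp [hy, QuadraticForm.dualProd]

lemma GoodP.base [CharP F 2] (a : Fin 0 → F) (c : F) : GoodP (tq (QF.qPfister a c)) := by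
  have h2 : (2 : F) = 0 := CharTwo.two_eq_zero
  have hev := ev_qPfister_zero a c
  have hpol : ∀ x y, polar (tq (QF.qPfister a c)) x y = x (0 : Fin 2) * y (1 : Fin 2) + x (1 : Fin 2) * y (0 : Fin 2) := by
    intro x y
    simp only [polar, tq_apply, hev, Pi.add_apply]
    linear_combination (x (0 : Fin 2) * y (0 : Fin 2) + c * x (1 : Fin 2) * y (1 : Fin 2)) * h2
  refine ⟨?_, ?_, ?_, ?_⟩
  · intro x hx
    have h0 := hx (![0, 1] : Fin 2 → F)
    have h1 := hx (![1, 0] : Fin 2 → F)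
    rw [hpol] at h0 h1
    ext i
    change Fin 2 at i
    fin_cases i
    · simpa using h0
    · simpa using h1
  · intro u hu
    let S : (Fin 2 → F) →ₗ[F] (Fin 2 → F) :=
      { toFun := fun z => ![u (0 : Fin 2) * z 0 - c * u (1 : Fin 2) * z 1, u (0 : Fin 2) * z 1 + u (1 : Fin 2) * z 0 + u (1 : Fin 2) * z 1]
        map_add' := fun z z' => by
          ext i
          fin_cases i <;> simp <;> ring
        map_smul' := fun r z => by
          ext i
          fin_cases i <;> simp <;> ring }
    refine ⟨S, fun w => ?_⟩
    simp only [tq_apply]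
    rw [hev, hev, hev]
    simp [S]
    ring
  · refine ⟨(![1, 0] : Fin 2 → F), ?_⟩
    rw [tq_apply, hev]
    simp
  · intro hn
    refine ⟨1, by simp, ?_⟩
    simp only [QuadraticMap.Anisotropic, not_forall] at hn
    obtain ⟨x, hx, hx0⟩ := hn
    rw [tq_apply, hev] at hx
    have hy0 : x (1 : Fin 2) ≠ 0 := by
      intro h
      apply hx0
      rw [h] at hx
      ext i
      change Fin 2 at i
      fin_cases i
      · simpa using hx
      · exact h
    set t := x (0 : Fin 2) / x (1 : Fin 2) with ht
    have hc : c = t ^ 2 + t := by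
      have : x (0 : Fin 2) = t * x (1 : Fin 2) := by rw [ht]; field_simp
      rw [this] at hx
      have : x (1 : Fin 2) ^ 2 * (c - (t ^ 2 + t)) = 0 := by linear_combination hx - (t ^ 2 + t) * x (1 : Fin 2) ^ 2 * h2
      rcases mul_eq_zero.1 this with h | h
      · exact absurd (pow_eq_zero_iff (two_ne_zero)|>.1 h) hy0
      · linear_combination h
    let T : (Fin 2 → F) →ₗ[F] (Dual F (Fin 1 → F) × (Fin 1 → F)) :=
      { toFun := fun z => ((z 0 + t * z 1) • LinearMap.proj 0, fun _ => z 0 + (t + 1) * z 1)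
        map_add' := fun z z' => by
          refine Prod.ext ?_ ?_
          · simp only [Pi.add_apply, Prod.fst_add, ← add_smul]; ring_nf
          · ext i; simp; ring
        map_smul' := fun r z => by
          refine Prod.ext ?_ ?_
          · simp only [Pi.smul_apply, Prod.smul_fst, RingHom.id_apply, smul_smul, smul_eq_mul]; ring_nf
          · ext i; simp; ring }
    refine Dom.eqv ⟨T, ?_, ?_⟩ (by simp)
    · rw [← LinearMap.ker_eq_bot, LinearMap.ker_eq_bot']
      intro z hz
      have e1 : z (0 : Fin 2) + t * z (1 : Fin 2) = 0 := by
        have := LinearMap.congr_fun (congrArg Prod.fst hz) (fun _ => 1)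
        simpa [T] using this
      have e2 : z (0 : Fin 2) + (t + 1) * z (1 : Fin 2) = 0 := by
        have := congrFun (congrArg Prod.snd hz) 0
        simpa [T] using this
      have e3 : z (1 : Fin 2) = 0 := by linear_combination e2 - e1
      rw [e3] at e1
      ext i
      change Fin 2 at i
      fin_cases i
      · simpa using e1
      · exact e3
    · intro z
      rw [tq_apply, hev, hc]
      simp [T, hy, QuadraticForm.dualProd]
      linear_combination (t * z (0 : Fin 2) * z (1 : Fin 2)) * h2

lemma GoodP.step [CharP F 2] [FiniteDimensional F V] {Q : QuadraticForm F V} (h : GoodP Q) {a : F} (ha : a ≠ 0) :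
    GoodP (Q.prod (a • Q)) := by
  have h2 : (2 : F) = 0 := CharTwo.two_eq_zero
  have hround : ∀ u, Q u ≠ 0 → ∃ S : V ≃ₗ[F] V, ∀ w, Q (S w) = Q u * Q w := by
    intro u hu
    obtain ⟨S, hS⟩ := h.round u hu
    exact sim_equiv h.nd hu S hS
  refine ⟨?_, ?_, ?_, ?_⟩
  · rintro ⟨x, y⟩ hxy
    simp only [polar_prod'] at hxy
    ext
    · exact h.nd x fun z => by simpa [polar_smul] using hxy (z, 0)
    · refine h.nd y fun z => ?_
      have := hxy (0, z)
      simpa [polar_smul, ha] using this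
  · rintro ⟨x, y⟩ hxy
    simp only [prod_apply, _root_.smul_apply, smul_eq_mul] at hxy ⊢
    by_cases hX : Q x = 0
    · have hY : Q y ≠ 0 := by rintro h; simp [h, hX] at hxy
      obtain ⟨S, hS⟩ := h.round y hY
      refine ⟨(a • (S ∘ₗ LinearMap.snd F V V)).prod (S ∘ₗ LinearMap.fst F V V), ?_⟩
      rintro ⟨u, w⟩
      simp [QuadraticMap.map_smul, hS, hX]
      ring
    by_cases hY : Q y = 0
    · obtain ⟨S, hS⟩ := h.round x hX
      refine ⟨(S ∘ₗ LinearMap.fst F V V).prod (S ∘ₗ LinearMap.snd F V V), ?_⟩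
      rintro ⟨u, w⟩
      simp [hS, hY]
      ring
    obtain ⟨Sx, hSx⟩ := hround x hX
    obtain ⟨Sy, hSy⟩ := hround y hY
    have hSxi : ∀ w, Q (Sx.symm w) = (Q x)⁻¹ * Q w := by
      intro w
      have := hSx (Sx.symm w)
      rw [LinearEquiv.apply_symm_apply] at this
      rw [this]; field_simp
    let B : V →ₗ[F] V := (-(Q x / Q y)) • (Sy.toLinearMap ∘ₗ Sx.symm.toLinearMap ∘ₗ Sy.toLinearMap)
    have hB : ∀ w, Q (B w) = Q x * Q w := by
      intro w
      simp [B, QuadraticMap.map_smul, hSy, hSxi]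
      field_simp
    have hp : ∀ u w, polar Q (Sx u) (Sy w) + polar Q (Sy u) (B w) = 0 := by
      intro u w
      have e1 : polar Q (Sx u) (Sy w) = Q x * polar Q u (Sx.symm (Sy w)) := by
        have := polar_sim (P := Q) (Q := Q) (f := Sx.toLinearMap) hSx u (Sx.symm (Sy w))
        simpa using this
      have e2 : polar Q (Sy u) (Sy (Sx.symm (Sy w))) = Q y * polar Q u (Sx.symm (Sy w)) :=
        polar_sim (P := Q) (Q := Q) (f := Sy.toLinearMap) hSy u (Sx.symm (Sy w))
      have e3 : polar Q (Sy u) (B w) = -(Q x / Q y) * polar Q (Sy u) (Sy (Sx.symm (Sy w))) := by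
        simp only [B, LinearMap.smul_apply, polar_smul_right, smul_eq_mul]
        rfl
      rw [e1, e3, e2]
      field_simp
      ring
    refine ⟨(Sx.toLinearMap ∘ₗ LinearMap.fst F V V + a • (Sy.toLinearMap ∘ₗ LinearMap.snd F V V)).prod
      (Sy.toLinearMap ∘ₗ LinearMap.fst F V V + B ∘ₗ LinearMap.snd F V V), ?_⟩
    rintro ⟨u, w⟩
    have hpu := hp u w
    change Q (Sx u + a • Sy w) + a * Q (Sy u + B w) = (Q x + a * Q y) * (Q u + a * Q w)
    rw [QuadraticMap.map_add Q, QuadraticMap.map_add Q, hSx, hSy, hB, QuadraticMap.map_smul, hSy, polar_smul_right]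
    simp only [smul_eq_mul]
    linear_combination a * hpu
  · obtain ⟨e, he⟩ := h.one
    exact ⟨(e, 0), by simp [he]⟩
  · intro hn
    by_cases hQ : Q.Anisotropic
    · simp only [QuadraticMap.Anisotropic, not_forall] at hn
      obtain ⟨⟨x, y⟩, hxy, h0⟩ := hn
      simp only [prod_apply, _root_.smul_apply, smul_eq_mul] at hxy
      have hY : Q y ≠ 0 := by
        intro hY
        have hy0 := hQ y hY
        rw [hY] at hxy
        have hx0 := hQ x (by simpa using hxy)
        exact h0 (by simp [hx0, hy0])
      have hX : Q x ≠ 0 := by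
        intro hX
        rw [hX] at hxy
        simp [ha, hY] at hxy
      obtain ⟨Sx, hSx⟩ := hround x hX
      obtain ⟨Sy, hSy⟩ := hround y hY
      have e1 : (a • Q).Equivalent Q := by
        refine eqv_of (Sy.symm.trans Sx) fun w => ?_
        have := hSy (Sy.symm w)
        rw [LinearEquiv.apply_symm_apply] at this
        simp only [LinearEquiv.trans_apply, hSx, _root_.smul_apply, smul_eq_mul]
        rw [this]
        linear_combination Q (Sy.symm w) * hxy - a * Q y * Q (Sy.symm w) * h2
      refine ⟨finrank F V, by simp, ?_⟩
      refine (Equivalent.prod (.refl _) e1).trans ?_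
      have hc : Compl Q (0 : QuadraticForm F (Fin 0 → F)) Q :=
        ⟨LinearMap.id, 0, Function.injective_id, Function.injective_of_subsingleton _, by simp, by simp,
          by simp, by simp⟩
      refine (hc.eqv h.nd).trans ?_
      exact (eqv_prod_comm _ _).trans (prod_zero_dim _ _ (by simp))
    · obtain ⟨m, hm, e⟩ := h.hyp hQ
      refine ⟨m + m, by simp [hm], ?_⟩
      have e1 : (a • Q).Equivalent (hy F m) := by
        obtain ⟨φ, hφ⟩ := Equivalent.out e
        exact (eqv_of (Q' := a • hy F m) φ fun x => by simp [hφ]).trans (smul_hy a ha m)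
      exact (Equivalent.prod e e1).trans (hy_add m m).symm

lemma GoodP.qPfister [CharP F 2] : ∀ {k : ℕ} (a : Fin k → F) (_ : ∀ i, a i ≠ 0) (c : F), GoodP (tq (QF.qPfister a c)) := by
  intro k
  induction k with
  | zero => intro a _ c; exact GoodP.base a c
  | succ k ih =>
    intro a ha c
    have := ((ih (Fin.tail a) (fun i => ha _) c).step (ha 0)).congr (qPfister_succ (a 0) (Fin.tail a) c).symm
    rwa [Fin.cons_self_tail] at this

end Good
end QFX

namespace QFX

open QuadraticMap Module

section BC

variable {F K : Type} [Field F] [Field K] (σ : F →+* K) {n m : ℕ}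

lemma ev_alt {R : Type*} [CommRing R] (D : Matrix (Fin n) (Fin n) R) (h1 : ∀ i, D i i = 0) (h2 : ∀ i j, D i j + D j i = 0)
    (x : Fin n → R) : ev D x = 0 := by
  unfold ev
  rw [← Finset.sum_product']
  refine Finset.sum_involution (fun p _ => (p.2, p.1)) ?_ ?_ ?_ ?_
  · rintro ⟨i, j⟩ _
    linear_combination x i * x j * h2 i j
  · rintro ⟨i, j⟩ _ h heq
    simp only [Prod.mk.injEq] at heq
    apply h
    simp only [heq.1, h1, zero_mul]
  · simp
  · simp

lemma ev_single (p : QF F n) (i : Fin n) : ev p (Pi.single i 1) = p i i := by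
  unfold ev
  rw [Finset.sum_eq_single i, Finset.sum_eq_single i]
  · simp
  · intro j _ hj; simp [hj]
  · simp
  · intro j _ hj; simp [hj]
  · simp

lemma bl_single (p : QF F n) (i j : Fin n) : bl p (Pi.single i 1) (Pi.single j 1) = p i j + p j i := by
  unfold bl
  simp only [Pi.single_apply]
  simp [mul_add, Finset.sum_add_distrib, ite_and]

lemma map_ev_congr {p p' : QF F n} (h : ∀ x, ev p x = ev p' x) (x : Fin n → K) :
    ev (p.map σ) x = ev (p'.map σ) x := by
  have hb : ∀ x y, bl p x y = bl p' x y := by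
    intro x y
    have e1 := ev_add p x y
    have e2 := ev_add p' x y
    rw [h, h, h] at e1
    linear_combination e2 - e1
  have h1 : ∀ i, p i i = p' i i := fun i => by rw [← ev_single p, ← ev_single p', h]
  have h2 : ∀ i j, p i j + p j i = p' i j + p' j i := fun i j => by rw [← bl_single p, ← bl_single p', hb]
  have := ev_alt (p.map σ - p'.map σ) (fun i => by simp [h1]) (fun i j => by
    have := congrArg σ (h2 i j)
    simp only [map_add] at this
    simp only [Matrix.sub_apply, Matrix.map_apply]
    linear_combination this) x
  have e : ev (p.map σ - p'.map σ) x = ev (p.map σ) x - ev (p'.map σ) x := by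
    simp [ev, sub_mul, Finset.sum_sub_distrib]
  rw [e] at this
  linear_combination this

lemma ev_mulVec {R : Type*} [CommRing R] (q : Matrix (Fin n) (Fin n) R) (M : Matrix (Fin n) (Fin m) R) (x : Fin m → R) :
    ev q (M.mulVec x) = ev (M.transpose * q * M) x := by
  have key : ∀ {l : ℕ} (q : Matrix (Fin l) (Fin l) R) (x : Fin l → R), ev q x = x ⬝ᵥ (q.mulVec x) := by
    intro l q x
    simp only [ev, dotProduct, Matrix.mulVec, Finset.mul_sum]
    refine Finset.sum_congr rfl fun i _ => Finset.sum_congr rfl fun j _ => by ring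
  rw [key, key, ← Matrix.mulVec_mulVec, ← Matrix.mulVec_mulVec, Matrix.dotProduct_mulVec x, Matrix.vecMul_transpose]

lemma Dom.map {p : QF F m} {q : QF F n} (h : Dom (tq p) (tq q)) : Dom (tq (p.map σ)) (tq (q.map σ)) := by
  obtain ⟨f, hf, hf'⟩ := h
  obtain ⟨g, hg⟩ := LinearMap.exists_leftInverse_of_injective f (LinearMap.ker_eq_bot.2 hf)
  set M := LinearMap.toMatrix' f with hM
  set G := LinearMap.toMatrix' g with hG
  have hGM : G * M = 1 := by rw [hG, hM, ← LinearMap.toMatrix'_comp, hg, LinearMap.toMatrix'_id]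
  have hfM : ∀ x, f x = M.mulVec x := fun x => by rw [hM, LinearMap.toMatrix'_mulVec]
  refine ⟨Matrix.toLin' (M.map σ), ?_, ?_⟩
  · apply Function.LeftInverse.injective (g := Matrix.toLin' (G.map σ))
    intro x
    rw [← LinearMap.comp_apply, ← Matrix.toLin'_mul, ← Matrix.map_mul, hGM, Matrix.map_one σ (map_zero _) (map_one _), Matrix.toLin'_one]
    rfl
  · intro x
    rw [Matrix.toLin'_apply, tq_apply, ev_mulVec, tq_apply]
    have := map_ev_congr σ (p := M.transpose * q * M) (p' := p) (fun x => by
      rw [← ev_mulVec, ← hfM]; exact hf' x) x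
    rw [← this, Matrix.map_mul, Matrix.map_mul, Matrix.transpose_map]

lemma eqv_map {p : QF F n} {q : QF F m} (h : (tq p).Equivalent (tq q)) : (tq (p.map σ)).Equivalent (tq (q.map σ)) := by
  have h1 := Equivalent.finrank_eq h
  simp only [finrank_fin_fun] at h1
  exact Dom.eqv (Dom.map σ (Equivalent.dom h)) (by simpa using h1)

lemma orthSum_map (p : QF F n) (q : QF F m) : (QF.orthSum p q).map σ = QF.orthSum (p.map σ) (q.map σ) := by
  unfold QF.orthSum
  rw [Matrix.reindex_apply, Matrix.reindex_apply, ← Matrix.submatrix_map, Matrix.fromBlocks_map]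
  simp

lemma hyper_map (n : ℕ) : (QF.hyper n : QF F (n + n)).map σ = QF.hyper n := by
  unfold QF.hyper QF.binSum
  rw [Matrix.reindex_apply, Matrix.reindex_apply, ← Matrix.submatrix_map, Matrix.fromBlocks_map]
  simp

lemma smul_map (a : F) (q : QF F n) : (a • q).map σ = σ a • q.map σ := by
  ext i j
  simp

lemma diag_map (c : Fin n → F) : (QF.diag c).map σ = QF.diag (fun i => σ (c i)) := by
  unfold QF.diag
  rw [Matrix.diagonal_map (map_zero _)]

lemma qPfister_map {k : ℕ} (a : Fin k → F) (c : F) : (QF.qPfister a c).map σ = QF.qPfister (fun i => σ (a i)) (σ c) := by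
  have hb : (QF.bPfister a).map σ = QF.bPfister (fun i => σ (a i)) := by
    unfold QF.bPfister
    rw [Matrix.reindex_apply, Matrix.reindex_apply, ← Matrix.submatrix_map, Matrix.diagonal_map (map_zero _)]
    congr 2
    ext f
    simp only [Function.comp, map_prod]
    refine Finset.prod_congr rfl fun i _ => ?_
    split_ifs <;> simp
  have hc : (QF.binary 1 c).map σ = QF.binary 1 (σ c) := by
    ext i j
    fin_cases i <;> fin_cases j <;> simp [QF.binary]
  unfold QF.qPfister
  rw [← hb, ← hc]
  ext i j
  simp

end BC
end QFX

namespace QFX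

open QuadraticMap Module

section Link

variable {F : Type} [Field F]
variable {U V W X Y : Type} [AddCommGroup U] [Module F U] [AddCommGroup V] [Module F V]
  [AddCommGroup W] [Module F W] [AddCommGroup X] [Module F X] [AddCommGroup Y] [Module F Y]

lemma meet [FiniteDimensional F U] [FiniteDimensional F V] [FiniteDimensional F W] (f : U →ₗ[F] V) (g : W →ₗ[F] V)
    (hf : Function.Injective f) (hg : Function.Injective g) (hd : finrank F V < finrank F U + finrank F W) :
    ∃ u w, u ≠ 0 ∧ w ≠ 0 ∧ f u = g w := by
  have := LinearMap.ker_ne_bot_of_finrank_lt (f := f.coprod (-g)) (by simpa using hd)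
  obtain ⟨⟨u, w⟩, hm, h0⟩ := Submodule.exists_mem_ne_zero_of_ne_bot this
  have he : f u = g w := by
    simpa [← sub_eq_add_neg, sub_eq_zero] using hm
  refine ⟨u, w, ?_, ?_, he⟩
  · rintro rfl
    have : w = 0 := hg (by rw [← he]; simp)
    exact h0 (by simp [this])
  · rintro rfl
    have : u = 0 := hf (by rw [he]; simp)
    exact h0 (by simp [this])

lemma hy_dom_zero (m : ℕ) : Dom (0 : QuadraticForm F (Fin m → F)) (hy F m) :=
  ⟨LinearMap.inr F _ _, LinearMap.inr_injective, fun x => by simp [hy, QuadraticForm.dualProd]⟩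

lemma eqv_zero {m : ℕ} [FiniteDimensional F U] (h : finrank F U = m) :
    (0 : QuadraticForm F U).Equivalent (0 : QuadraticForm F (Fin m → F)) :=
  eqv_of (LinearEquiv.ofFinrankEq U (Fin m → F) (by simpa using h)) (by simp)

/-- Either anisotropic with non-zero slots, or with a big totally isotropic subspace -/
lemma qPfister_dichotomy [CharP F 2] : ∀ {k : ℕ} (a : Fin k → F) (c : F),
    (∀ i, a i ≠ 0) ∨ Dom (0 : QuadraticForm F (Fin (2 ^ k) → F)) (tq (QF.qPfister a c)) := by
  intro k
  induction k with
  | zero => intro a c; left; exact fun i => i.elim0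
  | succ k ih =>
    intro a c
    have e := qPfister_succ (a 0) (Fin.tail a) c
    rw [Fin.cons_self_tail] at e
    by_cases h0 : a 0 = 0
    · right
      refine Dom.trans ?_ (Equivalent.dom e.symm)
      refine Dom.trans (Equivalent.dom (eqv_zero (U := Fin (2 ^ k * 2) → F) (m := 2 ^ (k + 1)) (by simp [pow_succ])).symm) ?_
      exact ⟨LinearMap.inr F _ _, LinearMap.inr_injective, fun x => by simp [h0]⟩
    rcases ih (Fin.tail a) c with h | h
    · left
      intro i
      refine Fin.cases h0 (fun j => h j) i
    · right
      refine Dom.trans ?_ (Equivalent.dom e.symm)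
      refine Dom.trans (Equivalent.dom (eqv_zero (U := (Fin (2 ^ k) → F) × (Fin (2 ^ k) → F)) (m := 2 ^ (k + 1)) (by simp [pow_succ]; ring)).symm) ?_
      obtain ⟨f, hf, hf'⟩ := h
      refine ⟨f.prodMap f, hf.prodMap hf, fun x => ?_⟩
      simp only [LinearMap.prodMap_apply, prod_apply, _root_.smul_apply, hf']
      simp

lemma qPfister_dichotomy' [CharP F 2] {k : ℕ} (a : Fin k → F) (c : F) :
    ((∀ i, a i ≠ 0) ∧ An (QF.qPfister a c)) ∨ Dom (0 : QuadraticForm F (Fin (2 ^ k) → F)) (tq (QF.qPfister a c)) := by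
  rcases qPfister_dichotomy a c with h | h
  · by_cases hA : An (QF.qPfister a c)
    · exact Or.inl ⟨h, hA⟩
    · right
      obtain ⟨m, hm, e⟩ := (GoodP.qPfister a h c).hyp hA
      have : m = 2 ^ k := by simp at hm; omega
      subst this
      exact (hy_dom_zero _).trans (Equivalent.dom e.symm)
  · exact Or.inr h

lemma An.slots [CharP F 2] {k : ℕ} {a : Fin k → F} {c : F} (h : An (QF.qPfister a c)) : ∀ i, a i ≠ 0 := by
  rcases qPfister_dichotomy' a c with h' | ⟨f, hf, hf'⟩
  · exact h'.1
  · exfalso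
    have h1 := h (f (fun _ => 1)) (hf' _)
    have h2 : (fun _ => 1 : Fin (2 ^ k) → F) = 0 := hf (by rw [h1, map_zero])
    have := congrFun h2 ⟨0, by positivity⟩
    simp at this

/-- a Pfister form with an anisotropic neighbour is anisotropic -/
lemma neighbour_aniso [CharP F 2] {k : ℕ} {a : Fin k → F} {c d : F} (hd : d ≠ 0) {n : ℕ} {ψ : QF F n} (hψ : An ψ)
    (hn : 2 ^ k < n) (h : Dom (tq ψ) (d • tq (QF.qPfister a c))) : An (QF.qPfister a c) := by
  rcases qPfister_dichotomy' a c with h' | ⟨f, hf, hf'⟩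
  · exact h'.2
  · exfalso
    obtain ⟨g, hg, hg'⟩ := h
    obtain ⟨u, w, hu, hw, he⟩ := meet g f hg hf (by simp; omega)
    apply hu
    apply hψ
    rw [← tq_apply, ← hg', _root_.smul_apply, he, hf']
    simp

lemma GoodP.ratio {Q : QuadraticForm F V} (h : GoodP Q) {u v : V} (hu : Q u ≠ 0) (hv : Q v ≠ 0) :
    ∃ S : V →ₗ[F] V, ∀ w, Q (S w) = Q u / Q v * Q w := by
  obtain ⟨S, hS⟩ := h.round u hu
  obtain ⟨T, hT⟩ := h.round v hv
  refine ⟨(Q v)⁻¹ • (S ∘ₗ T), fun w => ?_⟩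
  simp [QuadraticMap.map_smul, hS, hT]
  field_simp

lemma smul_aniso {Q : QuadraticForm F V} (h : Q.Anisotropic) {d : F} (hd : d ≠ 0) : (d • Q).Anisotropic := by
  intro x hx
  exact h x (by simpa [hd] using hx)

/-- linkage -/
theorem link [CharP F 2] {k k' n : ℕ} {ψ : QF F n} {a : Fin k → F} {c d : F} {a' : Fin k' → F} {c' d' : F}
    (hd : d ≠ 0) (hd' : d' ≠ 0) (hP : An (QF.qPfister a c)) (hP' : An (QF.qPfister a' c'))
    (h : Dom (tq ψ) (d • tq (QF.qPfister a c))) (h' : Dom (tq ψ) (d' • tq (QF.qPfister a' c'))) (hn : 2 ^ k' < n) :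
    Dom (d' • tq (QF.qPfister a' c')) (d • tq (QF.qPfister a c)) := by
  set N := 2 ^ k' * 2 with hN
  set L := (Gen F N).carrier
  set σ := aG F N
  haveI : CharP L 2 := charP_of_injective_ringHom σ.injective 2
  set x := genx F N
  have hρ : An (d • QF.qPfister a c) := by rw [an_iff, tq_smul]; exact smul_aniso (an_iff.1 hP) hd
  have hρ' : An (d' • QF.qPfister a' c') := by rw [an_iff, tq_smul]; exact smul_aniso (an_iff.1 hP') hd'
  rw [← tq_smul] at h h'
  obtain ⟨g, hg, hg'⟩ := Dom.map σ h
  obtain ⟨f, hf, hf'⟩ := Dom.map σ h'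
  have good : GoodP (tq ((QF.qPfister a c).map σ)) := by
    rw [qPfister_map]
    exact GoodP.qPfister _ (fun i => by simpa using hP.slots i) _
  have good' : GoodP (tq ((QF.qPfister a' c').map σ)) := by
    rw [qPfister_map]
    exact GoodP.qPfister _ (fun i => by simpa using hP'.slots i) _
  have hPL : An ((QF.qPfister a c).map σ) := hP.gen N
  have hPL' : An ((QF.qPfister a' c').map σ) := hP'.gen N
  set P := tq ((QF.qPfister a c).map σ)
  set P' := tq ((QF.qPfister a' c').map σ)
  have hσd : σ d ≠ 0 := by simpa using hd
  have hσd' : σ d' ≠ 0 := by simpa using hd'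
  have eg : ∀ z, σ d * P (g z) = ev (ψ.map σ) z := fun z => by
    rw [← tq_apply, ← hg', smul_map, tq_smul]; rfl
  have ef : ∀ z, σ d' * P' (f z) = ev (ψ.map σ) z := fun z => by
    rw [← tq_apply, ← hf', smul_map, tq_smul]; rfl
  have nz : ∀ z, z ≠ 0 → P (g z) ≠ 0 ∧ P' (f z) ≠ 0 := by
    intro z hz
    constructor
    · intro h0
      exact hz (hg (by rw [hPL _ h0, map_zero]))
    · intro h0
      exact hz (hf (by rw [hPL' _ h0, map_zero]))
  have key : ∃ v, ev ((d • QF.qPfister a c).map σ) v = ev ((d' • QF.qPfister a' c').map σ) x := by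
    by_cases hx : P' x = 0
    · refine ⟨0, ?_⟩
      rw [ev_zero, smul_map, smul_ev]
      change 0 = σ d' * P' x
      rw [hx, mul_zero]
    have hn0 : 0 < n := by omega
    set e : Fin n → L := fun _ => 1
    have he : e ≠ 0 := fun h => one_ne_zero (congrFun h ⟨0, hn0⟩)
    obtain ⟨S, hS⟩ := good'.ratio hx (nz e he).2
    obtain ⟨S, hS⟩ := sim_equiv good'.nd (div_ne_zero hx (nz e he).2) S hS
    obtain ⟨z1, z2, h1, h2, h12⟩ := meet (S.toLinearMap ∘ₗ f) f (S.injective.comp hf) hf (by simp; omega)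
    have h12' : P' (f z2) = P' x / P' (f e) * P' (f z1) := by
      rw [← h12]; exact hS _
    obtain ⟨T, hT⟩ := good.ratio (nz z2 h2).1 (nz z1 h1).1
    refine ⟨T (g e), ?_⟩
    rw [smul_map, smul_ev, smul_map, smul_ev]
    change σ d * P (T (g e)) = σ d' * P' x
    rw [hT]
    have q1 := (eg z1).trans (ef z1).symm
    have q2 := (eg z2).trans (ef z2).symm
    have q3 := (eg e).trans (ef e).symm
    have r1 := (nz z1 h1)
    have r3 := (nz e he)
    rw [h12'] at q2
    have q2' : P (g z2) * P' (f e) = P' x * P (g z1) := by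
      have r : σ d * (P (g z2) * P' (f e)) = σ d * (P' x * P (g z1)) := by
        have : σ d * P (g z2) * P' (f e) = σ d' * P' x * P' (f z1) := by rw [q2]; field_simp [r3.2]
        linear_combination this - P' x * q1
      exact mul_left_cancel₀ hσd r
    have : σ d * (P (g z2) / P (g z1) * P (g e)) = P (g z2) / P (g z1) * (σ d * P (g e)) := by ring
    rw [this, q3]
    have : P (g z2) = P' x * P (g z1) / P' (f e) := by rw [← q2']; field_simp [r3.2]
    rw [this]
    field_simp [r1.1, r3.2]
  obtain ⟨v, hv⟩ := key
  obtain ⟨T, hT⟩ := gvt hρ N Empty (fun i => i.elim) (d' • QF.qPfister a' c') (fun i => i.elim) v hv (fun i => i.elim)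
  rw [← tq_smul, ← tq_smul]
  refine ⟨T, ?_, fun y => (hT y).1⟩
  rw [← LinearMap.ker_eq_bot, LinearMap.ker_eq_bot']
  intro y hy
  apply hρ'
  rw [← (hT y).1, hy, ev_zero]

end Link
end QFX

namespace QFX

open Module Polynomial
open scoped TensorProduct

/-- base change preserves reducedness -/
def GR (F K : Type) [Field F] [Field K] [Algebra F K] : Prop :=
  ∀ (R : Type) [CommRing R] [Algebra F R], IsReduced R → IsReduced (K ⊗[F] R)

lemma GR.sep {F K : Type} [Field F] [Field K] [Algebra F K] (h : GR F K) : QF.IsSepExt F K := by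
  intro L _ _ _
  exact h L inferInstance

lemma GR.self (F : Type) [Field F] : GR F F := by
  intro R _ _ hR
  exact isReduced_of_injective (Algebra.TensorProduct.lid F R) (Algebra.TensorProduct.lid F R).injective

lemma GR.trans {F L K : Type} [Field F] [Field L] [Field K] [Algebra F L] [Algebra L K] [Algebra F K] [IsScalarTower F L K]
    (h : GR F L) (h' : GR L K) : GR F K := by
  intro R _ _ hR
  have := h' (L ⊗[F] R) (h R hR)
  exact isReduced_of_injective (Algebra.TensorProduct.cancelBaseChange F L L K R).symm
    (Algebra.TensorProduct.cancelBaseChange F L L K R).symm.injective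

lemma poly_reduced {R : Type} [CommRing R] (hR : IsReduced R) : IsReduced R[X] := by
  constructor
  intro p hp
  rw [Polynomial.isNilpotent_iff] at hp
  ext i
  exact hR.eq_zero _ (hp i)

lemma GR.ratFunc (L : Type) [Field L] : GR L (RatFunc L) := by
  intro R _ _ hR
  have hpoly : IsReduced (L[X] ⊗[L] R) := by
    have := poly_reduced hR
    let e : L[X] ⊗[L] R ≃ₐ[L] R[X] := (Algebra.TensorProduct.comm L _ _).trans (polyEquivTensor L R).symm
    exact isReduced_of_injective e e.injective
  let ι : L[X] ⊗[L] R →ₐ[L] RatFunc L ⊗[L] R :=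
    Algebra.TensorProduct.map (IsScalarTower.toAlgHom L L[X] (RatFunc L)) (AlgHom.id L R)
  have hι : Function.Injective ι := by
    have := Module.Flat.rTensor_preserves_injective_linearMap (M := R)
      (IsScalarTower.toAlgHom L L[X] (RatFunc L)).toLinearMap (IsFractionRing.injective L[X] (RatFunc L))
    exact this
  have clear : ∀ z : RatFunc L ⊗[L] R, ∃ s : L[X], s ≠ 0 ∧ ∃ w, ι w = (algebraMap L[X] (RatFunc L) s ⊗ₜ 1) * z := by
    intro z
    induction z using TensorProduct.induction_on with
    | zero => exact ⟨1, one_ne_zero, 0, by simp⟩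
    | tmul x y =>
      obtain ⟨⟨a, s⟩, h⟩ := IsLocalization.surj (nonZeroDivisors L[X]) x
      refine ⟨s, nonZeroDivisors.ne_zero s.2, a ⊗ₜ y, ?_⟩
      simp only [ι, Algebra.TensorProduct.map_tmul, Algebra.TensorProduct.tmul_mul_tmul, one_mul]
      rw [mul_comm, h]
      rfl
    | add x y hx hy =>
      obtain ⟨s, hs, w, hw⟩ := hx
      obtain ⟨s', hs', w', hw'⟩ := hy
      refine ⟨s * s', mul_ne_zero hs hs', (s' ⊗ₜ 1) * w + (s ⊗ₜ 1) * w', ?_⟩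
      have e1 : ∀ s : L[X], ι (s ⊗ₜ 1) = algebraMap L[X] (RatFunc L) s ⊗ₜ 1 := fun s => by simp [ι]
      have e2 : (algebraMap L[X] (RatFunc L) (s * s') ⊗ₜ (1 : R) : RatFunc L ⊗[L] R) =
          (algebraMap L[X] (RatFunc L) s ⊗ₜ 1) * (algebraMap L[X] (RatFunc L) s' ⊗ₜ 1) := by
        simp
      rw [map_add, map_mul, map_mul, hw, hw', e1, e1, e2]
      ring
  constructor
  intro z hz
  obtain ⟨s, hs, w, hw⟩ := clear z
  have hn : IsNilpotent (ι w) := by rw [hw]; exact (Commute.all _ _).isNilpotent_mul_left hz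
  have hw0 : w = 0 := hpoly.eq_zero _ ((IsNilpotent.map_iff hι).1 hn)
  rw [hw0, map_zero] at hw
  have hs' : algebraMap L[X] (RatFunc L) s ≠ 0 := by simpa using hs
  have : z = ((algebraMap L[X] (RatFunc L) s)⁻¹ ⊗ₜ 1) * ((algebraMap L[X] (RatFunc L) s ⊗ₜ 1) * z) := by
    rw [← mul_assoc, Algebra.TensorProduct.tmul_mul_tmul, inv_mul_cancel₀ hs', mul_one, ← Algebra.TensorProduct.one_def, one_mul]
  rw [this, ← hw, mul_zero]

lemma GR.gen (F : Type) [Field F] (n : ℕ) : GR F (Gen F n).carrier := by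
  induction n with
  | zero => exact GR.self F
  | succ n ih =>
    have := IsScalarTower.of_algebraMap_eq (R := F) (S := (Gen F n).carrier) (A := RatFunc (Gen F n).carrier)
      fun x => RingHom.congr_fun (aG_succ n) x
    exact @GR.trans F (Gen F n).carrier (RatFunc (Gen F n).carrier) _ _ _ _ _ _ this ih (GR.ratFunc (Gen F n).carrier)

lemma GR.quad {L K : Type} [Field L] [CharP L 2] [Field K] [Algebra L K] (α : K) (b0 c0 : L) (hb0 : b0 ≠ 0)
    (hα : α ^ 2 = algebraMap L K b0 * α + algebraMap L K c0)
    (b : Basis (Fin 2) L K) (h0 : b 0 = 1) (h1 : b 1 = α) : GR L K := by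
  intro R _ _ hR
  suffices h : IsReduced (R ⊗[L] K) from
    isReduced_of_injective (Algebra.TensorProduct.comm L K R) (Algebra.TensorProduct.comm L K R).injective
  rw [isReduced_iff_pow_one_lt 2 (by norm_num)]
  intro z hz
  let B := Algebra.TensorProduct.basis R b
  have hzz := B.sum_repr z
  rw [Fin.sum_univ_two] at hzz
  have e0 : B 0 = 1 := by simp [B, h0, Algebra.TensorProduct.one_def]
  have e1 : B 1 = 1 ⊗ₜ α := by simp [B, h1]
  generalize B.repr z 0 = r at *
  generalize B.repr z 1 = s at *
  have h2 : (2 : R ⊗[L] K) = 0 := by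
    have : (2 : L) = 0 := CharTwo.two_eq_zero
    have := congrArg (algebraMap L (R ⊗[L] K)) this
    rw [map_ofNat, map_zero] at this
    exact this
  have e2 : B 1 ^ 2 = (algebraMap L R b0) • B 1 + (algebraMap L R c0) • B 0 := by
    rw [e0, e1, Algebra.TensorProduct.tmul_pow, one_pow, hα, TensorProduct.tmul_add, ← Algebra.smul_def,
      Algebra.algebraMap_eq_smul_one, TensorProduct.tmul_smul, TensorProduct.tmul_smul, algebraMap_smul, algebraMap_smul,
      Algebra.TensorProduct.one_def]
  have e3 : z ^ 2 = (r ^ 2 + s ^ 2 * algebraMap L R c0) • B 0 + (s ^ 2 * algebraMap L R b0) • B 1 := by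
    have : z ^ 2 = r ^ 2 • (B 0) ^ 2 + s ^ 2 • (B 1 ^ 2) := by
      rw [← hzz, add_sq, _root_.smul_pow, _root_.smul_pow, h2]
      ring
    rw [this, e2, smul_add, smul_smul, smul_smul, add_smul, e0, one_pow]
    abel
  rw [e3] at hz
  have li := B.linearIndependent
  rw [Fintype.linearIndependent_iff] at li
  have := li ![r ^ 2 + s ^ 2 * algebraMap L R c0, s ^ 2 * algebraMap L R b0] (by simpa [Fin.sum_univ_two] using hz)
  have l0 := this 0
  have l1 := this 1
  simp at l0 l1
  have s2 : s ^ 2 = 0 := by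
    have : s ^ 2 * algebraMap L R b0 * algebraMap L R b0⁻¹ = 0 := by rw [l1, zero_mul]
    rwa [mul_assoc, ← map_mul, mul_inv_cancel₀ hb0, map_one, mul_one] at this
  rw [s2, zero_mul, add_zero] at l0
  have hs : s = 0 := hR.eq_zero _ ⟨2, s2⟩
  have hr : r = 0 := hR.eq_zero _ ⟨2, l0⟩
  rw [← hzz, hs, hr]
  simp

end QFX

namespace QFX
open QuadraticMap Module Polynomial

lemma quadExt (L : Type) [Field L] (b0 c0 : L) (hno : ∀ t : L, t ^ 2 - b0 * t - c0 ≠ 0) :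
    ∃ (K : Type) (_ : Field K) (_ : Algebra L K) (α : K) (B : Basis (Fin 2) L K), B 0 = 1 ∧ B 1 = α ∧
      α ^ 2 = algebraMap L K b0 * α + algebraMap L K c0 := by
  set p : L[X] := X ^ 2 - C b0 * X - C c0 with hp
  have hdeg : p.natDegree = 2 := by rw [hp]; compute_degree!
  have hmon : p.Monic := by rw [hp]; monicity!
  have hirr : Irreducible p := by
    rw [Polynomial.irreducible_iff_roots_eq_zero_of_degree_le_three (by omega) (by omega)]
    rw [Multiset.eq_zero_iff_forall_notMem]
    intro t ht
    have := (Polynomial.mem_roots'.1 ht).2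
    apply hno t
    simpa [hp, Polynomial.IsRoot] using this
  haveI : Fact (Irreducible p) := ⟨hirr⟩
  let pb := AdjoinRoot.powerBasis' hmon
  have hd : pb.dim = 2 := hdeg
  refine ⟨AdjoinRoot p, inferInstance, inferInstance, AdjoinRoot.root p, pb.basis.reindex (finCongr hd), ?_, ?_, ?_⟩
  · simp [PowerBasis.basis_eq_pow]
  · simp [PowerBasis.basis_eq_pow]
    exact AdjoinRoot.powerBasis'_gen hmon
  · have := AdjoinRoot.eval₂_root p
    simp [hp, eval₂_sub] at this
    rw [sub_sub, sub_eq_zero] at this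
    exact this

lemma bl_expand {R : Type*} [CommRing R] {n : ℕ} (q : Matrix (Fin n) (Fin n) R) (x y : Fin n → R) :
    bl q x y = ∑ i, (∑ j, (q i j + q j i) * y j) * x i := by
  unfold bl
  simp only [mul_add, add_mul, Finset.sum_add_distrib, Finset.sum_mul]
  congr 1
  · refine Finset.sum_congr rfl fun i _ => Finset.sum_congr rfl fun j _ => by ring
  · rw [Finset.sum_comm]
    refine Finset.sum_congr rfl fun i _ => Finset.sum_congr rfl fun j _ => by ring

lemma ev_two {L K : Type} [Field L] [Field K] (t : L →+* K) {n : ℕ} (q : Matrix (Fin n) (Fin n) L) (u v : Fin n → L) (α : K) :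
    ev (q.map t) (fun i => t (u i) + α * t (v i)) = t (ev q u) + α ^ 2 * t (ev q v) + α * t (bl q u v) := by
  have : (fun i => t (u i) + α * t (v i)) = (fun i => t (u i)) + α • (fun i => t (v i)) := rfl
  rw [this, ev_add, ev_smul, bl_smul_right, ev_map, ev_map, bl_map]

lemma ff_core {F L : Type} [Field F] [Field L] [Algebra F L] [CharP L 2] {M : ℕ} (P : QF F M)
    (σ : F →+* L) (hσ : σ = algebraMap F L)
    (x σe : Fin M → L) (hPL : An (P.map σ)) (heL : ev (P.map σ) σe = 1)
    (hb : bl (P.map σ) x σe ≠ 0) (hGR : GR F L) :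
    ∃ K : QF.FieldExt F, QF.IsSepExt F K.carrier ∧ ¬ An (P.map (algebraMap F K.carrier)) ∧
      ∀ (N : ℕ) (P' : QF F N), GoodP (tq (P'.map σ)) → An (P'.map σ) →
        (∀ z, ev (P'.map σ) z ≠ ev (P.map σ) x) → An (P'.map (algebraMap F K.carrier)) := by
  have h2 : (2 : L) = 0 := CharTwo.two_eq_zero
  set b := bl (P.map σ) x σe with hbdef
  set p0 := ev (P.map σ) x with hp0
  have hno : ∀ t : L, t ^ 2 - b * t - p0 ≠ 0 := by
    intro t ht
    have h3 : ev (P.map σ) (x + t • σe) = 0 := by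
      rw [ev_add, ev_smul, bl_smul_right, heL, ← hbdef, ← hp0]
      linear_combination ht + (b * t + p0) * h2
    have h4 := hPL _ h3
    apply hb
    have h5 : x = -(t • σe) := eq_neg_of_add_eq_zero_left h4
    have h6 : -(t • σe) = (-t) • σe := by rw [neg_smul]
    rw [hbdef, h5, h6, bl_smul_left, bl_self, h2]; ring
  obtain ⟨K, _, _, α, B, hB0, hB1, hα⟩ := quadExt L b p0 hno
  letI : Algebra F K := ((algebraMap L K).comp σ).toAlgebra
  haveI : IsScalarTower F L K := IsScalarTower.of_algebraMap_eq fun _ => by rw [← hσ]; rfl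
  set t := algebraMap L K with ht
  have h2K : (2 : K) = 0 := by rw [← map_ofNat t 2, h2, map_zero]
  have hind : ∀ u v, t u + α * t v = 0 → u = 0 ∧ v = 0 := by
    intro u v h
    have li := B.linearIndependent
    rw [Fintype.linearIndependent_iff] at li
    have := li ![u, v] (by
      rw [Fin.sum_univ_two, hB0, hB1]
      simp only [Matrix.cons_val_zero, Matrix.cons_val_one, Algebra.smul_def, mul_one]
      rw [mul_comm (algebraMap _ _ v)]
      exact h)
    exact ⟨this 0, this 1⟩
  have hspan : ∀ w : K, ∃ u v, w = t u + α * t v := by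
    intro w
    refine ⟨B.repr w 0, B.repr w 1, ?_⟩
    conv_lhs => rw [← B.sum_repr w, Fin.sum_univ_two, hB0, hB1]
    simp only [Algebra.smul_def, mul_one]
    rw [mul_comm α]
  have hmap : ∀ {n : ℕ} (q : QF F n), q.map (algebraMap F K) = (q.map σ).map t := by
    intro n q
    rw [Matrix.map_map]; rfl
  refine ⟨⟨K⟩, ?_, ?_, ?_⟩
  · exact (hGR.trans (GR.quad α b p0 hb hα B hB0 hB1)).sep
  · intro hA
    change An (P.map (algebraMap F K)) at hA
    rw [hmap] at hA
    have h3 := hA (fun i => t (x i) + α * t (σe i)) (by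
      rw [ev_two, heL, map_one, ← hp0, ← hbdef, hα]
      linear_combination (t p0 + t b * α) * h2K)
    have h4 : σe = 0 := by
      ext i
      exact (hind _ _ (congrFun h3 i)).2
    rw [h4, ev_zero] at heL
    exact zero_ne_one heL
  · intro N P' gP' hPL' hne
    change An (P'.map (algebraMap F K))
    rw [hmap]
    intro w hw
    choose u v huv using fun i => hspan (w i)
    have hw' : w = fun i => t (u i) + α * t (v i) := funext huv
    rw [hw', ev_two, hα] at hw
    have h3 := (hind (ev (P'.map σ) u + p0 * ev (P'.map σ) v) (b * ev (P'.map σ) v + bl (P'.map σ) u v) (by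
      rw [← hw]; simp only [map_add, map_mul]; ring)).1
    by_cases hv : v = 0
    · rw [hv, ev_zero, mul_zero, add_zero] at h3
      have hu := hPL' _ h3
      rw [hw', hu, hv]
      ext i
      simp
    · exfalso
      have hv' : ev (P'.map σ) v ≠ 0 := fun h => hv (hPL' _ h)
      have h4 : ev (P'.map σ) u = p0 * ev (P'.map σ) v := by
        linear_combination h3 - (p0 * ev (P'.map σ) v) * h2
      obtain ⟨z, hz⟩ : ∃ z, ev (P'.map σ) z = p0 := by
        by_cases hu : ev (P'.map σ) u = 0
        · refine ⟨0, ?_⟩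
          rw [ev_zero]
          rw [hu] at h4
          exact ((mul_eq_zero.1 h4.symm).resolve_right hv').symm
        · obtain ⟨S, hS⟩ := gP'.ratio (u := u) (v := v) hu hv'
          obtain ⟨e', he'⟩ := gP'.one
          refine ⟨S e', (hS e').trans ?_⟩
          rw [he', mul_one]
          change ev _ u / ev _ v = p0
          rw [h4]; field_simp
      exact hne z hz

theorem exists_ff' {F : Type} [Field F] [CharP F 2] {M : ℕ} {P : QF F M} (hP : An P) (gP : GoodP (tq P)) :
    ∃ K : QF.FieldExt F, QF.IsSepExt F K.carrier ∧ ¬ An (P.map (algebraMap F K.carrier)) ∧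
      ∀ (k' : ℕ) (a' : Fin k' → F) (c' : F), 2 ^ k' * 2 < M → An (QF.qPfister a' c') →
        An ((QF.qPfister a' c').map (algebraMap F K.carrier)) := by
  obtain ⟨e, he⟩ := gP.one
  change ev _ e = 1 at he
  haveI hchar : CharP (Gen F M).carrier 2 := charP_of_injective_algebraMap (algebraMap F (Gen F M).carrier).injective 2
  obtain ⟨K, hK1, hK2, hK3⟩ := ff_core P (aG F M) rfl (genx F M) (fun i => aG F M (e i)) (hP.gen M)
    (by rw [ev_map, he, map_one]) (by
    intro h0
    rw [bl_expand] at h0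
    have := genx_indep M (fun i => ∑ j, (P i j + P j i) * e j) (by
      rw [← h0]
      refine Finset.sum_congr rfl fun i _ => ?_
      simp)
    have h3 : ∀ y, polar (tq P) e y = 0 := by
      intro y
      rw [tq_polar, bl_comm, bl_expand]
      refine Finset.sum_eq_zero fun i _ => ?_
      rw [congrFun this i]; simp
    have h4 := gP.nd e h3
    rw [h4, ev_zero] at he
    exact zero_ne_one he) (GR.gen F M)
  refine ⟨K, hK1, hK2, ?_⟩
  intro k' a' c' hk hP'
  have gP' := GoodP.qPfister _ (fun i => (map_ne_zero (aG F M)).2 (hP'.slots i)) (aG F M c')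
  rw [← qPfister_map] at gP'
  refine hK3 _ _ gP' (hP'.gen M) ?_
  intro z hz
  obtain ⟨T, hT⟩ := gvt hP' M Empty (fun i => i.elim) P (fun i => i.elim) z hz (fun i => i.elim)
  have hinj : Function.Injective T := by
    rw [← LinearMap.ker_eq_bot, LinearMap.ker_eq_bot']
    intro y hy
    apply hP y
    rw [← (hT y).1, hy, ev_zero]
  have := LinearMap.finrank_le_finrank_of_injective hinj
  simp only [Module.finrank_fin_fun] at this
  omega

theorem exists_ff {F : Type} [Field F] [CharP F 2] {k : ℕ} {a : Fin k → F} {c : F} (hP : An (QF.qPfister a c)) :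
    ∃ K : QF.FieldExt F, QF.IsSepExt F K.carrier ∧ ¬ An ((QF.qPfister a c).map (algebraMap F K.carrier)) ∧
      ∀ (k' : ℕ) (a' : Fin k' → F) (c' : F), k' < k → An (QF.qPfister a' c') →
        An ((QF.qPfister a' c').map (algebraMap F K.carrier)) := by
  obtain ⟨K, h1, h2, h3⟩ := exists_ff' hP (GoodP.qPfister a hP.slots c)
  refine ⟨K, h1, h2, fun k' a' c' hk => h3 k' a' c' ?_⟩
  have h5 : 2 ^ k' < 2 ^ k := Nat.pow_lt_pow_right (by norm_num) hk
  omega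

end QFX

namespace QFX
open QuadraticMap Module

section Step
variable {F K : Type} [Field F] [Field K] (σ : F →+* K)

lemma polar_zero_map {n : ℕ} (q : QF F n) (h : ∀ x y, polar (tq q) x y = 0) (x y : Fin n → K) :
    polar (tq (q.map σ)) x y = 0 := by
  rw [tq_polar, bl_expand]
  refine Finset.sum_eq_zero fun i _ => ?_
  rw [Finset.sum_eq_zero, zero_mul]
  intro j _
  have := h (Pi.single i 1) (Pi.single j 1)
  rw [tq_polar, bl_single] at this
  rw [Matrix.map_apply, Matrix.map_apply, ← map_add, this, map_zero, zero_mul]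

lemma aniso_smul_map {k n : ℕ} {A : Fin k → F} {c a : F} {ψ : QF F n} (ha : a ≠ 0)
    (hd : Dom (tq ψ) (a • tq (QF.qPfister A c))) (h : An ((QF.qPfister A c).map σ)) : An (ψ.map σ) := by
  rw [← tq_smul] at hd
  have h1 := Dom.map σ hd
  rw [smul_map, tq_smul] at h1
  exact h1.aniso (smul_aniso (an_iff.1 h) ((map_ne_zero σ).2 ha))

lemma step_split [CharP F 2] {k n m : ℕ} {A : Fin k → F} {c a : F} {ψ : QF F n} {ψ' : QF F m} (ha : a ≠ 0)
    (hA : An (QF.qPfister A c))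
    (hC : Compl (tq ψ) (tq ψ') (a • tq (QF.qPfister A c)))
    (h : ¬ An ((QF.qPfister A c).map σ)) :
    QF.wittIndex (ψ.map σ) + 2 ^ k = QF.wittIndex (ψ'.map σ) + n := by
  haveI : CharP K 2 := charP_of_injective_ringHom σ.injective 2
  have gP := GoodP.qPfister A hA.slots c
  have hnd : Nd (a • tq (QF.qPfister A c)) := by
    intro x hx
    apply gP.nd x
    intro y
    have := hx y
    simp only [polar, QuadraticMap.smul_apply, smul_eq_mul, ← mul_sub] at this
    exact (mul_eq_zero.1 this).resolve_left ha
  have e1 := hC.eqv hnd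
  rw [← tq_smul, finrank_fin_fun] at e1
  have e2 : (tq (QF.orthSum ψ (a • QF.qPfister A c))).Equivalent (tq (QF.orthSum ψ' (QF.hyper n))) :=
    (tq_orthSum _ _).trans (e1.trans ((Equivalent.prod (.refl _) (tq_hyper n).symm).trans (tq_orthSum _ _).symm))
  have e3 := eqv_map σ e2
  rw [orthSum_map, orthSum_map, hyper_map, smul_map] at e3
  have gK := GoodP.qPfister _ (fun i => (map_ne_zero σ).2 (hA.slots i)) (σ c)
  rw [← qPfister_map] at gK
  obtain ⟨l, hl, e4⟩ := gK.hyp h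
  have hl' : l = 2 ^ k := by
    rw [finrank_fin_fun] at hl; omega
  subst hl'
  have e5 : (σ a • tq ((QF.qPfister A c).map σ)).Equivalent (hy K (2 ^ k)) := by
    refine Equivalent.trans ?_ (smul_hy (σ a) ((map_ne_zero σ).2 ha) _)
    obtain ⟨f, hf⟩ := Equivalent.out e4
    exact eqv_of f fun x => by simp [hf]
  have w1 := wittIndex_prod _ (ψ.map σ) (2 ^ k) ((tq_orthSum _ _).trans
    (Equivalent.prod (.refl _) (by rw [tq_smul]; exact e5)))
  have w2 := wittIndex_prod _ (ψ'.map σ) n (e3.trans ((tq_orthSum _ _).trans (Equivalent.prod (.refl _) (tq_hyper n))))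
  omega

end Step

theorem hnd_chain {F : Type} [Field F] [CharP F 2] {a : F} (ha : a ≠ 0) (h : ℕ) (k : ℕ → ℕ) (A : ∀ i, Fin (k i) → F)
    (c : ℕ → F) (D : ℕ → ℕ) (ψ : ∀ i, QF F (D i)) {n : ℕ} (q : QF F n) (hq : (tq q).Equivalent (tq (ψ 0)))
    (hA : ∀ i, i < h → An (QF.qPfister (A i) (c i)))
    (hC : ∀ i, i < h → Compl (tq (ψ i)) (tq (ψ (i + 1))) (a • tq (QF.qPfister (A i) (c i))))
    (hD : ∀ i, i < h → 2 ^ k i < D i)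
    (hψ : ∀ x y, polar (tq (ψ h)) x y = 0)
    (hdom : ∀ i, i + 1 < h → Dom (tq (QF.qPfister (A (i + 1)) (c (i + 1)))) (tq (QF.qPfister (A i) (c i))))
    (hk : ∀ i, i + 1 < h → k (i + 1) < k i) : QF.hnd q = h := by
  set J : ℕ → ℕ := fun j => ∑ i ∈ Finset.range j, (D i - 2 ^ k i) with hJ
  have key : ∀ (K : Type) [Field K] (σ : F →+* K) (j : ℕ), j ≤ h →
      (∀ i, i < j → ¬ An ((QF.qPfister (A i) (c i)).map σ)) →
      (j < h → An ((QF.qPfister (A j) (c j)).map σ)) → QF.wittIndex (q.map σ) = J j := by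
    intro K _ σ j hj h1 h2
    have h0 : QF.wittIndex ((ψ j).map σ) = 0 := by
      rcases hj.lt_or_eq with h3 | rfl
      · exact wittIndex_aniso _ (aniso_smul_map σ ha (hC j h3).dom (h2 h3))
      · exact wittIndex_polar_zero _ (polar_zero_map σ _ hψ)
    have h3 : ∀ i, i ≤ j → QF.wittIndex ((ψ 0).map σ) = J i + QF.wittIndex ((ψ i).map σ) := by
      intro i
      induction i with
      | zero => intro _; simp [hJ]
      | succ i ih =>
        intro hi
        have e1 := ih (by omega)
        have e2 := step_split σ ha (hA i (by omega)) (hC i (by omega)) (h1 i hi)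
        have e3 := hD i (by omega)
        have e4 : J (i + 1) = J i + (D i - 2 ^ k i) := Finset.sum_range_succ _ _
        omega
    have h4 := h3 j le_rfl
    have h5 := wittIndex_prod (q.map σ) ((ψ 0).map σ) 0
      ((eqv_map σ hq).trans (prod_zero_dim _ (hy K 0) (by simp)).symm)
    omega
  have hset : QF.splittingPattern q = J '' Set.Iic h := by
    ext w
    constructor
    · rintro ⟨K, _, rfl⟩
      let σ := algebraMap F K.carrier
      have hex : ∃ j, ¬ (j < h ∧ ¬ An ((QF.qPfister (A j) (c j)).map σ)) := ⟨h, fun hh => lt_irrefl _ hh.1⟩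
      classical
      have s1 := Nat.find_spec hex
      have s2 := fun i hi => Nat.find_min hex (m := i) hi
      have hle : Nat.find hex ≤ h := Nat.find_min' hex (fun hh => lt_irrefl _ hh.1)
      refine ⟨Nat.find hex, hle, ?_⟩
      refine (key K.carrier σ _ hle (fun i hi => ?_) (fun hi => ?_)).symm
      · exact (not_not.1 (s2 i hi)).2
      · by_contra hc
        exact s1 ⟨hi, hc⟩
    · rintro ⟨j, hj, rfl⟩
      rw [Set.mem_Iic] at hj
      rcases Nat.eq_zero_or_pos j with rfl | hpos
      · refine ⟨⟨F⟩, (GR.self F).sep, ?_⟩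
        refine key F (algebraMap F F) 0 hj (fun i hi => absurd hi (by omega)) (fun hi => ?_)
        exact hA 0 hi
      · obtain ⟨j, rfl⟩ : ∃ j', j = j' + 1 := ⟨j - 1, by omega⟩
        obtain ⟨K, k1, k2, k3⟩ := exists_ff (hA j (by omega))
        refine ⟨K, k1, key K.carrier (algebraMap F K.carrier) (j + 1) hj ?_ ?_⟩
        · have : ∀ d i, i + d = j → ¬ An ((QF.qPfister (A i) (c i)).map (algebraMap F K.carrier)) := by
            intro d
            induction d with
            | zero => rintro i rfl; exact k2
            | succ d ih =>
              intro i hi hn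
              exact ih (i + 1) (by omega) ((Dom.map _ (hdom i (by omega))).aniso hn)
          intro i hi
          exact this (j - i) i (by omega)
        · intro hi
          exact k3 _ _ _ (hk j hi) (hA _ hi)
  have hmono : ∀ i, i < h → J i < J (i + 1) := by
    intro i hi
    have e4 : J (i + 1) = J i + (D i - 2 ^ k i) := Finset.sum_range_succ _ _
    have := hD i hi
    omega
  have hinj : Set.InjOn J (Set.Iic h) := by
    have : ∀ d i, i + (d + 1) ≤ h → J i < J (i + (d + 1)) := by
      intro d
      induction d with
      | zero => intro i hi; exact hmono i hi
      | succ d ih => intro i hi; exact (ih i (by omega)).trans (hmono (i + (d + 1)) (by omega))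
    intro i hi j hj he
    rw [Set.mem_Iic] at hi hj
    rcases lt_trichotomy i j with hl | hl | hl
    · have := this (j - i - 1) i (by omega)
      rw [show i + (j - i - 1 + 1) = j by omega] at this
      omega
    · exact hl
    · have := this (i - j - 1) j (by omega)
      rw [show j + (i - j - 1 + 1) = i by omega] at this
      omega
  unfold QF.hnd
  rw [hset, hinj.ncard_image]
  have : (Set.Iic h).ncard = h + 1 := by
    rw [Set.ncard_eq_toFinset_card']; simp
  omega

end QFX

namespace QFX
open QuadraticMap Module

section A
variable {F : Type} [Field F] {U V W X Y : Type} [AddCommGroup U] [Module F U] [AddCommGroup V] [Module F V]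
  [AddCommGroup W] [Module F W] [AddCommGroup X] [Module F X]

lemma nd_smul {Q : QuadraticForm F V} (h : Nd Q) {a : F} (ha : a ≠ 0) : Nd (a • Q) := by
  intro x hx
  apply h x
  intro y
  have := hx y
  simp only [polar, QuadraticMap.smul_apply, smul_eq_mul, ← mul_sub] at this
  exact (mul_eq_zero.1 this).resolve_left ha

lemma smul_prod_eqv (a : F) (P : QuadraticForm F U) (Q : QuadraticForm F V) :
    (a • P.prod Q).Equivalent ((a • P).prod (a • Q)) :=
  eqv_of (LinearEquiv.refl F _) fun x => by simp [mul_add]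

lemma smul_congr (a : F) {P : QuadraticForm F U} {Q : QuadraticForm F V} (h : P.Equivalent Q) :
    (a • P).Equivalent (a • Q) := by
  obtain ⟨f, hf⟩ := Equivalent.out h
  exact eqv_of f fun x => by simp [hf]

lemma smul_dom (a : F) {P : QuadraticForm F U} {Q : QuadraticForm F V} (h : Dom P Q) :
    Dom (a • P) (a • Q) := by
  obtain ⟨f, hf, hf'⟩ := h
  exact ⟨f, hf, fun x => by simp [hf']⟩

lemma smul_dom_cancel {a : F} (ha : a ≠ 0) {P : QuadraticForm F U} {Q : QuadraticForm F V} (h : Dom (a • P) (a • Q)) :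
    Dom P Q := by
  have := smul_dom a⁻¹ h
  rwa [smul_smul, smul_smul, inv_mul_cancel₀ ha, one_smul, one_smul] at this

lemma Compl.congr2 {P : QuadraticForm F U} {Q : QuadraticForm F X} {R : QuadraticForm F V} (h : Compl P Q R)
    {Q' : QuadraticForm F W} (e : Q.Equivalent Q') : Compl P Q' R := (h.symm.congr e).symm

lemma sum_chain [CharP F 2] {a : F} (h : ℕ) (e : ℕ → ℕ) (Pf : ∀ i, QF F (2 ^ e i * 2)) (D : ℕ → ℕ)
    (ψ : ∀ i, QF F (D i)) (hnd : ∀ i, i < h → Nd (a • tq (Pf i)))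
    (hC : ∀ i, i < h → Compl (tq (ψ i)) (tq (ψ (i + 1))) (a • tq (Pf i))) :
    ∀ j, j ≤ h → ∃ M, ((a • tq (QF.sumFam Pf j)).prod (tq (ψ j))).Equivalent ((tq (ψ 0)).prod (hy F M)) := by
  intro j
  induction j with
  | zero =>
    intro _
    refine ⟨0, ?_⟩
    exact (eqv_prod_comm _ _).trans ((prod_zero_dim _ _ (tq_sumFam_zero Pf)).trans (prod_zero_dim _ _ (by simp)).symm)
  | succ j ih =>
    intro hj
    obtain ⟨M, hM⟩ := ih (by omega)
    have e1 := (hC j (by omega)).symm.eqv (hnd j (by omega))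
    rw [finrank_fin_fun] at e1
    refine ⟨M + D (j + 1), ?_⟩
    have e2 := (smul_congr a (tq_sumFam_succ Pf j)).trans (smul_prod_eqv a _ _)
    refine (Equivalent.prod e2 (.refl _)).trans ?_
    refine (eqv_prod_assoc _ _ _).trans ?_
    refine (Equivalent.prod (.refl _) ((eqv_prod_comm _ _).trans e1)).trans ?_
    refine (eqv_prod_assoc _ _ _).symm.trans ?_
    refine (Equivalent.prod hM (.refl _)).trans ?_
    refine (eqv_prod_assoc _ _ _).trans ?_
    exact Equivalent.prod (.refl _) (hy_add _ _).symm

lemma anisoPart_self {n : ℕ} {q : QF F n} (h : An q) : QF.IsAnisotropicPart q q := by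
  rw [isAnisotropicPart_iff]
  refine ⟨h, 0, 0, ?_⟩
  exact ((prod_zero_dim _ _ (by simp)).trans (prod_zero_dim _ _ (by simp))).symm

lemma anisoPart_of_hy {n m M : ℕ} {q : QF F n} {p : QF F m} (h : An p) (he : (tq q).Equivalent ((tq p).prod (hy F M))) :
    QF.IsAnisotropicPart q p := by
  rw [isAnisotropicPart_iff]
  refine ⟨h, M, 0, ?_⟩
  exact he.trans (Equivalent.prod (prod_zero_dim _ _ (by simp)).symm (.refl _))

lemma nondefective_of_an {n : ℕ} {q : QF F n} (h : An q) : QF.Nondefective q := by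
  unfold QF.Nondefective QF.defect
  have : {d | ∃ W : Submodule F (Fin n → F), Module.finrank F W = d ∧
    (∀ x ∈ W, QF.eval q x = 0) ∧ ∀ x ∈ W, ∀ y, QF.polar q x y = 0} = {0} := by
    ext d
    constructor
    · rintro ⟨W, rfl, h1, _⟩
      have : W = ⊥ := by
        rw [Submodule.eq_bot_iff]
        intro x hx
        exact h x (h1 x hx)
      rw [this]; simp
    · rintro rfl
      refine ⟨⊥, by simp, ?_, ?_⟩
      · intro x hx
        rw [Submodule.mem_bot] at hx
        rw [hx, eval_eq, ev_zero]
      · intro x hx y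
        rw [Submodule.mem_bot] at hx
        rw [hx, polar_eq, bl_zero_left]
  rw [this]; simp

lemma isComplementOf_of_compl [CharP F 2] {k n m : ℕ} {ψ : QF F n} {ψ' : QF F m} {π : QF F (2 ^ k * 2)}
    (hπ : QF.IsGenPfister k π) (hnd : Nd (tq π)) (han : An π) (hn : 2 ^ k < n)
    (hC : Compl (tq ψ) (tq ψ') (tq π)) : QF.IsComplementOf ψ ψ' := by
  have h' : An ψ' := hC.symm.dom.aniso han
  have hf := hC.finrank
  simp only [finrank_fin_fun] at hf
  refine ⟨k, π, hn, hπ, hC.dom, by omega, nondefective_of_an h', m, ψ', ?_, anisoPart_self h'⟩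
  exact anisoPart_of_hy h' ((tq_orthSum _ _).trans (hC.eqv hnd))

lemma compl_of_isComplementOf [CharP F 2] {n m : ℕ} {ψ : QF F n} {ψ' : QF F m} (h : An ψ) (hc : QF.IsComplementOf ψ ψ') :
    ∃ (k : ℕ) (d : F) (A : Fin k → F) (c : F), d ≠ 0 ∧ 2 ^ k < n ∧ An (QF.qPfister A c) ∧
      Compl (tq ψ) (tq ψ') (d • tq (QF.qPfister A c)) := by
  obtain ⟨k, π, hn, ⟨d, hd, A, c, hπ⟩, hdom, hm, -, l, qa, h1, h2⟩ := hc
  rw [isom_iff, tq_smul] at hπ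
  rw [dominated_iff] at hdom
  have hdom' := hdom.trans (Equivalent.dom hπ)
  have hA := neighbour_aniso hd h hn hdom'
  have gP := GoodP.qPfister A hA.slots c
  have hnd := nd_smul gP.nd hd
  refine ⟨k, d, A, c, hd, hn, hA, ?_⟩
  have hle := hdom'.le
  simp only [finrank_fin_fun] at hle
  obtain ⟨p, hp⟩ := hdom'.exists_compl hnd m (by simp only [finrank_fin_fun]; omega)
  have hpan : An p := hp.symm.dom.aniso (smul_aniso (an_iff.1 hA) hd)
  have e1 : QF.IsAnisotropicPart (QF.orthSum ψ π) p :=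
    anisoPart_of_hy hpan ((tq_orthSum _ _).trans ((Equivalent.prod (.refl _) hπ).trans (hp.eqv hnd)))
  have e2 := anisoPart_unique e1 h1
  rw [isAnisotropicPart_iff] at h2
  obtain ⟨-, w, d', e3⟩ := h2
  have f1 := Equivalent.finrank_eq e2
  have f2 := Equivalent.finrank_eq e3
  simp [hy] at f1 f2
  have hw : w = 0 := by omega
  have hd' : d' = 0 := by omega
  subst hw hd'
  refine hp.congr2 (e2.trans ?_)
  exact (e3.trans ((prod_zero_dim _ _ (by simp)).trans (prod_zero_dim _ _ (by simp)))).symm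

lemma hasRad_type [CharP F 2] {n r s : ℕ} {q : QF F n} {c : Fin s → F} (h : QF.HasTypeWith q r s c) :
    HasRad (tq q) (tq (QF.diag c)) := by
  obtain ⟨a, b, h⟩ := h
  rw [isom_iff] at h
  exact (HasRad.prod _ (polar_diag c) (nd_binSum a b)).congr ((h.trans (tq_orthSum _ _)).symm)

lemma GoodP.smul_eqv [FiniteDimensional F V] {Q : QuadraticForm F V} (g : GoodP Q) {d a : F} (ha : a ≠ 0) {v : V} (h : d * Q v = a) :
    (d • Q).Equivalent (a • Q) := by
  have hv : Q v ≠ 0 := by rintro h0; rw [h0, mul_zero] at h; exact ha h.symm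
  obtain ⟨S, hS⟩ := g.round v hv
  obtain ⟨f, hf⟩ := sim_equiv g.nd hv S hS
  refine Equivalent.symm (eqv_of f fun x => ?_)
  simp [hf, ← h, mul_assoc]

end A
end QFX

namespace QFX
open QuadraticMap Module

theorem forward (F : Type) [Field F] [CharP F 2]
    {n s : ℕ} (q : QF F n) (c : Fin s → F)
    (haniso : QF.Anisotropic q)
    (g : ℕ) (hse : QF.StronglyExcellentOfHeight q c (g + 1)) :
    ∃ (e : ℕ → ℕ) (Pf : ∀ i, QF F (2 ^ e i * 2)) (td : ℕ) (τ : QF F td) (a : F),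
      a ≠ 0 ∧
      (∀ i, i < g + 1 → QF.IsPfister (e i) (Pf i) ∧ QF.Anisotropic (Pf i)) ∧
      QF.IsQuasilinear τ ∧ QF.Anisotropic τ ∧
      QF.WittEquiv q (a • QF.orthSum (QF.sumFam Pf (g + 1)) τ) ∧
      (∀ i, 1 ≤ i → i < g + 1 →
        QF.Subform (Pf i) (Pf (i - 1)) ∧ 2 ^ e i * 2 < 2 ^ e (i - 1) * 2) ∧
      QF.Dominated τ (Pf (g + 1 - 1)) ∧ 2 * td < 2 ^ e (g + 1 - 1) * 2 ∧
      (td = 0 → 2 ≤ g + 1 → 2 * (2 ^ e (g + 1 - 1) * 2) < 2 ^ e (g + 1 - 2) * 2) := by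
  obtain ⟨-, D, ψ, h0, -, hcomp, hlast⟩ := hse
  set X : ℕ → Σ n, QF F n := fun i => if i < g + 1 then ⟨D i, ψ i⟩ else ⟨s, QF.diag c⟩ with hX
  have X1 : ∀ i, i < g + 1 → X i = ⟨D i, ψ i⟩ := fun i hi => if_pos hi
  have X2 : X (g + 1) = ⟨s, QF.diag c⟩ := if_neg (lt_irrefl _)
  have hcX : ∀ i, i < g + 1 → QF.IsComplementOf (X i).2 (X (i + 1)).2 := by
    intro i hi
    by_cases hi' : i + 1 < g + 1
    · rw [X1 i hi, X1 _ hi']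
      exact hcomp i hi'
    · obtain rfl : i = g := by omega
      rw [X1 i hi, X2]
      exact hlast
  have hX0 : (tq (X 0).2).Equivalent (tq q) := by
    rw [X1 0 (by omega)]
    exact isom_iff.1 h0
  clear_value X
  clear h0 hcomp hlast hX X1
  have hAn : ∀ i, i ≤ g + 1 → An (X i).2 := by
    intro i
    induction i with
    | zero => intro _; exact Equivalent.aniso hX0.symm haniso
    | succ i ih =>
      intro hi
      obtain ⟨k, d, A, c, hd, -, hA, hC⟩ := compl_of_isComplementOf (ih (by omega)) (hcX i hi)
      exact hC.symm.dom.aniso (smul_aniso (an_iff.1 hA) hd)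
  have hex : ∀ i, ∃ (k : ℕ) (d : F) (A : Fin k → F) (c : F), i < g + 1 → d ≠ 0 ∧ 2 ^ k < (X i).1 ∧ An (QF.qPfister A c) ∧
      Compl (tq (X i).2) (tq (X (i + 1)).2) (d • tq (QF.qPfister A c)) := by
    intro i
    by_cases hi : i < g + 1
    · obtain ⟨k, d, A, c, hh⟩ := compl_of_isComplementOf (hAn i hi.le) (hcX i hi)
      exact ⟨k, d, A, c, fun _ => hh⟩
    · exact ⟨0, 0, 0, 0, fun h => absurd h hi⟩
  choose k d A b hP using hex
  have good : ∀ i, i < g + 1 → GoodP (tq (QF.qPfister (A i) (b i))) := fun i hi =>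
    GoodP.qPfister _ (hP i hi).2.2.1.slots _
  have hlink : ∀ i, i + 1 < g + 1 → Dom (d (i + 1) • tq (QF.qPfister (A (i + 1)) (b (i + 1))))
      (d i • tq (QF.qPfister (A i) (b i))) := by
    intro i hi
    obtain ⟨a1, a2, a3, a4⟩ := hP i (by omega)
    obtain ⟨b1, b2, b3, b4⟩ := hP (i + 1) hi
    exact link a1 b1 a3 b3 a4.symm.dom b4.dom b2
  have hlink' : ∀ j i, i + j = g → Dom (d g • tq (QF.qPfister (A g) (b g)))
      (d i • tq (QF.qPfister (A i) (b i))) := by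
    intro j
    induction j with
    | zero => rintro i rfl; exact Equivalent.dom (.refl _)
    | succ j ih => intro i hi; exact (ih (i + 1) (by omega)).trans (hlink i (by omega))
  have ha := (hP g (by omega)).1
  set a := d g with hadef
  have heq : ∀ i, i < g + 1 → (d i • tq (QF.qPfister (A i) (b i))).Equivalent (a • tq (QF.qPfister (A i) (b i))) := by
    intro i hi
    obtain ⟨f, -, hf⟩ := hlink' (g - i) i (by omega)
    obtain ⟨e1, he1⟩ := (good g (by omega)).one
    refine (good i hi).smul_eqv (v := f e1) ha ?_
    have := hf e1
    simpa [he1] using this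
  have hC : ∀ i, i < g + 1 → Compl (tq (X i).2) (tq (X (i + 1)).2) (a • tq (QF.qPfister (A i) (b i))) :=
    fun i hi => (hP i hi).2.2.2.congr3 (heq i hi)
  have hdom : ∀ i, i + 1 < g + 1 → Dom (tq (QF.qPfister (A (i + 1)) (b (i + 1)))) (tq (QF.qPfister (A i) (b i))) := by
    intro i hi
    refine smul_dom_cancel ha ?_
    exact (Equivalent.dom (heq (i + 1) hi).symm).trans ((hlink i hi).trans (Equivalent.dom (heq i (by omega))))
  have hdim : ∀ i, i < g + 1 → (X (i + 1)).1 + (X i).1 = 2 ^ k i * 2 ∧ 2 ^ k i < (X i).1 := by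
    intro i hi
    have := (hC i hi).finrank
    simp only [finrank_fin_fun] at this
    exact ⟨this, (hP i hi).2.1⟩
  have hAnl := hAn (g + 1) le_rfl
  have hCl := (hC g (by omega)).symm.dom
  have hdl := hdim g (by omega)
  obtain ⟨M, hM⟩ := sum_chain (g + 1) k (fun i => QF.qPfister (A i) (b i)) (fun i => (X i).1) (fun i => (X i).2)
    (fun i hi => nd_smul (good i hi).nd ha) hC (g + 1) le_rfl
  beta_reduce at hM
  rw [X2] at hAnl hCl hdl hM
  dsimp only at hAnl hCl hdl hM
  have hai : a⁻¹ ≠ 0 := inv_ne_zero ha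
  refine ⟨k, fun i => QF.qPfister (A i) (b i), s, a⁻¹ • QF.diag c, a, ha, ?_, ?_, ?_, ?_, ?_, ?_, ?_, ?_⟩
  · intro i hi
    exact ⟨⟨A i, b i, isom_iff.2 (.refl _)⟩, (hP i hi).2.2.1⟩
  · refine ⟨fun i => a⁻¹ * c i, ?_⟩
    rw [isom_iff, tq_smul]
    refine eqv_of (LinearEquiv.refl F _) fun x => ?_
    simp [ev_diag, Finset.mul_sum, mul_assoc]
  · rw [aniso_iff, tq_smul]
    exact smul_aniso (an_iff.1 hAnl) hai
  · refine ⟨n, q, anisoPart_self haniso, anisoPart_of_hy (M := M) haniso ?_⟩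
    rw [tq_smul]
    refine (smul_congr a (tq_orthSum _ _)).trans ((smul_prod_eqv a _ _).trans ?_)
    rw [tq_smul, smul_smul, mul_inv_cancel₀ ha, one_smul]
    exact hM.trans (Equivalent.prod hX0 (.refl _))
  · intro i hi1 hi
    obtain ⟨i, rfl⟩ : ∃ j, i = j + 1 := ⟨i - 1, by omega⟩
    rw [Nat.add_sub_cancel]
    constructor
    · obtain ⟨l, p, hp⟩ := (hdom i hi).split (good _ hi).nd (good i (by omega)).nd
      exact ⟨l, p, isom_iff.2 (hp.trans (tq_orthSum _ _).symm)⟩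
    · have h1 := hdim i (by omega)
      have h2 := hdim (i + 1) hi
      omega
  · rw [Nat.add_sub_cancel, dominated_iff, tq_smul]
    refine smul_dom_cancel ha ?_
    rw [smul_smul, mul_inv_cancel₀ ha, one_smul]
    exact hCl
  · rw [Nat.add_sub_cancel]; omega
  · intro hs hg
    obtain ⟨g, rfl⟩ : ∃ j, g = j + 1 := ⟨g - 1, by omega⟩
    have h1 := hdim g (by omega)
    rw [Nat.add_sub_cancel, show g + 1 + 1 - 2 = g by omega]
    omega

end QFX

namespace QFX
open QuadraticMap Module

open Classical in
/-- one complement, if it exists -/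
noncomputable def stp {F : Type} [Field F] {N : ℕ} (R : QF F N) (s : Σ n, QF F n) : Σ n, QF F n :=
  if H : ∃ p : Σ n, QF F n, Compl (tq p.2) (tq s.2) (tq R) then H.choose else s

lemma stp_spec {F : Type} [Field F] {N : ℕ} (R : QF F N) (s : Σ n, QF F n) (hR : Nd (tq R)) (h : Dom (tq s.2) (tq R)) :
    Compl (tq (stp R s).2) (tq s.2) (tq R) := by
  have hle := h.le
  simp only [finrank_fin_fun] at hle
  obtain ⟨p, hp⟩ := h.exists_compl hR (N - s.1) (by simp only [finrank_fin_fun]; omega)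
  have H : ∃ p : Σ n, QF F n, Compl (tq p.2) (tq s.2) (tq R) := ⟨⟨_, p⟩, hp.symm⟩
  unfold stp
  rw [dif_pos H]
  exact H.choose_spec

/-- the chain of complements -/
noncomputable def chn {F : Type} [Field F] {D : ℕ → ℕ} (R : ∀ i, QF F (D i)) (h : ℕ) (s : Σ n, QF F n) : ℕ → Σ n, QF F n
  | 0 => s
  | j + 1 => stp (R (h - 1 - j)) (chn R h s j)

theorem backward (F : Type) [Field F] [CharP F 2]
    {n r s : ℕ} (q : QF F n) (c : Fin s → F)
    (haniso : QF.Anisotropic q)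
    (hty : QF.HasTypeWith q r s c)
    (h : ℕ) (hh : 0 < h)
    (e : ℕ → ℕ) (Pf : ∀ i, QF F (2 ^ e i * 2)) (td : ℕ) (τ : QF F td) (a : F)
    (ha : a ≠ 0)
    (hPf : ∀ i, i < h → QF.IsPfister (e i) (Pf i) ∧ QF.Anisotropic (Pf i))
    (hτq : QF.IsQuasilinear τ)
    (hw : QF.WittEquiv q (a • QF.orthSum (QF.sumFam Pf h) τ))
    (hsub : ∀ i, 1 ≤ i → i < h →
        QF.Subform (Pf i) (Pf (i - 1)) ∧ 2 ^ e i * 2 < 2 ^ e (i - 1) * 2)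
    (hτd : QF.Dominated τ (Pf (h - 1))) (htd : 2 * td < 2 ^ e (h - 1) * 2)
    (hiv : td = 0 → 2 ≤ h → 2 * (2 ^ e (h - 1) * 2) < 2 ^ e (h - 2) * 2) :
    QF.StronglyExcellentOfHeight q c h ∧ QF.hnd q = h := by
  have hex : ∀ i, ∃ (A : Fin (e i) → F) (b : F), i < h → (tq (Pf i)).Equivalent (tq (QF.qPfister A b)) := by
    intro i
    by_cases hi : i < h
    · obtain ⟨⟨A, b, hA⟩, _⟩ := hPf i hi
      exact ⟨A, b, fun _ => isom_iff.1 hA⟩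
    · exact ⟨0, 0, fun h => absurd h hi⟩
  choose A b hA using hex
  have an : ∀ i, i < h → An (Pf i) := fun i hi => (hPf i hi).2
  have anA : ∀ i, i < h → An (QF.qPfister (A i) (b i)) := fun i hi => Equivalent.aniso (hA i hi) (an i hi)
  have nd : ∀ i, i < h → Nd (tq (Pf i)) := fun i hi =>
    Equivalent.nd (hA i hi).symm (GoodP.qPfister _ (anA i hi).slots _).nd
  have hdom : ∀ i, i + 1 < h → Dom (tq (Pf (i + 1))) (tq (Pf i)) ∧ e (i + 1) < e i := by
    intro i hi
    obtain ⟨⟨l, p, hp⟩, h2⟩ := hsub (i + 1) (by omega) hi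
    rw [Nat.add_sub_cancel] at hp h2
    constructor
    · rw [isom_iff] at hp
      refine Dom.trans ?_ (Equivalent.dom (hp.trans (tq_orthSum _ _)).symm)
      exact ⟨LinearMap.inl F _ _, LinearMap.inl_injective, fun x => by simp⟩
    · rw [← Nat.pow_lt_pow_iff_right (show 1 < 2 by norm_num)]
      omega
  set R : ∀ i, QF F (2 ^ e i * 2) := fun i => a • Pf i with hR
  have ndR : ∀ i, i < h → Nd (tq (R i)) := fun i hi => by
    rw [hR]; dsimp only; rw [tq_smul]; exact nd_smul (nd i hi) ha
  have anR : ∀ i, i < h → An (R i) := fun i hi => by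
    rw [an_iff, hR]; dsimp only; rw [tq_smul]; exact smul_aniso (an_iff.1 (an i hi)) ha
  set χ := chn R h ⟨td, a • τ⟩ with hχ
  have χ0 : χ 0 = ⟨td, a • τ⟩ := rfl
  have hstep : ∀ j i, i + j + 1 = h → Dom (tq (χ j).2) (tq (R i)) → Compl (tq (χ (j + 1)).2) (tq (χ j).2) (tq (R i)) := by
    intro j i hi hd
    obtain rfl : i = h - 1 - j := by omega
    exact stp_spec _ _ (ndR _ (by omega)) hd
  have inv : ∀ j i, i + j + 1 = h → Dom (tq (χ j).2) (tq (R i)) ∧ 2 * (χ j).1 < 2 ^ e i * 2 ∧ (0 < j → 0 < (χ j).1) := by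
    intro j
    induction j with
    | zero =>
      intro i hi
      obtain rfl : i = h - 1 := by omega
      rw [χ0]
      refine ⟨?_, htd, fun h0 => absurd h0 (by omega)⟩
      rw [hR]
      dsimp only
      rw [tq_smul, tq_smul]
      exact smul_dom a hτd
    | succ j ih =>
      intro i hi
      obtain ⟨h1, h2, h3⟩ := ih (i + 1) (by omega)
      have hC := hstep j (i + 1) (by omega) h1
      have hf := hC.finrank
      simp only [finrank_fin_fun] at hf
      obtain ⟨g1, g2⟩ := hdom i (by omega)
      refine ⟨hC.dom.trans ?_, ?_, ?_⟩
      · rw [hR]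
        dsimp only
        rw [tq_smul, tq_smul]
        exact smul_dom a g1
      · have hp : 2 ^ e (i + 1) * 2 ≤ 2 ^ e i := by
          rw [← pow_succ]; exact Nat.pow_le_pow_right (by norm_num) g2
        rcases Nat.eq_zero_or_pos (χ j).1 with hz | hz
        · have hj : j = 0 := by
            by_contra hj
            have := h3 (by omega)
            omega
          subst hj
          have := hiv hz (by omega)
          rw [show h - 1 = i + 1 by omega, show h - 2 = i by omega] at this
          omega
        · omega
      · intro _
        omega
  set D : ℕ → ℕ := fun i => (χ (h - i)).1 with hD
  set ψ : ∀ i, QF F (D i) := fun i => (χ (h - i)).2 with hψ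
  have hC : ∀ i, i < h → Compl (tq (ψ i)) (tq (ψ (i + 1))) (tq (R i)) := by
    intro i hi
    have := hstep (h - (i + 1)) i (by omega) (inv _ i (by omega)).1
    have hs : h - (i + 1) + 1 = h - i := by omega
    change Compl (tq (χ (h - i)).2) (tq (χ (h - (i + 1))).2) (tq (R i))
    rw [← hs]
    exact this
  have hdim : ∀ i, i < h → 2 ^ e i < D i := by
    intro i hi
    have h1 := (inv (h - (i + 1)) i (by omega)).2.1
    have h2 := (hC i hi).finrank
    simp only [finrank_fin_fun] at h2
    have h3 : D (i + 1) = (χ (h - (i + 1))).1 := rfl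
    omega
  have hlast : (tq (ψ h)).Equivalent (tq (a • τ)) := by
    change (tq (χ (h - h)).2).Equivalent _
    rw [Nat.sub_self]
    exact .refl _
  have pz : ∀ x y, polar (tq (a • τ)) x y = 0 := by
    obtain ⟨c', hc'⟩ := hτq
    rw [isom_iff] at hc'
    obtain ⟨f, hf⟩ := Equivalent.out hc'
    intro x y
    have h1 := polar_isom (f := f.toLinearMap) hf x y
    rw [polar_diag] at h1
    rw [tq_polar] at h1 ⊢
    rw [smul_bl, ← h1, mul_zero]
  have pzψ : ∀ x y, polar (tq (ψ h)) x y = 0 := by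
    obtain ⟨f, hf⟩ := Equivalent.out hlast
    intro x y
    rw [← polar_isom (f := f.toLinearMap) hf x y]
    exact pz _ _
  have hC' : ∀ i, i < h → Compl (tq (ψ i)) (tq (ψ (i + 1))) (a • tq (Pf i)) := by
    intro i hi
    rw [← tq_smul]
    exact hC i hi
  obtain ⟨M, hM⟩ := sum_chain h e Pf D ψ (fun i hi => nd_smul (nd i hi) ha) hC' h le_rfl
  have anψ : ∀ i, i < h → An (ψ i) := fun i hi => (hC i hi).dom.aniso (anR i hi)
  have hq : (tq q).Equivalent (tq (ψ 0)) := by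
    obtain ⟨l, qa, w1, w2⟩ := hw
    have e1 := anisoPart_unique (anisoPart_self haniso) w1
    refine e1.trans (anisoPart_unique w2 (anisoPart_of_hy (M := M) (anψ 0 hh) ?_))
    rw [tq_smul]
    refine (smul_congr a (tq_orthSum _ _)).trans ((smul_prod_eqv a _ _).trans ?_)
    rw [← tq_smul a τ]
    exact (Equivalent.prod (.refl _) hlast.symm).trans hM
  have hrad : ∀ j i, i + j = h → HasRad (tq (ψ i)) (tq (ψ h)) := by
    intro j
    induction j with
    | zero => rintro i rfl; exact HasRad.polar_zero _ pzψ
    | succ j ih => intro i hi; exact (hC i (by omega)).hasRad (ndR i (by omega)) (ih (i + 1) (by omega))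
  have hdiag : (tq (ψ h)).Equivalent (tq (QF.diag c)) :=
    (hrad h 0 (by omega)).unique ((hasRad_type hty).congr hq)
  have hgen : ∀ i, i < h → QF.IsGenPfister (e i) (R i) := by
    intro i hi
    refine ⟨a, ha, A i, b i, ?_⟩
    rw [isom_iff, hR]
    dsimp only
    rw [tq_smul, tq_smul]
    exact smul_congr a (hA i hi)
  refine ⟨⟨hh, D, ψ, isom_iff.2 hq.symm, ?_, ?_, ?_⟩, ?_⟩
  · intro i hi
    exact ⟨e i, R i, hdim i hi, hgen i hi, (hC i hi).dom⟩
  · intro i hi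
    exact isComplementOf_of_compl (hgen i (by omega)) (ndR i (by omega)) (anR i (by omega)) (hdim i (by omega)) (hC i (by omega))
  · obtain ⟨g, rfl⟩ : ∃ g, h = g + 1 := ⟨h - 1, by omega⟩
    rw [Nat.add_sub_cancel]
    exact isComplementOf_of_compl (hgen g (by omega)) (ndR g (by omega)) (anR g (by omega)) (hdim g (by omega))
      ((hC g (by omega)).congr2 hdiag)
  · refine hnd_chain ha h e A b D ψ q hq anA (fun i hi => (hC' i hi).congr3 (smul_congr a (hA i hi))) hdim pzψ ?_
      (fun i hi => (hdom i hi).2)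
    intro i hi
    exact (Equivalent.dom (hA _ hi).symm).trans ((hdom i hi).1.trans (Equivalent.dom (hA i (by omega))))

end QFX

/-- Proposition 2.16: an anisotropic nonquasilinear quadratic form `φ`
over a field `F` of characteristic 2 is strongly excellent of nondefective height `h`
iff there are anisotropic Pfister forms `π₀ ⊋ π₁ ⊋ ⋯ ⊋ π_{h-1}`, an anisotropic
quasilinear form `τ` and a scalar `a ≠ 0` such that
(i) `φ ~ a (π₀ ⊥ ⋯ ⊥ π_{h-1} ⊥ τ)`; (ii) each `π_i` is a proper subform of `π_{i-1}`;
(iii) `τ ≺ π_{h-1}` and `dim τ < (dim π_{h-1}) / 2`; (iv) if `τ = 0` then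
`dim π_{h-2} > 2 dim π_{h-1}`. -/
theorem statement5 (F : Type) [Field F] [CharP F 2]
    {n r s : ℕ} (q : QF F n) (c : Fin s → F)
    (haniso : QF.Anisotropic q) (hnq : ¬ QF.IsQuasilinear q)
    (hty : QF.HasTypeWith q r s c)
    (h : ℕ) (hh : 0 < h) :
    (QF.StronglyExcellentOfHeight q c h ∧ QF.hnd q = h) ↔
    ∃ (e : ℕ → ℕ) (Pf : ∀ i, QF F (2 ^ e i * 2)) (td : ℕ) (τ : QF F td) (a : F),
      a ≠ 0 ∧
      (∀ i, i < h → QF.IsPfister (e i) (Pf i) ∧ QF.Anisotropic (Pf i)) ∧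
      QF.IsQuasilinear τ ∧ QF.Anisotropic τ ∧
      QF.WittEquiv q (a • QF.orthSum (QF.sumFam Pf h) τ) ∧
      (∀ i, 1 ≤ i → i < h →
        QF.Subform (Pf i) (Pf (i - 1)) ∧ 2 ^ e i * 2 < 2 ^ e (i - 1) * 2) ∧
      QF.Dominated τ (Pf (h - 1)) ∧ 2 * td < 2 ^ e (h - 1) * 2 ∧
      (td = 0 → 2 ≤ h → 2 * (2 ^ e (h - 1) * 2) < 2 ^ e (h - 2) * 2) := by
  constructor
  · rintro ⟨hse, -⟩
    obtain ⟨g, rfl⟩ : ∃ g, h = g + 1 := ⟨h - 1, by omega⟩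
    exact QFX.forward F q c haniso g hse
  · rintro ⟨e, Pf, td, τ, a, ha, hPf, hτq, hτa, hw, hsub, hτd, htd, hiv⟩
    exact QFX.backward F q c haniso hty h hh e Pf td τ a ha hPf hτq hw hsub hτd htd hiv
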